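/- Let d ≥ 2 and let u : ℝ × ℝ^d → ℝ be a smooth function with each time slice of u, ∂_t u, and F Schwartz in x, satisfying ∂_t² u − Δ u + F = 0 on ℝ × ℝ^d. Then there is a constant C depending only on d such that ‖u‖_{L^{2(d+1)/(d−1)}_{t,x}(ℝ × ℝ^d)} ≤ C (‖u(0)‖_{Ḣ^{1/2}} + ‖∂_t u(0)‖_{Ḣ^{−1/2}} + ‖F‖_{L^{2(d+1)/(d+3)}_{t,x}(ℝ × ℝ^d)}). -/

import Mathlib

noncomputable section

open MeasureTheory Real Set
open scoped ENNReal RealInnerProductSpace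

/-- Euclidean space `ℝ^d`. -/
abbrev Euc (d : ℕ) := EuclideanSpace ℝ (Fin d)

/-- The time derivative `∂ₜ u` of a function `u : ℝ × ℝ^d → ℝ` (in curried form). -/
def timeDeriv (d : ℕ) (u : ℝ → Euc d → ℝ) (t : ℝ) (x : Euc d) : ℝ :=
  deriv (fun s => u s x) t

/-- The second time derivative `∂ₜ² u`. -/
def timeDeriv2 (d : ℕ) (u : ℝ → Euc d → ℝ) (t : ℝ) (x : Euc d) : ℝ :=
  deriv (deriv (fun s => u s x)) t

/-- The spatial Laplacian `Δf = ∑ⱼ ∂²f/∂xⱼ²`. -/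
def spatialLap (d : ℕ) (f : Euc d → ℝ) (x : Euc d) : ℝ :=
  ∑ i : Fin d,
    fderiv ℝ (fun y => fderiv ℝ f y (EuclideanSpace.single i 1)) x (EuclideanSpace.single i 1)

/-- A function on `ℝ^d` is radial if it depends only on `|x|`. -/
def IsRadial (d : ℕ) (f : Euc d → ℝ) : Prop := ∃ g : ℝ → ℝ, ∀ x, f x = g ‖x‖

/-- A classical solution of the defocusing conformal nonlinear wave equation
`∂ₜ²u − Δu + |u|^{4/(d−1)} u = 0`: a smooth function satisfying the equation pointwise,
whose time slices `u(t, ⬝)` and `∂ₜu(t, ⬝)` are (smooth and) compactly supported. -/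
def IsClassicalSolution (d : ℕ) (u : ℝ → Euc d → ℝ) : Prop :=
  ContDiff ℝ (⊤ : ℕ∞) (Function.uncurry u) ∧
  (∀ t, HasCompactSupport (u t)) ∧
  (∀ t, HasCompactSupport (fun x => timeDeriv d u t x)) ∧
  (∀ t x, timeDeriv2 d u t x - spatialLap d (u t) x
      + |u t x| ^ ((4 : ℝ) / ((d : ℝ) - 1)) * u t x = 0)

/-- The homogeneous Sobolev norm `‖f‖_{Ḣ^s} = (∫ |ξ|^{2s} |f̂(ξ)|² dξ)^{1/2}`,
valued in `[0, ∞]`. -/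
def sobolevNorm (d : ℕ) (s : ℝ) (f : Euc d → ℝ) : ℝ≥0∞ :=
  (∫⁻ ξ : Euc d,
    ENNReal.ofReal (‖ξ‖ ^ (2 * s) * ‖FourierTransform.fourier (fun x => (f x : ℂ)) ξ‖ ^ 2)) ^
    ((1 : ℝ) / 2)

/-- The space-time Lebesgue norm `‖u‖_{L^r_{t,x}(ℝ × ℝ^d)}`, valued in `[0, ∞]`. -/
def spacetimeNorm (d : ℕ) (r : ℝ≥0∞) (u : ℝ → Euc d → ℝ) : ℝ≥0∞ :=
  eLpNorm (Function.uncurry u) r volume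

/-- `f : ℝ^d → ℝ` agrees with a Schwartz function. -/
def IsSchwartzFn (d : ℕ) (f : Euc d → ℝ) : Prop :=
  ∃ φ : SchwartzMap (Euc d) ℝ, ∀ x, f x = φ x

namespace WaveStrichartz

/-- A parametric integral of holomorphic functions with a locally uniform integrable majorant is
holomorphic. -/
theorem differentiableOn_integral_of_dominated {α : Type*} [MeasurableSpace α] {μ : Measure α}
    {U : Set ℂ} (hU : IsOpen U) {F : ℂ → α → ℂ}
    (hmeas : ∀ z ∈ U, AEStronglyMeasurable (F z) μ)
    (hdiff : ∀ᵐ a ∂μ, DifferentiableOn ℂ (fun z => F z a) U)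
    (hbound : ∀ z ∈ U, ∃ δ > 0, ∃ g : α → ℝ, Integrable g μ ∧
      ∀ᵐ a ∂μ, ∀ w ∈ Metric.ball z δ, w ∈ U → ‖F w a‖ ≤ g a) :
    DifferentiableOn ℂ (fun z => ∫ a, F z a ∂μ) U := by
  intro z hz
  obtain ⟨δ₀, hδ₀, g, hg, hgb⟩ := hbound z hz
  obtain ⟨δ₁, hδ₁, hball⟩ := Metric.isOpen_iff.1 hU z hz
  set δ := min δ₀ δ₁ with hδdef
  have hδ : 0 < δ := lt_min hδ₀ hδ₁
  have hsub : Metric.ball z δ ⊆ U :=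
    (Metric.ball_subset_ball (min_le_right _ _)).trans hball
  have hsub' : Metric.ball z δ ⊆ Metric.ball z δ₀ := Metric.ball_subset_ball (min_le_left _ _)
  have hderiv : ∀ᵐ a ∂μ, ∀ w ∈ Metric.ball z (δ / 2),
      HasDerivAt (fun z => F z a) (deriv (fun z => F z a) w) w := by
    filter_upwards [hdiff] with a ha w hw
    have hw' : w ∈ U := hsub (Metric.ball_subset_ball (by linarith) hw)
    exact ((ha w hw').differentiableAt (hU.mem_nhds hw')).hasDerivAt
  have hF'meas : AEStronglyMeasurable (fun a => deriv (fun z => F z a) z) μ := by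
    let h : ℕ → ℂ := fun n => ((δ / 2 / ((n : ℝ) + 1) : ℝ) : ℂ)
    have hpos : ∀ n : ℕ, 0 < δ / 2 / ((n : ℝ) + 1) := fun n => by positivity
    have hle : ∀ n : ℕ, δ / 2 / ((n : ℝ) + 1) ≤ δ / 2 := fun n =>
      div_le_self (by positivity) (by linarith [n.cast_nonneg (α := ℝ)])
    have hh0 : ∀ n, h n ≠ 0 := fun n => by
      exact Complex.ofReal_ne_zero.2 (hpos n).ne'
    have hlim : Filter.Tendsto h Filter.atTop (nhdsWithin 0 {0}ᶜ) := by
      refine tendsto_nhdsWithin_iff.2 ⟨?_, Filter.Eventually.of_forall hh0⟩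
      have h1 : Filter.Tendsto (fun n : ℕ => δ / 2 / ((n : ℝ) + 1)) Filter.atTop (nhds 0) :=
        Filter.Tendsto.div_atTop tendsto_const_nhds
          (Filter.tendsto_atTop_add_const_right _ _ tendsto_natCast_atTop_atTop)
      exact (by simpa using (Complex.continuous_ofReal.tendsto 0).comp h1 :
        Filter.Tendsto (Complex.ofReal ∘ fun n : ℕ => δ / 2 / ((n : ℝ) + 1)) _ (nhds 0))
    refine aestronglyMeasurable_of_tendsto_ae Filter.atTop
      (f := fun n a => (h n)⁻¹ • (F (z + h n) a - F z a)) (fun n => ?_) ?_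
    · have hn : z + h n ∈ U := by
        refine hsub ?_
        simp only [Metric.mem_ball, dist_self_add_left, h, Complex.norm_real, Real.norm_eq_abs,
            abs_of_pos (hpos n)]
        linarith [hle n]
      exact ((hmeas _ hn).sub (hmeas z hz)).const_smul (h n)⁻¹
    · filter_upwards [hderiv] with a ha
      exact (hasDerivAt_iff_tendsto_slope_zero.1
        (ha z (Metric.mem_ball_self (by positivity)))).comp hlim
  have hb : ∀ᵐ a ∂μ, ∀ w ∈ Metric.ball z (δ / 2), ‖deriv (fun z => F z a) w‖ ≤ g a / (δ / 4) := by
    filter_upwards [hdiff, hgb] with a ha hga w hw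
    have hcl : Metric.closedBall w (δ / 4) ⊆ Metric.ball z δ := by
      intro v hv
      have h1 := Metric.mem_ball.1 hw
      have h2 := Metric.mem_closedBall.1 hv
      have := dist_triangle v w z
      exact Metric.mem_ball.2 (by linarith)
    refine Complex.norm_deriv_le_of_forall_mem_sphere_norm_le (by positivity) ?_ ?_
    · refine DifferentiableOn.diffContOnCl ?_
      rw [closure_ball _ (by positivity)]
      exact ha.mono (hcl.trans hsub)
    · intro v hv
      have := hcl (Metric.sphere_subset_closedBall hv)
      exact hga v (hsub' this) (hsub this)
  have h_integrable : Integrable (F z) μ := by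
    refine hg.mono' (hmeas z hz) ?_
    filter_upwards [hgb] with a ha using ha z (Metric.mem_ball_self hδ₀) hz
  exact (hasDerivAt_integral_of_dominated_loc_of_deriv_le (F' := fun w a => deriv (fun z => F z a) w)
    (Metric.ball_mem_nhds z (half_pos hδ))
    (Filter.eventually_of_mem (Metric.ball_mem_nhds z hδ) fun w hw => hmeas w (hsub hw)) h_integrable hF'meas
    hb (hg.div_const _) hderiv).2.differentiableAt.differentiableWithinAt

end WaveStrichartz

namespace WaveStrichartz

section Subordination

variable {a b : ℝ}

private lemma image_schlomilch (ha : 0 < a) (hb : 0 < b) :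
    (fun v : ℝ => b * v - a / v) '' Ioi 0 = univ := by
  refine eq_univ_of_forall fun w => ?_
  have hs : 0 < √(w ^ 2 + 4 * a * b) := Real.sqrt_pos.2 (by positivity)
  have hsq : √(w ^ 2 + 4 * a * b) ^ 2 = w ^ 2 + 4 * a * b := Real.sq_sqrt (by positivity)
  have hlt : |w| < √(w ^ 2 + 4 * a * b) := by
    rw [← Real.sqrt_sq_eq_abs]
    exact Real.sqrt_lt_sqrt (by positivity) (by nlinarith [mul_pos ha hb])
  have hpos : 0 < w + √(w ^ 2 + 4 * a * b) := by linarith [neg_abs_le w]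
  refine ⟨(w + √(w ^ 2 + 4 * a * b)) / (2 * b), div_pos hpos (by positivity), ?_⟩
  generalize √(w ^ 2 + 4 * a * b) = S at *
  have := hpos.ne'
  simp only
  rw [div_div_eq_mul_div, sub_eq_iff_eq_add, mul_div_assoc', div_eq_iff (by positivity), add_mul,
    div_mul_eq_mul_div, mul_div_assoc, eq_comm, ← eq_sub_iff_add_eq']
  field_simp
  nlinarith

private lemma injOn_schlomilch (ha : 0 < a) (hb : 0 < b) :
    InjOn (fun v : ℝ => b * v - a / v) (Ioi 0) := by
  have : StrictMonoOn (fun v : ℝ => b * v - a / v) (Ioi 0) := by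
    intro x hx y hy hxy
    have h1 : a / y ≤ a / x := div_le_div_of_nonneg_left ha.le hx hxy.le
    have h2 : b * x < b * y := by gcongr
    simp only
    linarith
  exact this.injOn

private lemma hasDerivWithinAt_schlomilch (v : ℝ) (hv : v ∈ Ioi (0 : ℝ)) :
    HasDerivWithinAt (fun v : ℝ => b * v - a / v) (b + a / v ^ 2) (Ioi 0) v := by
  have hv0 : v ≠ 0 := (ne_of_gt hv)
  have := ((hasDerivAt_id v).const_mul b).sub ((hasDerivAt_inv hv0).const_mul a)
  refine (this.congr_deriv ?_).hasDerivWithinAt.congr_of_mem ?_ hv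
  · simp; ring
  · intro x _; simp [div_eq_mul_inv]

private lemma schlomilch (ha : 0 < a) (hb : 0 < b) :
    IntegrableOn (fun v : ℝ => rexp (-(b * v - a / v) ^ 2)) (Ioi 0) ∧
      ∫ v in Ioi (0 : ℝ), rexp (-(b * v - a / v) ^ 2) = √π / (2 * b) := by
  set g : ℝ → ℝ := fun v => rexp (-(b * v - a / v) ^ 2) with hg
  have hgauss : Integrable (fun w : ℝ => rexp (-w ^ 2)) := by
    simpa using integrable_exp_neg_mul_sq (b := 1) one_pos
  have hI1 : IntegrableOn (fun v => |b + a / v ^ 2| • g v) (Ioi 0) := by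
    have := (integrableOn_image_iff_integrableOn_abs_deriv_smul (measurableSet_Ioi (a := (0 : ℝ)))
      (fun v hv => hasDerivWithinAt_schlomilch (a := a) (b := b) v hv) (injOn_schlomilch ha hb)
      (fun w : ℝ => rexp (-w ^ 2))).1
    rw [image_schlomilch ha hb] at this
    exact this (integrableOn_univ.2 hgauss)
  have hE1 : ∫ v in Ioi (0 : ℝ), |b + a / v ^ 2| • g v = √π := by
    rw [← integral_image_eq_integral_abs_deriv_smul (measurableSet_Ioi (a := (0 : ℝ)))
      (fun v hv => hasDerivWithinAt_schlomilch (a := a) (b := b) v hv) (injOn_schlomilch ha hb)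
      (fun w : ℝ => rexp (-w ^ 2)), image_schlomilch ha hb, Measure.restrict_univ]
    simpa using integral_gaussian 1
  have hgm : AEStronglyMeasurable g (volume.restrict (Ioi 0)) := by
    apply Measurable.aestronglyMeasurable; fun_prop
  have hIg : IntegrableOn g (Ioi 0) := by
    refine (hI1.const_mul b⁻¹).mono' hgm ?_
    refine (ae_restrict_iff' measurableSet_Ioi).2 (Filter.Eventually.of_forall fun v _ => ?_)
    have h0 : 0 < g v := Real.exp_pos _
    have h1 : 0 ≤ a / v ^ 2 := by positivity
    rw [Real.norm_of_nonneg h0.le, smul_eq_mul, abs_of_nonneg (by positivity), ← mul_assoc]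
    have : 1 ≤ b⁻¹ * (b + a / v ^ 2) := by
      rw [mul_add, inv_mul_cancel₀ hb.ne']
      have : 0 ≤ b⁻¹ * (a / v ^ 2) := by positivity
      linarith
    nlinarith
  have hinv : ∫ v in Ioi (0 : ℝ), a / v ^ 2 * g v = b * ∫ v in Ioi (0 : ℝ), g v := by
    have h1 := integral_comp_rpow_Ioi (fun y => g ((a / b) * y)) (p := -1) (by norm_num)
    rw [integral_comp_mul_left_Ioi g 0 (div_pos ha hb)] at h1
    simp only [mul_zero, smul_eq_mul, inv_div] at h1
    have h2 : ∫ v in Ioi (0 : ℝ), a / v ^ 2 * g v =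
        ∫ x in Ioi (0 : ℝ), a * (|(-1 : ℝ)| * x ^ ((-1 : ℝ) - 1) * g (a / b * x ^ (-1 : ℝ))) := by
      refine setIntegral_congr_fun measurableSet_Ioi fun x hx => ?_
      have hx0 : x ≠ 0 := (ne_of_gt hx)
      have e1 : x ^ ((-1 : ℝ) - 1) = (x ^ 2)⁻¹ := by
        rw [show ((-1 : ℝ) - 1) = -((2 : ℕ) : ℝ) by norm_num, Real.rpow_neg (le_of_lt hx),
          Real.rpow_natCast]
      have e2 : g (a / b * x ^ (-1 : ℝ)) = g x := by
        simp only [hg, Real.rpow_neg_one]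
        congr 2
        field_simp
        ring
      simp only [e1, e2]
      simp; ring
    rw [h2, integral_const_mul, h1]
    field_simp
  refine ⟨hIg, ?_⟩
  have hI2 : IntegrableOn (fun v => a / v ^ 2 * g v) (Ioi 0) := by
    have : EqOn (fun v => |b + a / v ^ 2| • g v - b * g v) (fun v => a / v ^ 2 * g v) (Ioi 0) := by
      intro v _
      have h1 : 0 ≤ a / v ^ 2 := by positivity
      simp only [smul_eq_mul, abs_of_nonneg (add_nonneg hb.le h1)]
      ring
    exact IntegrableOn.congr_fun (hI1.sub (hIg.const_mul b)) this measurableSet_Ioi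
  have hsum : ∫ v in Ioi (0 : ℝ), |b + a / v ^ 2| • g v =
      (b * ∫ v in Ioi (0 : ℝ), g v) + ∫ v in Ioi (0 : ℝ), a / v ^ 2 * g v := by
    rw [← integral_const_mul, ← integral_add (hIg.const_mul b) hI2]
    refine setIntegral_congr_fun measurableSet_Ioi fun v _ => ?_
    have h1 : 0 ≤ a / v ^ 2 := by positivity
    simp only [smul_eq_mul, abs_of_nonneg (add_nonneg hb.le h1)]
    ring
  rw [hE1, hinv] at hsum
  rw [hsum]
  field_simp
  ring

/-- The subordination formula, together with the convergence of the integral. -/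
theorem subordination (ha : 0 < a) (hb : 0 < b) :
    IntegrableOn (fun l : ℝ => l ^ (-(3 / 2) : ℝ) * rexp (-l * a ^ 2 - b ^ 2 / l)) (Ioi 0) ∧
      ∫ l in Ioi (0 : ℝ), l ^ (-(3 / 2) : ℝ) * rexp (-l * a ^ 2 - b ^ 2 / l) =
        √π / b * rexp (-2 * a * b) := by
  obtain ⟨hI, hE⟩ := schlomilch ha hb
  have key : EqOn (fun x : ℝ => (|(-2 : ℝ)| * x ^ ((-2 : ℝ) - 1)) •
      ((x ^ (-2 : ℝ)) ^ (-(3 / 2) : ℝ) * rexp (-(x ^ (-2 : ℝ)) * a ^ 2 - b ^ 2 / x ^ (-2 : ℝ))))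
      (fun v => 2 * rexp (-2 * a * b) * rexp (-(b * v - a / v) ^ 2)) (Ioi 0) := by
    intro x hx
    have hx0 : 0 < x := hx
    have e1 : (x ^ (-2 : ℝ)) ^ (-(3 / 2) : ℝ) = x ^ (3 : ℝ) := by
      rw [← Real.rpow_mul hx0.le]; norm_num
    have e2 : x ^ ((-2 : ℝ) - 1) * x ^ (3 : ℝ) = 1 := by
      rw [← Real.rpow_add hx0]; norm_num
    have e3 : x ^ (-2 : ℝ) = (x ^ 2)⁻¹ := by
      rw [Real.rpow_neg hx0.le]; norm_cast
    simp only [smul_eq_mul, e1]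
    rw [show |(-2 : ℝ)| = 2 by norm_num, mul_assoc 2, ← mul_assoc (x ^ ((-2 : ℝ) - 1)), e2, one_mul,
      mul_assoc 2, ← Real.exp_add, e3]
    congr 2
    field_simp
    ring
  constructor
  · rw [← integrableOn_Ioi_comp_rpow_iff _ (p := -2) (by norm_num)]
    exact IntegrableOn.congr_fun (hI.const_mul _) key.symm measurableSet_Ioi
  · rw [← integral_comp_rpow_Ioi _ (p := -2) (by norm_num),
      setIntegral_congr_fun measurableSet_Ioi key, integral_const_mul, hE]
    field_simp

end Subordination

end WaveStrichartz

namespace WaveStrichartz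

private lemma fourier_gaussian_inv {d : ℕ} {l : ℝ} (hl : 0 < l) (x : Euc d) :
    ∫ ξ : Euc d, Complex.exp (-(((π ^ 2 / l : ℝ) : ℂ)) * ‖ξ‖ ^ 2 + 2 * π * Complex.I * ⟪x, ξ⟫) =
      ((l / π : ℝ) : ℂ) ^ ((d : ℂ) / 2) * Complex.exp (-l * ‖x‖ ^ 2) := by
  rw [GaussianFourier.integral_cexp_neg_mul_sq_norm_add
    (by rw [Complex.ofReal_re]; positivity) (2 * π * Complex.I) x]
  have hπ : (π : ℂ) ≠ 0 := by exact_mod_cast Real.pi_ne_zero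
  have hl' : (l : ℂ) ≠ 0 := by exact_mod_cast hl.ne'
  congr 1
  · rw [finrank_euclideanSpace_fin]
    congr 1
    push_cast
    field_simp
  · congr 1
    rw [mul_pow, Complex.I_sq]
    push_cast
    field_simp
    ring

/-- The Fourier transform of a superposition of Gaussians with a power weight. -/
theorem integral_gaussian_superposition {d : ℕ} {a : ℝ} (ha : 0 < a) {w : ℂ}
    (hw : 0 < w.re + d / 2) (x : Euc d) :
    ∫ ξ : Euc d, (∫ l in Ioi (0 : ℝ), (l : ℂ) ^ (w - 1) *
        Complex.exp (-l * a ^ 2 - (π * ‖ξ‖) ^ 2 / l)) * Complex.exp (2 * π * Complex.I * ⟪x, ξ⟫) =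
      (π : ℂ) ^ (-((d : ℂ) / 2)) * Complex.Gamma (w + d / 2) *
        ((a : ℂ) ^ 2 + (‖x‖ : ℂ) ^ 2) ^ (-(w + d / 2)) := by
  set H : Euc d → ℝ → ℂ := fun ξ l => (l : ℂ) ^ (w - 1) *
    Complex.exp (-l * a ^ 2 - (π * ‖ξ‖) ^ 2 / l) * Complex.exp (2 * π * Complex.I * ⟪x, ξ⟫) with hH
  have hnorm : ∀ l ∈ Ioi (0 : ℝ), ∀ ξ : Euc d, ‖H ξ l‖ =
      l ^ (w.re - 1) * rexp (-l * a ^ 2) * rexp (-(π ^ 2 / l) * ‖ξ‖ ^ 2) := by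
    intro l hl ξ
    have e1 : Complex.exp (-l * a ^ 2 - (π * ‖ξ‖) ^ 2 / l) =
        ((rexp (-l * a ^ 2) * rexp (-(π ^ 2 / l) * ‖ξ‖ ^ 2) : ℝ) : ℂ) := by
      rw [← Real.exp_add]; push_cast; congr 1; ring
    have e2 : ‖Complex.exp (2 * π * Complex.I * ⟪x, ξ⟫)‖ = 1 := by
      rw [show (2 * π * Complex.I * ⟪x, ξ⟫ : ℂ) = ((2 * π * ⟪x, ξ⟫ : ℝ) : ℂ) * Complex.I by
        push_cast; ring, Complex.norm_exp_ofReal_mul_I]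
    rw [hH]
    simp only [norm_mul, e2, e1, Complex.norm_real]
    rw [Complex.norm_cpow_eq_rpow_re_of_pos hl, Complex.sub_re, Complex.one_re,
      Real.norm_of_nonneg (Real.exp_pos _).le, Real.norm_of_nonneg (Real.exp_pos _).le]
    ring
  have hmeas : Measurable (Function.uncurry H) := by
    apply Measurable.mul
    · apply Measurable.mul
      · exact (Complex.measurable_ofReal.comp measurable_snd).pow_const _
      · fun_prop
    · apply Continuous.measurable; fun_prop
  have h_integrable : Integrable (Function.uncurry H) (volume.prod (volume.restrict (Ioi 0))) := by
    refine (integrable_prod_iff' hmeas.aestronglyMeasurable).2 ⟨?_, ?_⟩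
    · refine (ae_restrict_iff' measurableSet_Ioi).2 (Filter.Eventually.of_forall fun l hl => ?_)
      have hg := (GaussianFourier.integrable_cexp_neg_mul_sq_norm_add (V := Euc d)
        (b := ((π ^ 2 / l : ℝ) : ℂ)) (by rw [Complex.ofReal_re]; have := mem_Ioi.1 hl; positivity)
        0 0).norm
      refine (hg.const_mul (l ^ (w.re - 1) * rexp (-l * a ^ 2))).mono'
        (hmeas.comp measurable_prodMk_right).aestronglyMeasurable
        (Filter.Eventually.of_forall fun ξ => ?_)
      have h1 := hnorm l hl ξ
      simp only [Function.uncurry_apply_pair] at h1 ⊢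
      rw [h1]
      simp only [Complex.norm_exp]
      apply le_of_eq
      congr 2
      have : (-(((π ^ 2 / l : ℝ) : ℂ)) * (‖ξ‖ : ℂ) ^ 2 + 0 * ((inner ℝ (0 : Euc d) ξ : ℝ) : ℂ)) =
        ((-(π ^ 2 / l) * ‖ξ‖ ^ 2 : ℝ) : ℂ) := by push_cast; ring
      rw [this, Complex.ofReal_re]
    · have hE : EqOn (fun l : ℝ => ∫ ξ : Euc d, ‖Function.uncurry H (ξ, l)‖)
          (fun l => π ^ (-((d : ℝ) / 2)) * (l ^ (w.re + d / 2 - 1) * rexp (-(a ^ 2) * l)))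
          (Ioi 0) := by
        intro l hl
        have hl0 : 0 < l := hl
        have h1 : ∀ ξ : Euc d, ‖Function.uncurry H (ξ, l)‖ = _ := hnorm l hl
        simp only [h1]
        rw [integral_const_mul, GaussianFourier.integral_rexp_neg_mul_sq_norm (by positivity),
          finrank_euclideanSpace_fin, show π / (π ^ 2 / l) = π⁻¹ * l by field_simp,
          Real.mul_rpow (by positivity) hl0.le, Real.inv_rpow pi_pos.le,
          Real.rpow_neg pi_pos.le, show w.re + d / 2 - 1 = (w.re - 1) + d / 2 by ring,
          Real.rpow_add hl0, show -l * a ^ 2 = -(a ^ 2) * l by ring]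
        ring
      refine IntegrableOn.congr_fun ?_ hE.symm measurableSet_Ioi
      refine Integrable.const_mul ?_ _
      have := integrableOn_rpow_mul_exp_neg_mul_rpow (p := 1) (s := w.re + d / 2 - 1)
        (b := a ^ 2) (by linarith) one_pos (by positivity)
      simpa [IntegrableOn] using this
  calc _ = ∫ ξ : Euc d, ∫ l in Ioi (0 : ℝ), H ξ l := by
        refine integral_congr_ae (Filter.Eventually.of_forall fun ξ => ?_)
        simp only [hH]
        rw [integral_mul_const]
    _ = ∫ l in Ioi (0 : ℝ), ∫ ξ : Euc d, H ξ l := integral_integral_swap h_integrable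
    _ = ∫ l in Ioi (0 : ℝ), (π : ℂ) ^ (-((d : ℂ) / 2)) * ((l : ℂ) ^ (w + d / 2 - 1) *
          Complex.exp (-(((a : ℂ) ^ 2 + (‖x‖ : ℂ) ^ 2) * l))) := by
        refine setIntegral_congr_fun measurableSet_Ioi fun l hl => ?_
        have hl0 : (0 : ℝ) < l := hl
        have hl' : (l : ℂ) ≠ 0 := by exact_mod_cast hl0.ne'
        have h1 : ∀ ξ, H ξ l = ((l : ℂ) ^ (w - 1) * Complex.exp (-l * a ^ 2)) *
            Complex.exp (-(((π ^ 2 / l : ℝ) : ℂ)) * ‖ξ‖ ^ 2 + 2 * π * Complex.I * ⟪x, ξ⟫) := by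
          intro ξ
          simp only [hH]
          rw [mul_assoc, mul_assoc ((l : ℂ) ^ (w - 1)), ← Complex.exp_add, ← Complex.exp_add]
          congr 2
          push_cast
          field_simp
          ring
        simp only [h1]
        rw [integral_const_mul, fourier_gaussian_inv hl0, Complex.ofReal_div,
          show w + (d : ℂ) / 2 - 1 = (w - 1) + d / 2 by ring, Complex.cpow_add _ _ hl',
          div_eq_mul_inv, mul_comm (l : ℂ), ← Complex.ofReal_inv,
          Complex.mul_cpow_ofReal_nonneg (by positivity) hl0.le, Complex.ofReal_inv,
          Complex.inv_cpow _ _ (by rw [Complex.arg_ofReal_of_nonneg pi_pos.le]; exact pi_pos.ne),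
          Complex.cpow_neg, show -(((a : ℂ) ^ 2 + (‖x‖ : ℂ) ^ 2) * l) = -l * a ^ 2 + -l * ‖x‖ ^ 2 by
            ring, Complex.exp_add]
        ring
    _ = _ := by
        have hr : 0 < a ^ 2 + ‖x‖ ^ 2 := by positivity
        have hc : (a : ℂ) ^ 2 + (‖x‖ : ℂ) ^ 2 = ((a ^ 2 + ‖x‖ ^ 2 : ℝ) : ℂ) := by push_cast; rfl
        rw [integral_const_mul, hc, Complex.integral_cpow_mul_exp_neg_mul_Ioi (a := w + d / 2)
          (by simpa using hw) hr, one_div, Complex.inv_cpow, Complex.cpow_neg _ (w + d / 2)]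
        · ring
        · rw [Complex.arg_ofReal_of_nonneg hr.le]
          exact pi_pos.ne

end WaveStrichartz

namespace WaveStrichartz

/-- Two holomorphic functions on the right half-plane agreeing on the positive reals agree. -/
theorem eq_of_eq_on_pos_real {f g : ℂ → ℂ} (hf : DifferentiableOn ℂ f {z | 0 < z.re})
    (hg : DifferentiableOn ℂ g {z | 0 < z.re}) (h : ∀ a : ℝ, 0 < a → f a = g a) {z : ℂ}
    (hz : 0 < z.re) : f z = g z := by
  have hopen : IsOpen {z : ℂ | 0 < z.re} := isOpen_lt continuous_const Complex.continuous_re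
  have hconn : IsPreconnected {z : ℂ | 0 < z.re} := (convex_halfSpace_re_gt 0).isPreconnected
  refine (hf.analyticOnNhd hopen).eqOn_of_preconnected_of_frequently_eq (hg.analyticOnNhd hopen)
    hconn (z₀ := 1) (by simp) ?_ hz
  have hlim : Filter.Tendsto (fun n : ℕ => (((1 + 1 / ((n : ℝ) + 1) : ℝ)) : ℂ)) Filter.atTop
      (nhdsWithin 1 {1}ᶜ) := by
    refine tendsto_nhdsWithin_iff.2 ⟨?_, Filter.Eventually.of_forall fun n => ?_⟩
    · have h1 : Filter.Tendsto (fun n : ℕ => 1 + 1 / ((n : ℝ) + 1)) Filter.atTop (nhds 1) := by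
        simpa using (tendsto_one_div_add_atTop_nhds_zero_nat (𝕜 := ℝ)).const_add 1
      exact (by simpa using (Complex.continuous_ofReal.tendsto 1).comp h1 :
        Filter.Tendsto (Complex.ofReal ∘ fun n : ℕ => 1 + 1 / ((n : ℝ) + 1)) _ (nhds 1))
    · have : (0 : ℝ) < 1 / ((n : ℝ) + 1) := by positivity
      simp only [mem_compl_iff, mem_singleton_iff]
      intro h
      have h2 : (1 + 1 / ((n : ℝ) + 1) : ℝ) = 1 := by exact_mod_cast h
      linarith
  refine hlim.frequently (Filter.Frequently.of_forall fun n => ?_)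
  exact h _ (by positivity)

/-- `a² + c²` avoids the negative real axis when `Re a > 0`. -/
theorem sq_add_sq_mem_slitPlane {a : ℂ} (ha : 0 < a.re) (c : ℝ) :
    a ^ 2 + (c : ℂ) ^ 2 ∈ Complex.slitPlane := by
  rw [Complex.mem_slitPlane_iff]
  by_cases h : a.im = 0
  · left
    simp only [sq, Complex.add_re, Complex.mul_re, Complex.ofReal_re, Complex.ofReal_im, h]
    nlinarith [mul_pos ha ha, mul_self_nonneg c]
  · right
    simp only [sq, Complex.add_im, Complex.mul_im, Complex.ofReal_re, Complex.ofReal_im]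
    intro h2
    have : a.re * a.im = 0 := by linarith
    rcases mul_eq_zero.1 this with h3 | h3
    · exact ha.ne' h3
    · exact h h3

/-- The modulus of `a² + c²` is at least `(Re a)²`. -/
theorem sq_re_le_norm_sq_add_sq (a : ℂ) (c : ℝ) : a.re ^ 2 ≤ ‖a ^ 2 + (c : ℂ) ^ 2‖ := by
  have h1 : a ^ 2 + (c : ℂ) ^ 2 = (a + c * Complex.I) * (a - c * Complex.I) := by
    ring_nf; rw [Complex.I_sq]; ring
  rw [h1, norm_mul, sq, ← abs_mul_abs_self]
  refine mul_le_mul ?_ ?_ (abs_nonneg _) (norm_nonneg _)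
  · simpa using Complex.abs_re_le_norm (a + c * Complex.I)
  · simpa using Complex.abs_re_le_norm (a - c * Complex.I)

theorem differentiableOn_sq_add_sq_cpow (c : ℝ) (s : ℂ) :
    DifferentiableOn ℂ (fun a : ℂ => (a ^ 2 + (c : ℂ) ^ 2) ^ s) {z | 0 < z.re} := by
  intro a ha
  refine DifferentiableAt.differentiableWithinAt ?_
  exact DifferentiableAt.cpow (by fun_prop) (by fun_prop) (sq_add_sq_mem_slitPlane ha c)

theorem norm_cexp_two_pi_I_inner {d : ℕ} (x ξ : Euc d) :
    ‖Complex.exp (2 * π * Complex.I * ⟪x, ξ⟫)‖ = 1 := by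
  rw [show (2 * π * Complex.I * ⟪x, ξ⟫ : ℂ) = ((2 * π * ⟪x, ξ⟫ : ℝ) : ℂ) * Complex.I by
    push_cast; ring, Complex.norm_exp_ofReal_mul_I]

theorem integrable_norm_rpow_mul_exp {d : ℕ} (hd : 1 ≤ d) {k c : ℝ} (hk : -(d : ℝ) < k)
    (hc : 0 < c) : Integrable (fun ξ : Euc d => ‖ξ‖ ^ k * rexp (-c * ‖ξ‖)) := by
  have : Nontrivial (Euc d) := by
    have : Nonempty (Fin d) := ⟨⟨0, hd⟩⟩
    infer_instance
  refine (integrable_fun_norm_addHaar volume (f := fun r => r ^ k * rexp (-c * r))).2 ?_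
  have h1 := integrableOn_rpow_mul_exp_neg_mul_rpow (p := 1) (s := k + d - 1) (b := c)
    (by linarith) one_pos hc
  refine IntegrableOn.congr_fun h1 (fun r hr => ?_) measurableSet_Ioi
  have hr0 : (0 : ℝ) < r := hr
  simp only [finrank_euclideanSpace_fin, smul_eq_mul, Real.rpow_one]
  rw [← mul_assoc, ← Real.rpow_natCast r (d - 1), ← Real.rpow_add hr0, Nat.cast_sub hd]
  congr 2
  push_cast
  ring

theorem ae_norm_pos {d : ℕ} (hd : 1 ≤ d) : ∀ᵐ ξ : Euc d, 0 < ‖ξ‖ := by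
  have : Nontrivial (Euc d) := by
    have : Nonempty (Fin d) := ⟨⟨0, hd⟩⟩
    infer_instance
  filter_upwards [compl_mem_ae_iff.2 (measure_singleton (μ := (volume : Measure (Euc d))) 0)] with ξ h
  exact norm_pos_iff.2 h

/-- The normalising constant of the half-wave kernel. -/
def waveConst (d : ℕ) : ℂ := √π * (π : ℂ) ^ (-((d : ℂ) / 2)) * Complex.Gamma (((d : ℂ) - 1) / 2)

/-- The half-wave kernel with complex time `a`. -/
def waveKernel {d : ℕ} (a : ℂ) (x : Euc d) : ℂ :=
  waveConst d * (a ^ 2 + (‖x‖ : ℂ) ^ 2) ^ (-(((d : ℂ) - 1) / 2))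

theorem integral_exp_div_norm_of_pos {d : ℕ} (hd : 2 ≤ d) {a : ℝ} (ha : 0 < a) (x : Euc d) :
    ∫ ξ : Euc d, Complex.exp (-2 * π * a * ‖ξ‖) / ‖ξ‖ * Complex.exp (2 * π * Complex.I * ⟪x, ξ⟫) =
      waveKernel (a : ℂ) x := by
  have hd' : (2 : ℝ) ≤ d := by exact_mod_cast hd
  have h := integral_gaussian_superposition (d := d) ha (w := -1 / 2) (by norm_num; linarith) x
  have hae : ∀ᵐ ξ : Euc d, (∫ l in Ioi (0 : ℝ), (l : ℂ) ^ ((-1 / 2 : ℂ) - 1) *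
        Complex.exp (-l * a ^ 2 - (π * ‖ξ‖) ^ 2 / l)) * Complex.exp (2 * π * Complex.I * ⟪x, ξ⟫) =
      (√π / π : ℂ) * (Complex.exp (-2 * π * a * ‖ξ‖) / ‖ξ‖ *
        Complex.exp (2 * π * Complex.I * ⟪x, ξ⟫)) := by
    filter_upwards [ae_norm_pos (d := d) (by omega)] with ξ hξ
    have hs := (subordination ha (b := π * ‖ξ‖) (by positivity)).2
    have : ∫ l in Ioi (0 : ℝ), (l : ℂ) ^ ((-1 / 2 : ℂ) - 1) *
        Complex.exp (-l * a ^ 2 - (π * ‖ξ‖) ^ 2 / l) =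
        ((√π / (π * ‖ξ‖) * rexp (-2 * a * (π * ‖ξ‖)) : ℝ) : ℂ) := by
      rw [← hs, ← integral_complex_ofReal]
      refine setIntegral_congr_fun measurableSet_Ioi fun l hl => ?_
      have hl0 : (0 : ℝ) < l := hl
      push_cast
      rw [Complex.ofReal_cpow hl0.le]
      congr 2
      push_cast
      norm_num
    rw [this, ← mul_assoc (√π / π : ℂ)]
    congr 1
    push_cast
    rw [show (-2 * (a : ℂ) * (π * ‖ξ‖)) = -2 * π * a * ‖ξ‖ by ring, div_mul_eq_mul_div,
      div_mul_div_comm]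
  rw [integral_congr_ae hae, integral_const_mul] at h
  have hπ : (√π : ℂ) ≠ 0 := by exact_mod_cast (Real.sqrt_pos.2 pi_pos).ne'
  have hππ : (π : ℂ) = (√π : ℂ) * √π := by
    exact_mod_cast (Real.mul_self_sqrt pi_pos.le).symm
  rw [waveKernel, waveConst]
  have e : (-1 / 2 : ℂ) + d / 2 = ((d : ℂ) - 1) / 2 := by ring
  rw [e] at h
  have hh : (√π / π : ℂ) = (√π : ℂ)⁻¹ := by
    rw [hππ]
    field_simp
  rw [hh, inv_mul_eq_iff_eq_mul₀ hπ] at h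
  rw [h]
  ring

/-- The half-wave kernel is the Fourier transform of `e^{-2πa|ξ|}/|ξ|`. -/
theorem integral_exp_div_norm {d : ℕ} (hd : 2 ≤ d) {a : ℂ} (ha : 0 < a.re) (x : Euc d) :
    ∫ ξ : Euc d, Complex.exp (-2 * π * a * ‖ξ‖) / ‖ξ‖ * Complex.exp (2 * π * Complex.I * ⟪x, ξ⟫) =
      waveKernel a x := by
  refine eq_of_eq_on_pos_real (f := fun a => ∫ ξ : Euc d, Complex.exp (-2 * π * a * ‖ξ‖) / ‖ξ‖ *
    Complex.exp (2 * π * Complex.I * ⟪x, ξ⟫)) (g := fun a => waveKernel a x) ?_ ?_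
    (fun a ha => integral_exp_div_norm_of_pos hd ha x) ha
  · refine differentiableOn_integral_of_dominated
      (isOpen_lt continuous_const Complex.continuous_re) (fun z _ => ?_) ?_ (fun z hz => ?_)
    · apply Measurable.aestronglyMeasurable
      fun_prop
    · exact Filter.Eventually.of_forall fun ξ => by fun_prop
    · have hz : 0 < z.re := hz
      refine ⟨z.re / 2, by positivity, fun ξ => ‖ξ‖ ^ (-1 : ℝ) * rexp (-(π * z.re) * ‖ξ‖),
        integrable_norm_rpow_mul_exp (by omega) ?_ (by positivity),
        Filter.Eventually.of_forall fun ξ w hw _ => ?_⟩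
      · have hd' : (2 : ℝ) ≤ d := by exact_mod_cast hd
        linarith
      · have h1 : z.re / 2 ≤ w.re := by
          have h2 := Complex.abs_re_le_norm (w - z)
          rw [← dist_eq_norm, Complex.sub_re] at h2
          have h3 := Metric.mem_ball.1 hw
          have := neg_abs_le (w.re - z.re)
          linarith
        rw [norm_mul, norm_cexp_two_pi_I_inner, mul_one, norm_div, Complex.norm_exp,
          Complex.norm_real, norm_norm]
        simp only [Real.rpow_neg_one]
        rw [div_eq_inv_mul]
        refine mul_le_mul_of_nonneg_left (Real.exp_le_exp.2 ?_) (by positivity)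
        have : (-2 * π * w * ‖ξ‖ : ℂ).re = -(2 * π * w.re) * ‖ξ‖ := by
          rw [show (-2 * π * w * ‖ξ‖ : ℂ) = ((-2 * π * ‖ξ‖ : ℝ) : ℂ) * w by push_cast; ring,
            Complex.re_ofReal_mul]
          ring
        rw [this]
        refine mul_le_mul_of_nonneg_right ?_ (norm_nonneg _)
        nlinarith [pi_pos]
  · exact (differentiableOn_sq_add_sq_cpow _ _).const_mul _

end WaveStrichartz

namespace WaveStrichartz

/-- The integral factor in the multiplier of `(a² + |x|²)^{-(d+1)/2 - iy}`. -/
def besselFactor (y : ℝ) (a : ℂ) (b : ℝ) : ℂ :=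
  ∫ r in Ioi (0 : ℝ), (rexp (-(2 * π * r)) : ℂ) * (r : ℂ) ^ (y * Complex.I) *
    (r / a + 2 * b) ^ (y * Complex.I)

/-- The Fourier multiplier of `(a² + |x|²)^{-(d+1)/2 - iy}`, up to normalisation. -/
def besselMultiplier (y : ℝ) (a : ℂ) (b : ℝ) : ℂ :=
  Complex.exp (-2 * π * a * b) * a ^ (-(1 + y * Complex.I)) * besselFactor y a b

theorem integrableOn_gaussian_power {a b : ℝ} (ha : 0 < a) {k : ℝ} (hk : -1 < k) :
    IntegrableOn (fun l : ℝ => l ^ k * rexp (-l * a ^ 2 - b ^ 2 / l)) (Ioi 0) := by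
  have h1 := integrableOn_rpow_mul_exp_neg_mul_rpow (p := 1) (s := k)
    (b := a ^ 2) hk one_pos (by positivity)
  refine Integrable.mono' h1 ?_ ?_
  · apply Measurable.aestronglyMeasurable; fun_prop
  · refine (ae_restrict_iff' measurableSet_Ioi).2 (Filter.Eventually.of_forall fun l hl => ?_)
    have hl0 : (0 : ℝ) < l := hl
    rw [Real.norm_of_nonneg (by positivity), Real.rpow_one]
    refine mul_le_mul_of_nonneg_left (Real.exp_le_exp.2 ?_) (by positivity)
    have : 0 ≤ b ^ 2 / l := by positivity
    linarith

private lemma bessel_fubini {a b : ℝ} (ha : 0 < a) (hb : 0 < b) (y : ℝ) :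
    Complex.Gamma (1 + y * Complex.I) * (π : ℂ) ^ (-2 * (1 + y * Complex.I)) *
      ∫ l in Ioi (0 : ℝ), (l : ℂ) ^ ((1 / 2 + y * Complex.I) - 1) *
        Complex.exp (-l * a ^ 2 - (π * b) ^ 2 / l) =
    ∫ u in Ioi (0 : ℝ), (u : ℂ) ^ (y * Complex.I) *
      ((√π / (π * √(u + b ^ 2)) * rexp (-2 * a * (π * √(u + b ^ 2))) : ℝ) : ℂ) := by
  set s : ℂ := y * Complex.I with hs
  have hsre : s.re = 0 := by simp [hs]
  set H : ℝ → ℝ → ℂ := fun l u => (u : ℂ) ^ s *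
    ((l ^ (-(3 / 2) : ℝ) * rexp (-l * a ^ 2 - (π * √(u + b ^ 2)) ^ 2 / l) : ℝ) : ℂ) with hH
  have hsqrt : ∀ u ∈ Ioi (0 : ℝ), (π * √(u + b ^ 2)) ^ 2 = π ^ 2 * u + (π * b) ^ 2 := by
    intro u hu
    have hu0 : (0 : ℝ) < u := hu
    rw [mul_pow, Real.sq_sqrt (by positivity)]
    ring
  have hmeas : Measurable (Function.uncurry H) := by
    apply Measurable.mul
    · exact (Complex.measurable_ofReal.comp measurable_snd).pow_const _
    · apply Complex.measurable_ofReal.comp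
      fun_prop
  have hHeq : ∀ l ∈ Ioi (0 : ℝ), ∀ u ∈ Ioi (0 : ℝ), H l u =
      ((l ^ (-(3 / 2) : ℝ) * rexp (-l * a ^ 2 - (π * b) ^ 2 / l) : ℝ) : ℂ) *
        ((u : ℂ) ^ ((1 + s) - 1) * Complex.exp (-(((π ^ 2 / l : ℝ) : ℂ) * u))) := by
    intro l hl u hu
    have hl0 : (0 : ℝ) < l := hl
    simp only [hH]
    rw [hsqrt u hu, show -l * a ^ 2 - (π ^ 2 * u + (π * b) ^ 2) / l =
      (-l * a ^ 2 - (π * b) ^ 2 / l) + (-((π ^ 2 / l) * u)) by ring, Real.exp_add,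
      add_sub_cancel_left]
    push_cast
    ring
  have h_integrable : Integrable (Function.uncurry H)
      ((volume.restrict (Ioi 0)).prod (volume.restrict (Ioi 0))) := by
    refine (integrable_prod_iff hmeas.aestronglyMeasurable).2 ⟨?_, ?_⟩
    · refine (ae_restrict_iff' measurableSet_Ioi).2 (Filter.Eventually.of_forall fun l hl => ?_)
      have hl0 : (0 : ℝ) < l := hl
      have h1 := integrableOn_rpow_mul_exp_neg_mul_rpow (p := 1) (s := 0)
        (b := π ^ 2 / l) (by norm_num) one_pos (by positivity)
      refine Integrable.mono' (h1.const_mul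
        (l ^ (-(3 / 2) : ℝ) * rexp (-l * a ^ 2 - (π * b) ^ 2 / l)))
        (hmeas.comp measurable_prodMk_left).aestronglyMeasurable ?_
      refine (ae_restrict_iff' measurableSet_Ioi).2 (Filter.Eventually.of_forall fun u hu => ?_)
      have hu0 : (0 : ℝ) < u := hu
      simp only [Function.uncurry_apply_pair]
      rw [hHeq l hl u hu, norm_mul, norm_mul, Complex.norm_real, Real.norm_of_nonneg (by positivity),
        Complex.norm_cpow_eq_rpow_re_of_pos hu0, add_sub_cancel_left, hsre,
        ← Complex.ofReal_mul, ← Complex.ofReal_neg, Complex.norm_exp_ofReal, Real.rpow_one, neg_mul (π ^ 2 / l)]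
    · have hE : EqOn (fun l : ℝ => ∫ u in Ioi (0 : ℝ), ‖Function.uncurry H (l, u)‖)
          (fun l => (π ^ 2)⁻¹ * (l ^ (-(1 / 2) : ℝ) * rexp (-l * a ^ 2 - (π * b) ^ 2 / l)))
          (Ioi 0) := by
        intro l hl
        have hl0 : (0 : ℝ) < l := hl
        have h2 : ∫ u in Ioi (0 : ℝ), ‖Function.uncurry H (l, u)‖ =
            ∫ u in Ioi (0 : ℝ), (l ^ (-(3 / 2) : ℝ) * rexp (-l * a ^ 2 - (π * b) ^ 2 / l)) *
              rexp (-(π ^ 2 / l) * u) := by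
          refine setIntegral_congr_fun measurableSet_Ioi fun u hu => ?_
          have hu0 : (0 : ℝ) < u := hu
          simp only [Function.uncurry_apply_pair]
          rw [hHeq l hl u hu, norm_mul, norm_mul, Complex.norm_real,
            Real.norm_of_nonneg (by positivity), Complex.norm_cpow_eq_rpow_re_of_pos hu0,
            add_sub_cancel_left, hsre, ← Complex.ofReal_mul, ← Complex.ofReal_neg,
            Complex.norm_exp_ofReal, Real.rpow_zero, one_mul, neg_mul (π ^ 2 / l)]
        simp only
        rw [h2, integral_const_mul, integral_exp_mul_Ioi (by
          rw [neg_lt_zero]; positivity) 0, mul_zero, Real.exp_zero,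
          show (-(1 / 2) : ℝ) = -(3 / 2) + 1 by norm_num, Real.rpow_add hl0, Real.rpow_one]
        field_simp
      refine IntegrableOn.congr_fun ?_ hE.symm measurableSet_Ioi
      exact Integrable.const_mul (integrableOn_gaussian_power ha (by norm_num)) _
  have hL : ∀ l ∈ Ioi (0 : ℝ), ∫ u in Ioi (0 : ℝ), H l u =
      Complex.Gamma (1 + s) * (π : ℂ) ^ (-2 * (1 + s)) * ((l : ℂ) ^ ((1 / 2 + s) - 1) *
        Complex.exp (-l * a ^ 2 - (π * b) ^ 2 / l)) := by
    intro l hl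
    have hl0 : (0 : ℝ) < l := hl
    have hl' : (l : ℂ) ≠ 0 := by exact_mod_cast hl0.ne'
    have hπ' : (π : ℂ) ≠ 0 := by exact_mod_cast pi_pos.ne'
    rw [setIntegral_congr_fun measurableSet_Ioi (fun u hu => hHeq l hl u hu), integral_const_mul,
      Complex.integral_cpow_mul_exp_neg_mul_Ioi (a := 1 + s) (by simp [hsre]) (by positivity)]
    have e1 : (1 / ((π ^ 2 / l : ℝ) : ℂ)) ^ (1 + s) =
        (l : ℂ) ^ (1 + s) * (π : ℂ) ^ (-2 * (1 + s)) := by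
      rw [show (1 / ((π ^ 2 / l : ℝ) : ℂ)) = (l : ℂ) * ((π⁻¹ ^ 2 : ℝ) : ℂ) by
          push_cast; field_simp, Complex.mul_cpow_ofReal_nonneg hl0.le (by positivity)]
      congr 1
      rw [← Real.rpow_natCast, ← Real.rpow_neg_one, ← Real.rpow_mul pi_pos.le,
        Complex.ofReal_cpow pi_pos.le, ← Complex.cpow_mul]
      · congr 1; push_cast; ring
      · rw [← Complex.ofReal_log pi_pos.le, ← Complex.ofReal_mul, Complex.ofReal_im]
        linarith [pi_pos]
      · rw [← Complex.ofReal_log pi_pos.le, ← Complex.ofReal_mul, Complex.ofReal_im]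
        exact pi_pos.le
    rw [e1]
    push_cast
    rw [Complex.ofReal_cpow hl0.le, show (1 / 2 + s) - 1 = ((-(3 / 2) : ℝ) : ℂ) + (1 + s) by
      push_cast; ring, Complex.cpow_add ((-(3 / 2) : ℝ) : ℂ) (1 + s) hl']
    ring
  rw [← integral_const_mul]
  calc _ = ∫ l in Ioi (0 : ℝ), ∫ u in Ioi (0 : ℝ), H l u :=
        setIntegral_congr_fun measurableSet_Ioi fun l hl => (hL l hl).symm
    _ = ∫ u in Ioi (0 : ℝ), ∫ l in Ioi (0 : ℝ), H l u := integral_integral_swap h_integrable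
    _ = _ := by
        refine setIntegral_congr_fun measurableSet_Ioi fun u hu => ?_
        have hu0 : (0 : ℝ) < u := hu
        simp only [hH]
        rw [integral_const_mul, integral_complex_ofReal,
          (subordination ha (b := π * √(u + b ^ 2)) (by positivity)).2]

private lemma bessel_change {a b : ℝ} (ha : 0 < a) (hb : 0 < b) (y : ℝ) :
    ∫ u in Ioi (0 : ℝ), (u : ℂ) ^ (y * Complex.I) *
      ((√π / (π * √(u + b ^ 2)) * rexp (-2 * a * (π * √(u + b ^ 2))) : ℝ) : ℂ) =
    (2 / √π : ℂ) * besselMultiplier y a b := by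
  set s : ℂ := y * Complex.I with hs
  have himg : (fun r : ℝ => r / a * (r / a + 2 * b)) '' Ioi 0 = Ioi 0 := by
    ext u
    constructor
    · rintro ⟨r, hr, rfl⟩
      have hr0 : (0 : ℝ) < r := hr
      exact mem_Ioi.2 (by positivity)
    · intro hu
      have hu0 : (0 : ℝ) < u := hu
      have h1 : √(b ^ 2) < √(u + b ^ 2) := Real.sqrt_lt_sqrt (by positivity) (by linarith)
      rw [Real.sqrt_sq hb.le] at h1
      refine ⟨a * (√(u + b ^ 2) - b), mul_pos ha (by linarith), ?_⟩
      have h2 := Real.sq_sqrt (show 0 ≤ u + b ^ 2 by positivity)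
      simp only
      rw [mul_div_assoc, mul_div_cancel₀ _ ha.ne']
      nlinarith
  have hinj : InjOn (fun r : ℝ => r / a * (r / a + 2 * b)) (Ioi 0) := by
    refine StrictMonoOn.injOn fun r hr r' hr' hrr => ?_
    have hr0 : (0 : ℝ) < r := hr
    have h1 : r / a < r' / a := by gcongr
    have h2 : 0 < r / a := by positivity
    nlinarith
  have hder : ∀ r ∈ Ioi (0 : ℝ), HasDerivWithinAt (fun r : ℝ => r / a * (r / a + 2 * b))
      (2 / a * (r / a + b)) (Ioi 0) r := by
    intro r _
    have h1 : HasDerivAt (fun r : ℝ => r / a) (1 / a) r := (hasDerivAt_id r).div_const a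
    refine ((h1.mul (h1.add_const (2 * b))).congr_deriv ?_).hasDerivWithinAt
    ring
  have := integral_image_eq_integral_abs_deriv_smul measurableSet_Ioi hder hinj
    (fun u : ℝ => (u : ℂ) ^ s *
      ((√π / (π * √(u + b ^ 2)) * rexp (-2 * a * (π * √(u + b ^ 2))) : ℝ) : ℂ))
  rw [himg] at this
  rw [this, besselMultiplier, besselFactor, ← integral_const_mul, ← integral_const_mul]
  refine setIntegral_congr_fun measurableSet_Ioi fun r hr => ?_
  have hr0 : (0 : ℝ) < r := hr
  have e1 : √(r / a * (r / a + 2 * b) + b ^ 2) = r / a + b := by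
    rw [show r / a * (r / a + 2 * b) + b ^ 2 = (r / a + b) ^ 2 by ring]
    exact Real.sqrt_sq (by positivity)
  have e2 : ((r / a * (r / a + 2 * b) : ℝ) : ℂ) ^ s =
      (a : ℂ) ^ (-s) * (r : ℂ) ^ s * ((r : ℂ) / a + 2 * b) ^ s := by
    rw [Complex.ofReal_mul, Complex.mul_cpow_ofReal_nonneg (by positivity) (by positivity),
      div_eq_inv_mul, Complex.ofReal_mul, Complex.mul_cpow_ofReal_nonneg (by positivity) hr0.le,
      Complex.cpow_neg, Complex.ofReal_inv, Complex.inv_cpow]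
    · push_cast
      rw [div_eq_inv_mul]
    · rw [Complex.arg_ofReal_of_nonneg ha.le]; exact pi_pos.ne
  have ha' : (a : ℂ) ≠ 0 := by exact_mod_cast ha.ne'
  rw [e1, e2, abs_of_nonneg (by positivity), show -(1 + s) = -1 + -s by ring,
    Complex.cpow_add _ _ ha', Complex.cpow_neg_one,
    show -2 * a * (π * (r / a + b)) = -2 * π * a * b + -(2 * π * r) by field_simp; ring,
    Real.exp_add, Complex.real_smul]
  have hπ : (√π : ℂ) ≠ 0 := by exact_mod_cast (Real.sqrt_pos.2 pi_pos).ne'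
  have hππ : (π : ℂ) = (√π : ℂ) * √π := by
    exact_mod_cast (Real.mul_self_sqrt pi_pos.le).symm
  have hrb : ((r : ℂ) / a + b) ≠ 0 := by
    have : 0 < r / a + b := by positivity
    exact_mod_cast this.ne'
  push_cast
  have e3 : (√π : ℂ) / (π * (r / a + b)) = 1 / (√π * (r / a + b)) := by
    rw [div_eq_div_iff (by rw [hππ]; positivity) (by positivity)]
    rw [hππ]; ring
  rw [e3]
  generalize (a : ℂ) ^ (-s) = A, (r : ℂ) ^ s = B, ((r : ℂ) / a + 2 * b) ^ s = D
  generalize hq : (r : ℂ) / a + b = q at *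
  field_simp

/-- The Bessel-type integral as an explicit multiplier. -/
theorem bessel_identity {a b : ℝ} (ha : 0 < a) (hb : 0 < b) (y : ℝ) :
    Complex.Gamma (1 + y * Complex.I) * (π : ℂ) ^ (-2 * (1 + y * Complex.I)) *
      ∫ l in Ioi (0 : ℝ), (l : ℂ) ^ ((1 / 2 + y * Complex.I) - 1) *
        Complex.exp (-l * a ^ 2 - (π * b) ^ 2 / l) = (2 / √π : ℂ) * besselMultiplier y a b :=
  (bessel_fubini ha hb y).trans (bessel_change ha hb y)

end WaveStrichartz

namespace WaveStrichartz

theorem norm_cpow_mul_I_le {w : ℂ} (hw : 0 ≤ w.re) (y : ℝ) :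
    ‖w ^ (y * Complex.I)‖ ≤ rexp (π / 2 * |y|) := by
  refine (Complex.norm_cpow_le _ _).trans ?_
  have h1 := Complex.abs_arg_le_pi_div_two_iff.2 hw
  have e1 : (y * Complex.I : ℂ).re = 0 := by simp
  have e2 : (y * Complex.I : ℂ).im = y := by simp
  rw [e1, e2, Real.rpow_zero, one_div, ← Real.exp_neg]
  refine Real.exp_le_exp.2 ?_
  calc -(w.arg * y) ≤ |w.arg * y| := neg_le_abs _
    _ = |w.arg| * |y| := abs_mul _ _
    _ ≤ π / 2 * |y| := mul_le_mul_of_nonneg_right h1 (abs_nonneg _)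

private lemma norm_besselIntegrand_le (y : ℝ) {a : ℂ} (ha : 0 < a.re) {b : ℝ} (hb : 0 ≤ b) {r : ℝ}
    (hr : 0 < r) : ‖(rexp (-(2 * π * r)) : ℂ) * (r : ℂ) ^ (y * Complex.I) *
      (r / a + 2 * b) ^ (y * Complex.I)‖ ≤ rexp (π / 2 * |y|) * rexp (-(2 * π) * r) := by
  have h1 : 0 ≤ ((r : ℂ) / a + 2 * b).re := by
    have e1 : ((r : ℂ) / a).re = r * a.re / Complex.normSq a := by simp [Complex.div_re]
    have e2 : (2 * (b : ℂ)).re = 2 * b := by simp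
    have := Complex.normSq_nonneg a
    rw [Complex.add_re, e1, e2]
    positivity
  have h2 : ‖(r : ℂ) ^ (y * Complex.I)‖ = 1 := by
    rw [Complex.norm_cpow_eq_rpow_re_of_pos hr]; simp
  rw [norm_mul, norm_mul, h2, Complex.norm_real, Real.norm_of_nonneg (Real.exp_pos _).le, mul_one,
    mul_comm, neg_mul]
  exact mul_le_mul_of_nonneg_right (norm_cpow_mul_I_le h1 y) (Real.exp_pos _).le

private lemma integrableOn_exp_two_pi (M : ℝ) :
    IntegrableOn (fun r : ℝ => M * rexp (-(2 * π) * r)) (Ioi 0) :=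
  (integrableOn_exp_mul_Ioi (by linarith [pi_pos]) 0).const_mul _

theorem norm_besselFactor_le (y : ℝ) {a : ℂ} (ha : 0 < a.re) {b : ℝ} (hb : 0 ≤ b) :
    ‖besselFactor y a b‖ ≤ rexp (π / 2 * |y|) / (2 * π) := by
  refine (norm_integral_le_of_norm_le (integrableOn_exp_two_pi (rexp (π / 2 * |y|)))
    ((ae_restrict_iff' measurableSet_Ioi).2 (Filter.Eventually.of_forall fun r hr =>
      norm_besselIntegrand_le y ha hb hr))).trans ?_
  rw [integral_const_mul, integral_exp_mul_Ioi (by linarith [pi_pos]) 0, mul_zero, Real.exp_zero,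
    neg_div_neg_eq, mul_one_div]

theorem norm_besselMultiplier_le (y : ℝ) {a : ℂ} (ha : 0 < a.re) {b : ℝ} (hb : 0 ≤ b) :
    ‖besselMultiplier y a b‖ ≤ rexp (π * |y|) / (2 * π * ‖a‖) * rexp (-(2 * π * a.re) * b) := by
  have ha0 : a ≠ 0 := fun h => by simp [h] at ha
  have h1 : ‖a ^ (-(1 + y * Complex.I))‖ ≤ ‖a‖⁻¹ * rexp (π / 2 * |y|) := by
    rw [show -(1 + y * Complex.I) = -1 + ((-y : ℝ) : ℂ) * Complex.I by push_cast; ring,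
      Complex.cpow_add _ _ ha0, norm_mul, Complex.cpow_neg_one, norm_inv, ← abs_neg y]
    exact mul_le_mul_of_nonneg_left (norm_cpow_mul_I_le ha.le _) (by positivity)
  have h2 : ‖Complex.exp (-2 * π * a * b)‖ = rexp (-(2 * π * a.re) * b) := by
    rw [Complex.norm_exp, show (-2 * π * a * b : ℂ) = ((-2 * π * b : ℝ) : ℂ) * a by push_cast; ring,
      Complex.re_ofReal_mul]
    ring_nf
  rw [besselMultiplier, norm_mul, norm_mul, h2]
  calc _ ≤ rexp (-(2 * π * a.re) * b) * (‖a‖⁻¹ * rexp (π / 2 * |y|)) *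
        (rexp (π / 2 * |y|) / (2 * π)) := by
        gcongr
        exact norm_besselFactor_le y ha hb
    _ = _ := by
        rw [show π * |y| = π / 2 * |y| + π / 2 * |y| by ring, Real.exp_add]
        have := norm_pos_iff.2 ha0
        field_simp

theorem measurable_besselMultiplier (y : ℝ) (a : ℂ) : Measurable (besselMultiplier y a) := by
  have h1 : Measurable (besselFactor y a) := by
    have : StronglyMeasurable (Function.uncurry fun (b r : ℝ) => (rexp (-(2 * π * r)) : ℂ) *
        (r : ℂ) ^ (y * Complex.I) * (r / a + 2 * b) ^ (y * Complex.I)) := by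
      apply Measurable.stronglyMeasurable
      apply Measurable.mul
      · apply Measurable.mul
        · apply Complex.measurable_ofReal.comp; fun_prop
        · exact (Complex.measurable_ofReal.comp measurable_snd).pow_const _
      · exact Measurable.pow_const (by fun_prop) _
    exact this.integral_prod_right.measurable
  unfold besselMultiplier
  fun_prop

private lemma re_ge_of_mem_ball {z w : ℂ} (hw : w ∈ Metric.ball z (z.re / 2)) : z.re / 2 ≤ w.re := by
  have h2 := Complex.abs_re_le_norm (w - z)
  rw [← dist_eq_norm, Complex.sub_re] at h2
  have h3 := Metric.mem_ball.1 hw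
  have := neg_abs_le (w.re - z.re)
  linarith

private lemma isOpen_re_pos : IsOpen {z : ℂ | 0 < z.re} :=
  isOpen_lt continuous_const Complex.continuous_re

theorem differentiableOn_besselMultiplier (y : ℝ) {b : ℝ} (hb : 0 < b) :
    DifferentiableOn ℂ (fun a => besselMultiplier y a b) {z | 0 < z.re} := by
  have h1 : DifferentiableOn ℂ (fun a => besselFactor y a b) {z | 0 < z.re} := by
    refine differentiableOn_integral_of_dominated isOpen_re_pos (fun z _ => ?_) ?_ (fun z hz => ?_)
    · apply Measurable.aestronglyMeasurable
      apply Measurable.mul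
      · apply Measurable.mul
        · apply Complex.measurable_ofReal.comp; fun_prop
        · exact Complex.measurable_ofReal.pow_const _
      · exact Measurable.pow_const (by fun_prop) _
    · refine (ae_restrict_iff' measurableSet_Ioi).2 (Filter.Eventually.of_forall fun r hr => ?_)
      have hr0 : (0 : ℝ) < r := hr
      intro a ha
      have ha' : 0 < a.re := ha
      have ha0 : a ≠ 0 := fun h => by simp [h] at ha'
      have hs : (r : ℂ) / a + 2 * b ∈ Complex.slitPlane := by
        refine Complex.mem_slitPlane_iff.2 (Or.inl ?_)
        have e1 : ((r : ℂ) / a).re = r * a.re / Complex.normSq a := by simp [Complex.div_re]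
        have e2 : (2 * (b : ℂ)).re = 2 * b := by simp
        have := Complex.normSq_nonneg a
        rw [Complex.add_re, e1, e2]
        positivity
      refine DifferentiableAt.differentiableWithinAt ?_
      refine DifferentiableAt.const_mul ?_ _
      refine DifferentiableAt.cpow ?_ (by fun_prop) hs
      exact ((differentiableAt_const _).div differentiableAt_id ha0).add_const _
    · refine ⟨1, one_pos, _, integrableOn_exp_two_pi (rexp (π / 2 * |y|)), ?_⟩
      refine (ae_restrict_iff' measurableSet_Ioi).2 (Filter.Eventually.of_forall fun r hr => ?_)
      intro w _ hw
      exact norm_besselIntegrand_le y hw hb.le hr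
  refine DifferentiableOn.mul (DifferentiableOn.mul (by fun_prop) ?_) h1
  intro a ha
  have ha' : 0 < a.re := ha
  exact (DifferentiableAt.cpow differentiableAt_id (by fun_prop)
    (Complex.mem_slitPlane_iff.2 (Or.inl ha'))).differentiableWithinAt

/-- The normalising constant in the Fourier representation of `(a² + |x|²)^{-(d+1)/2 - iy}`. -/
def besselConst (d : ℕ) (y : ℝ) : ℂ :=
  √π / 2 * Complex.Gamma (1 + y * Complex.I) * (π : ℂ) ^ (-2 * (1 + y * Complex.I)) *
    ((π : ℂ) ^ (-((d : ℂ) / 2)) * Complex.Gamma (1 / 2 + y * Complex.I + d / 2))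

theorem integral_besselMultiplier_of_pos {d : ℕ} (hd : 1 ≤ d) (y : ℝ) {a : ℝ} (ha : 0 < a)
    (x : Euc d) :
    ∫ ξ : Euc d, besselMultiplier y a ‖ξ‖ * Complex.exp (2 * π * Complex.I * ⟪x, ξ⟫) =
      besselConst d y * ((a : ℂ) ^ 2 + (‖x‖ : ℂ) ^ 2) ^ (-(1 / 2 + y * Complex.I + d / 2)) := by
  have h := integral_gaussian_superposition (d := d) ha (w := 1 / 2 + y * Complex.I)
    (by simp; positivity) x
  have hπ : (√π : ℂ) ≠ 0 := by exact_mod_cast (Real.sqrt_pos.2 pi_pos).ne'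
  have hae : ∀ᵐ ξ : Euc d, besselMultiplier y a ‖ξ‖ * Complex.exp (2 * π * Complex.I * ⟪x, ξ⟫) =
      (√π / 2 * Complex.Gamma (1 + y * Complex.I) * (π : ℂ) ^ (-2 * (1 + y * Complex.I))) *
      ((∫ l in Ioi (0 : ℝ), (l : ℂ) ^ ((1 / 2 + y * Complex.I) - 1) *
        Complex.exp (-l * a ^ 2 - (π * ‖ξ‖) ^ 2 / l)) *
        Complex.exp (2 * π * Complex.I * ⟪x, ξ⟫)) := by
    filter_upwards [ae_norm_pos (d := d) hd] with ξ hξ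
    rw [← mul_assoc]
    congr 1
    rw [mul_assoc, mul_assoc, ← mul_assoc (Complex.Gamma _), bessel_identity ha hξ y]
    field_simp
  rw [integral_congr_ae hae, integral_const_mul, h, besselConst]
  ring

theorem integral_besselMultiplier {d : ℕ} (hd : 1 ≤ d) (y : ℝ) {a : ℂ} (ha : 0 < a.re)
    (x : Euc d) :
    ∫ ξ : Euc d, besselMultiplier y a ‖ξ‖ * Complex.exp (2 * π * Complex.I * ⟪x, ξ⟫) =
      besselConst d y * (a ^ 2 + (‖x‖ : ℂ) ^ 2) ^ (-(1 / 2 + y * Complex.I + d / 2)) := by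
  refine eq_of_eq_on_pos_real (f := fun a => ∫ ξ : Euc d, besselMultiplier y a ‖ξ‖ *
    Complex.exp (2 * π * Complex.I * ⟪x, ξ⟫)) (g := fun a => besselConst d y *
      (a ^ 2 + (‖x‖ : ℂ) ^ 2) ^ (-(1 / 2 + y * Complex.I + d / 2))) ?_ ?_
    (fun a ha => integral_besselMultiplier_of_pos hd y ha x) ha
  · refine differentiableOn_integral_of_dominated isOpen_re_pos (fun z _ => ?_) ?_ (fun z hz => ?_)
    · apply Measurable.aestronglyMeasurable
      exact ((measurable_besselMultiplier y z).comp measurable_norm).mul (by fun_prop)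
    · filter_upwards [ae_norm_pos (d := d) hd] with ξ hξ
      exact (differentiableOn_besselMultiplier y hξ).mul_const _
    · have hz : 0 < z.re := hz
      refine ⟨z.re / 2, by positivity, fun ξ => rexp (π * |y|) / (2 * π * (z.re / 2)) *
        (‖ξ‖ ^ (0 : ℝ) * rexp (-(π * z.re) * ‖ξ‖)),
        (integrable_norm_rpow_mul_exp hd ?_ (by positivity)).const_mul _,
        Filter.Eventually.of_forall fun ξ w hw hw' => ?_⟩
      · have hd' : (1 : ℝ) ≤ d := by exact_mod_cast hd
        linarith
      · have h1 := re_ge_of_mem_ball hw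
        have h2 : z.re / 2 ≤ ‖w‖ := h1.trans (Complex.re_le_norm w)
        rw [norm_mul, norm_cexp_two_pi_I_inner, mul_one]
        refine (norm_besselMultiplier_le y hw' (norm_nonneg ξ)).trans ?_
        simp only [Real.rpow_zero, one_mul]
        refine mul_le_mul (by gcongr) (Real.exp_le_exp.2 (mul_le_mul_of_nonneg_right ?_
          (norm_nonneg _))) (by positivity) (by positivity)
        nlinarith [pi_pos]
  · exact (differentiableOn_sq_add_sq_cpow _ _).const_mul _

end WaveStrichartz

namespace WaveStrichartz

open scoped FourierTransform SchwartzMap ContDiff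

section TestFunctions

variable {E : Type*} [NormedAddCommGroup E] [MeasurableSpace E]

/-- Bounded measurable functions with bounded support. -/
structure IsTest (f : E → ℂ) : Prop where
  measurable : Measurable f
  bdd : ∃ M, ∀ x, ‖f x‖ ≤ M
  supp : ∃ R, ∀ x, R < ‖x‖ → f x = 0

variable [ProperSpace E] {μ : Measure E} [IsFiniteMeasureOnCompacts μ]

theorem integrable_of_bdd_of_supp {F : Type*} [NormedAddCommGroup F] {g : E → F}
    (hg : AEStronglyMeasurable g μ) {M R : ℝ} (hM : ∀ x, ‖g x‖ ≤ M)
    (hR : ∀ x, R < ‖x‖ → g x = 0) : Integrable g μ := by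
  have h1 : IntegrableOn g (Metric.closedBall 0 R) μ :=
    Measure.integrableOn_of_bounded (isCompact_closedBall 0 R).measure_lt_top.ne hg
      (Filter.Eventually.of_forall hM)
  refine (integrableOn_iff_integrable_of_support_subset fun x hx => ?_).1 h1
  rw [mem_closedBall_zero_iff]
  by_contra h
  exact hx (hR x (not_le.1 h))

theorem IsTest.integrable {f : E → ℂ} (hf : IsTest f) : Integrable f μ := by
  obtain ⟨M, hM⟩ := hf.bdd
  obtain ⟨R, hR⟩ := hf.supp
  exact integrable_of_bdd_of_supp hf.measurable.aestronglyMeasurable hM hR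

theorem IsTest.integrable_norm_rpow {f : E → ℂ} (hf : IsTest f) {p : ℝ} (hp : 0 < p) :
    Integrable (fun x => ‖f x‖ ^ p) μ := by
  obtain ⟨M, hM⟩ := hf.bdd
  obtain ⟨R, hR⟩ := hf.supp
  refine integrable_of_bdd_of_supp (M := M ^ p) (R := R)
    (hf.measurable.norm.pow_const p).aestronglyMeasurable (fun x => ?_) (fun x hx => ?_)
  · rw [Real.norm_of_nonneg (by positivity)]
    exact Real.rpow_le_rpow (norm_nonneg _) (hM x) hp.le
  · rw [hR x hx, norm_zero, Real.zero_rpow hp.ne']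

theorem IsTest.memLp_two {f : E → ℂ} (hf : IsTest f) : MemLp f 2 μ := by
  refine (memLp_two_iff_integrable_sq_norm hf.measurable.aestronglyMeasurable).2 ?_
  simpa using hf.integrable_norm_rpow (μ := μ) (p := 2) two_pos

end TestFunctions

/-- The (inverse) Fourier integral. -/
def osc {d : ℕ} (f : Euc d → ℂ) (ξ : Euc d) : ℂ :=
  ∫ x, f x * Complex.exp (2 * π * Complex.I * ⟪x, ξ⟫)

theorem osc_eq_fourierInv {d : ℕ} (f : Euc d → ℂ) (ξ : Euc d) : osc f ξ = 𝓕⁻ f ξ := by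
  rw [Real.fourierInv_eq', osc]
  refine integral_congr_ae (Filter.Eventually.of_forall fun x => ?_)
  simp only [smul_eq_mul]
  rw [mul_comm]
  congr 2
  push_cast
  ring

theorem osc_neg_eq_fourier {d : ℕ} (f : Euc d → ℂ) (ξ : Euc d) : osc f (-ξ) = 𝓕 f ξ := by
  rw [osc_eq_fourierInv, Real.fourierInv_eq_fourier_neg, neg_neg]

/-- Plancherel's theorem on `L¹ ∩ L²`. -/
theorem eLpNorm_fourier_eq {d : ℕ} {f : Euc d → ℂ} (hf : Integrable f) (hf2 : MemLp f 2) :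
    AEStronglyMeasurable (𝓕 f) volume ∧ eLpNorm (𝓕 f) 2 volume = eLpNorm f 2 volume := by
  have hcont : Continuous (𝓕 f) :=
    VectorFourier.fourierIntegral_continuous Real.continuous_fourierChar
      (by exact continuous_inner) hf
  set G : Lp ℂ 2 (volume : Measure (Euc d)) := hf2.toLp f with hG
  have hpair : ∀ g : 𝓢(Euc d, ℂ), ∫ x, g x • (𝓕 f) x = ∫ x, g x • (𝓕 G : Lp ℂ 2 _) x := by
    intro g
    have h1 := congrArg (fun T => T g) (Lp.fourier_toTemperedDistribution_eq G)
    simp only [TemperedDistribution.fourier_apply, Lp.toTemperedDistribution_apply] at h1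
    rw [← h1]
    have h2 := VectorFourier.integral_fourierIntegral_smul_eq_flip (μ := volume) (ν := volume)
      (L := innerₗ (Euc d)) Real.continuous_fourierChar continuous_inner g.integrable hf
    have h3 : ∫ x, (𝓕 g) x • G x = ∫ x, (𝓕 g) x • f x := by
      refine integral_congr_ae ?_
      filter_upwards [hf2.coeFn_toLp] with x hx
      rw [hG, hx]
    rw [h3]
    have h4 := h2.symm
    rw [flip_innerₗ] at h4
    exact h4
  have hae : 𝓕 f =ᵐ[volume] (𝓕 G : Lp ℂ 2 _) := by
    have hl1 : LocallyIntegrable (𝓕 f) volume := hcont.locallyIntegrable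
    have hl2 : LocallyIntegrable (𝓕 G : Lp ℂ 2 (volume : Measure (Euc d))) volume :=
      (Lp.memLp _).locallyIntegrable (by norm_num)
    refine ae_eq_of_integral_contDiff_smul_eq hl1 hl2 fun g hg hgs => ?_
    let g' : 𝓢(Euc d, ℂ) := (hgs.comp_left (g := Complex.ofReal) (by simp)).toSchwartzMap
      (Complex.ofRealCLM.contDiff.comp hg)
    have := hpair g'
    simp only [Complex.real_smul]
    exact this
  refine ⟨hcont.aestronglyMeasurable, ?_⟩
  rw [eLpNorm_congr_ae hae, ← eLpNorm_congr_ae hf2.coeFn_toLp]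
  have h := Lp.norm_fourier_eq G
  rw [Lp.norm_def, Lp.norm_def] at h
  exact (ENNReal.toReal_eq_toReal_iff' (Lp.eLpNorm_ne_top _) (Lp.eLpNorm_ne_top _)).1 h

/-- Plancherel inequality for the oscillatory transform, with squared Bochner integrals. -/
theorem osc_sq_integral {d : ℕ} {f : Euc d → ℂ} (hf : IsTest f) :
    Continuous (osc f) ∧ MemLp (osc f) 2 ∧ ∫ ξ, ‖osc f ξ‖ ^ 2 = ∫ x, ‖f x‖ ^ 2 := by
  have hfi : Integrable f := hf.integrable
  have hf2 : MemLp f 2 := hf.memLp_two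
  have hcont : Continuous (𝓕 f) :=
    VectorFourier.fourierIntegral_continuous Real.continuous_fourierChar
      (by exact continuous_inner) hfi
  have he : osc f = fun ξ => 𝓕 f (-ξ) := by
    ext ξ
    rw [← osc_neg_eq_fourier, neg_neg]
  obtain ⟨h1, h2⟩ := eLpNorm_fourier_eq hfi hf2
  have hm : MemLp (𝓕 f) 2 := ⟨h1, h2 ▸ hf2.2⟩
  refine ⟨he ▸ hcont.comp continuous_neg, ?_, ?_⟩
  · rw [he]
    exact hm.comp_measurePreserving (Measure.measurePreserving_neg volume)
  · rw [he, integral_neg_eq_self (fun ξ => ‖𝓕 f ξ‖ ^ 2)]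
    have h3 := hm.eLpNorm_eq_integral_rpow_norm two_ne_zero ENNReal.ofNat_ne_top
    have h4 := hf2.eLpNorm_eq_integral_rpow_norm two_ne_zero ENNReal.ofNat_ne_top
    rw [h2, h4] at h3
    have h5 := (ENNReal.ofReal_eq_ofReal_iff (by positivity) (by positivity)).1 h3
    simp only [ENNReal.toReal_ofNat, Real.rpow_two] at h5
    exact ((Real.rpow_left_inj (by positivity) (by positivity) (by norm_num)).1 h5).symm

end WaveStrichartz

namespace WaveStrichartz

theorem norm_Gamma_le_Gamma_re {s : ℂ} (hs : 0 < s.re) : ‖Complex.Gamma s‖ ≤ Real.Gamma s.re := by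
  rw [Complex.Gamma_eq_integral hs, Real.Gamma_eq_integral hs]
  refine norm_integral_le_of_norm_le (Real.GammaIntegral_convergent hs) ?_
  refine (ae_restrict_iff' measurableSet_Ioi).2 (Filter.Eventually.of_forall fun x hx => ?_)
  have hx0 : (0 : ℝ) < x := hx
  rw [norm_mul, Complex.norm_cpow_eq_rpow_re_of_pos hx0, Complex.norm_real,
    Real.norm_of_nonneg (Real.exp_pos _).le, Complex.sub_re, Complex.one_re]

/-- An exponential lower bound for the Gamma function on the line `Re z = 1`. -/
theorem one_le_exp_mul_norm_Gamma (y : ℝ) :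
    1 ≤ rexp (π * |y|) * ‖Complex.Gamma (1 + y * Complex.I)‖ := by
  rcases eq_or_ne y 0 with rfl | hy
  · simp
  set z : ℂ := y * Complex.I with hz
  have hz0 : z ≠ 0 := mul_ne_zero (by exact_mod_cast hy) Complex.I_ne_zero
  have hre : z.re = 0 := by simp [hz]
  have h1 := Complex.Gamma_mul_Gamma_one_sub z
  have h2 : Complex.Gamma (1 + z) = z * Complex.Gamma z := by
    rw [add_comm, Complex.Gamma_add_one z hz0]
  have h3 : ‖Complex.Gamma (1 - z)‖ ≤ 1 := by
    refine (norm_Gamma_le_Gamma_re (by simp [hre])).trans ?_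
    simp [hre]
  have h4 : Complex.sin (π * z) = Complex.sinh (π * y) * Complex.I := by
    rw [hz, ← mul_assoc, Complex.sin_mul_I]
  have hsin : ‖Complex.sin (π * z)‖ = Real.sinh (π * |y|) := by
    rw [h4, norm_mul, Complex.norm_I, mul_one, ← Complex.ofReal_mul, ← Complex.ofReal_sinh,
      Complex.norm_real, Real.norm_eq_abs, Real.abs_sinh, abs_mul, abs_of_pos pi_pos]
  have hy' : 0 < π * |y| := mul_pos pi_pos (abs_pos.2 hy)
  have hsp : 0 < Real.sinh (π * |y|) := Real.sinh_pos_iff.2 hy'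
  have h5 : ‖Complex.Gamma (1 + z)‖ * ‖Complex.Gamma (1 - z)‖ = π * |y| / Real.sinh (π * |y|) := by
    rw [← norm_mul, h2, mul_assoc, h1, norm_mul, norm_div, hsin, Complex.norm_real,
      Real.norm_of_nonneg pi_pos.le, hz, norm_mul, Complex.norm_I, Complex.norm_real,
      Real.norm_eq_abs]
    ring
  have h6 : Real.sinh (π * |y|) ≤ rexp (π * |y|) * (π * |y|) := by
    have h7 : 1 - 2 * (π * |y|) ≤ rexp (-(2 * (π * |y|))) := by
      have := Real.add_one_le_exp (-(2 * (π * |y|)))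
      linarith
    have h8 : rexp (-(π * |y|)) = rexp (π * |y|) * rexp (-(2 * (π * |y|))) := by
      rw [← Real.exp_add]; ring_nf
    rw [Real.sinh_eq, h8]
    nlinarith [Real.exp_pos (π * |y|)]
  have h9 : π * |y| / Real.sinh (π * |y|) ≤ ‖Complex.Gamma (1 + z)‖ := by
    rw [← h5]
    exact mul_le_of_le_one_right (norm_nonneg _) h3
  calc (1 : ℝ) ≤ rexp (π * |y|) * (π * |y| / Real.sinh (π * |y|)) := by
        rw [← mul_div_assoc, le_div_iff₀ hsp, one_mul]
        exact h6
    _ ≤ _ := mul_le_mul_of_nonneg_left h9 (Real.exp_pos _).le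

theorem exp_mul_sub_sq_le (c y : ℝ) : rexp (c * |y| - y ^ 2) ≤ rexp (c ^ 2) := by
  refine Real.exp_le_exp.2 ?_
  rw [← sq_abs y]
  nlinarith [sq_nonneg (c - |y|), sq_nonneg (c + |y|), sq_nonneg (c - 2 * |y|)]

/-- A convolution kernel given by an integrable multiplier acts diagonally on the Fourier side. -/
theorem integral_convolution_kernel {d : ℕ} {f g m : Euc d → ℂ} (hf : Integrable f)
    (hg : Integrable g) (hm : Integrable m) :
    ∫ z : Euc d × Euc d, f z.1 * g z.2 *
        (∫ ξ, m ξ * Complex.exp (2 * π * Complex.I * ⟪z.1 - z.2, ξ⟫)) =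
      ∫ ξ, m ξ * (osc f ξ * osc g (-ξ)) := by
  set H : Euc d × Euc d → Euc d → ℂ := fun z ξ => f z.1 * g z.2 *
    (m ξ * Complex.exp (2 * π * Complex.I * ⟪z.1 - z.2, ξ⟫)) with hH
  have h_integrable : Integrable (Function.uncurry H) ((volume : Measure (Euc d × Euc d)).prod volume) := by
    have h1 := (hf.mul_prod hg).mul_prod hm
    refine (h1.norm).mono' ?_ (Filter.Eventually.of_forall fun p => ?_)
    · have h2 : AEStronglyMeasurable (fun p : (Euc d × Euc d) × Euc d =>
          Complex.exp (2 * π * Complex.I * ⟪p.1.1 - p.1.2, p.2⟫))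
          ((volume : Measure (Euc d × Euc d)).prod volume) := by
        apply Continuous.aestronglyMeasurable; fun_prop
      refine (h1.aestronglyMeasurable.mul h2).congr (Filter.Eventually.of_forall fun p => ?_)
      simp only [hH, Pi.mul_apply, Function.uncurry_def]
      ring
    · simp only [hH, Function.uncurry_def, norm_mul, norm_cexp_two_pi_I_inner, mul_one, le_refl]
  calc _ = ∫ z : Euc d × Euc d, ∫ ξ, H z ξ := by
        refine integral_congr_ae (Filter.Eventually.of_forall fun z => ?_)
        simp only [hH]
        rw [integral_const_mul]
    _ = ∫ ξ, ∫ z : Euc d × Euc d, H z ξ := integral_integral_swap h_integrable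
    _ = _ := by
        refine integral_congr_ae (Filter.Eventually.of_forall fun ξ => ?_)
        simp only [osc]
        rw [← integral_prod_mul, ← integral_const_mul]
        refine integral_congr_ae (Filter.Eventually.of_forall fun z => ?_)
        have : Complex.exp (2 * π * Complex.I * ⟪z.1 - z.2, ξ⟫) =
            Complex.exp (2 * π * Complex.I * ⟪z.1, ξ⟫) *
              Complex.exp (2 * π * Complex.I * ⟪z.2, -ξ⟫) := by
          rw [← Complex.exp_add, inner_sub_left, inner_neg_right]
          congr 1
          push_cast
          ring
        simp only [hH, this]
        ring

theorem norm_integral_convolution_kernel_le {d : ℕ} {f g m : Euc d → ℂ} (hf : IsTest f)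
    (hg : IsTest g) (hm : Integrable m) {M : ℝ} (hM : ∀ ξ, ‖m ξ‖ ≤ M) :
    ‖∫ z : Euc d × Euc d, f z.1 * g z.2 *
        (∫ ξ, m ξ * Complex.exp (2 * π * Complex.I * ⟪z.1 - z.2, ξ⟫))‖ ≤
      M * ((∫ x, ‖f x‖ ^ 2) ^ (1 / 2 : ℝ) * (∫ x, ‖g x‖ ^ 2) ^ (1 / 2 : ℝ)) := by
  rw [integral_convolution_kernel hf.integrable hg.integrable hm]
  obtain ⟨hfc, hfL, hfe⟩ := osc_sq_integral hf
  obtain ⟨hgc, hgL, hge⟩ := osc_sq_integral hg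
  have hM0 : 0 ≤ M := (norm_nonneg _).trans (hM 0)
  have hgL' : MemLp (fun ξ => osc g (-ξ)) 2 :=
    hgL.comp_measurePreserving (Measure.measurePreserving_neg volume)
  have h2 : (ENNReal.ofReal 2) = 2 := by simp
  have hCS := integral_mul_norm_le_Lp_mul_Lq (μ := (volume : Measure (Euc d)))
    (f := osc f) (g := fun ξ => osc g (-ξ)) (p := 2) (q := 2)
    Real.HolderConjugate.two_two (by rwa [h2]) (by rwa [h2])
  simp only [Real.rpow_two] at hCS
  rw [integral_neg_eq_self (fun ξ => ‖osc g ξ‖ ^ 2), hfe, hge] at hCS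
  have h_integrable : Integrable (fun ξ => ‖osc f ξ‖ * ‖osc g (-ξ)‖) := by
    have := hfL.norm.integrable_mul hgL'.norm
    exact this
  calc _ ≤ ∫ ξ, M * (‖osc f ξ‖ * ‖osc g (-ξ)‖) := by
        refine norm_integral_le_of_norm_le (h_integrable.const_mul M) (Filter.Eventually.of_forall fun ξ => ?_)
        rw [norm_mul, norm_mul]
        exact mul_le_mul_of_nonneg_right (hM ξ) (by positivity)
    _ ≤ _ := by
        rw [integral_const_mul]
        exact mul_le_mul_of_nonneg_left hCS hM0

end WaveStrichartz

namespace WaveStrichartz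

/-- The analytic family of functions used in the interpolation argument. -/
def twist {E : Type*} (r : ℝ) (f : E → ℂ) (ζ : ℂ) (x : E) : ℂ :=
  f x * (‖f x‖ : ℂ) ^ (r * (1 - ζ / 2) - 1)

theorem norm_twist {E : Type*} {r : ℝ} (hr : 0 < r) (f : E → ℂ) {ζ : ℂ} (hζ : ζ.re < 2) (x : E) :
    ‖twist r f ζ x‖ = ‖f x‖ ^ (r * (1 - ζ.re / 2)) := by
  have he : 0 < r * (1 - ζ.re / 2) := mul_pos hr (by linarith)
  rcases eq_or_ne (f x) 0 with h | h
  · simp [twist, h, Real.zero_rpow he.ne']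
  · have hp : 0 < ‖f x‖ := norm_pos_iff.2 h
    have h1 : ((r : ℂ) * (1 - ζ / 2) - 1).re = r * (1 - ζ.re / 2) - 1 := by
      simp [Complex.mul_re]
    rw [twist, norm_mul, Complex.norm_cpow_eq_rpow_re_of_pos hp, h1, Real.rpow_sub_one hp.ne']
    field_simp

theorem IsTest.twist {E : Type*} [NormedAddCommGroup E] [MeasurableSpace E] {r : ℝ} (hr : 0 < r)
    {f : E → ℂ} (hf : IsTest f) {ζ : ℂ} (hζ : ζ.re < 2) : IsTest (twist r f ζ) where
  measurable := by
    unfold WaveStrichartz.twist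
    exact hf.measurable.mul ((Complex.measurable_ofReal.comp hf.measurable.norm).pow_const _)
  bdd := by
    obtain ⟨M, hM⟩ := hf.bdd
    refine ⟨M ^ (r * (1 - ζ.re / 2)), fun x => ?_⟩
    rw [norm_twist hr f hζ]
    exact Real.rpow_le_rpow (norm_nonneg _) (hM x) (mul_pos hr (by linarith)).le
  supp := by
    obtain ⟨R, hR⟩ := hf.supp
    exact ⟨R, fun x hx => by simp [WaveStrichartz.twist, hR x hx]⟩

theorem exists_norm_twist_le {E : Type*} [NormedAddCommGroup E] [MeasurableSpace E] {r : ℝ}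
    (hr : 0 < r) {f : E → ℂ} (hf : IsTest f) :
    ∃ A, 0 ≤ A ∧ ∀ ζ : ℂ, |ζ.re| < 2 → ∀ x, ‖WaveStrichartz.twist r f ζ x‖ ≤ A := by
  obtain ⟨M, hM⟩ := hf.bdd
  refine ⟨(max M 1) ^ (2 * r), by positivity, fun ζ hζ x => ?_⟩
  obtain ⟨h1, h2⟩ := abs_lt.1 hζ
  rw [norm_twist hr f h2]
  have he : 0 < r * (1 - ζ.re / 2) := mul_pos hr (by linarith)
  calc _ ≤ (max M 1) ^ (r * (1 - ζ.re / 2)) :=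
        Real.rpow_le_rpow (norm_nonneg _) ((hM x).trans (le_max_left _ _)) he.le
    _ ≤ _ := Real.rpow_le_rpow_of_exponent_le (le_max_right _ _) (by nlinarith)

theorem differentiable_twist {E : Type*} {r : ℝ} (f : E → ℂ) (x : E) :
    Differentiable ℂ (fun ζ => twist r f ζ x) := by
  rcases eq_or_ne (f x) 0 with h | h
  · simp [twist, h]
  · have h1 : (‖f x‖ : ℂ) ≠ 0 := by exact_mod_cast norm_ne_zero_iff.2 h
    unfold twist
    refine (differentiable_const _).mul fun ζ => DifferentiableAt.const_cpow (by fun_prop) (Or.inl h1)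

theorem norm_cpow_le_exp {q : ℂ} (hq : q ≠ 0) {k : ℝ} (hk : 0 ≤ k) (ζ : ℂ) :
    ‖q ^ (-(k * ζ))‖ ≤ rexp (k * |Real.log ‖q‖| * |ζ.re| + k * π * |ζ.im|) := by
  rw [Complex.cpow_def_of_ne_zero hq, Complex.norm_exp]
  refine Real.exp_le_exp.2 ?_
  have e : (Complex.log q * -(k * ζ)).re = -(k * (Real.log ‖q‖ * ζ.re)) + k * (q.arg * ζ.im) := by
    simp [Complex.mul_re, Complex.log_re, Complex.log_im]
    ring
  rw [e]
  have h1 : -(Real.log ‖q‖ * ζ.re) ≤ |Real.log ‖q‖| * |ζ.re| := by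
    rw [← abs_mul]; exact neg_le_abs _
  have h2 : q.arg * ζ.im ≤ π * |ζ.im| := by
    refine (le_abs_self _).trans ?_
    rw [abs_mul]
    exact mul_le_mul_of_nonneg_right (Complex.abs_arg_le_pi q) (abs_nonneg _)
  nlinarith [mul_le_mul_of_nonneg_left h1 hk, mul_le_mul_of_nonneg_left h2 hk]

/-- The integrand of the analytic family. -/
def steinIntegrand (d : ℕ) (r k : ℝ) (a : ℂ) (f g : Euc d → ℂ) (ζ : ℂ) (z : Euc d × Euc d) : ℂ :=
  twist r f ζ z.1 * twist r g ζ z.2 * (a ^ 2 + (‖z.1 - z.2‖ : ℂ) ^ 2) ^ (-(k * ζ))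

variable {d : ℕ} {r k : ℝ} {a : ℂ} {f g : Euc d → ℂ}

theorem sq_add_sq_ne_zero (ha : 0 < a.re) (c : ℝ) : a ^ 2 + (c : ℂ) ^ 2 ≠ 0 :=
  Complex.slitPlane_ne_zero (sq_add_sq_mem_slitPlane ha c)

theorem exists_steinIntegrand_le (hr : 0 < r) (hk : 0 ≤ k) (ha : 0 < a.re) (hf : IsTest f)
    (hg : IsTest g) :
    ∃ A R : ℝ, 0 ≤ A ∧ ∀ ζ : ℂ, |ζ.re| < 2 → ∀ z, ‖steinIntegrand d r k a f g ζ z‖ ≤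
      (Metric.closedBall 0 R).indicator (fun _ => A * rexp (k * π * |ζ.im|)) z := by
  obtain ⟨Af, hAf0, hAf⟩ := exists_norm_twist_le hr hf
  obtain ⟨Ag, hAg0, hAg⟩ := exists_norm_twist_le hr hg
  obtain ⟨Rf, hRf⟩ := hf.supp
  obtain ⟨Rg, hRg⟩ := hg.supp
  set R := max Rf Rg with hR
  set L := |Real.log (a.re ^ 2)| + |Real.log (‖a‖ ^ 2 + (2 * R) ^ 2)| with hL
  refine ⟨Af * Ag * rexp (k * L * 2), R, by positivity, fun ζ hζ z => ?_⟩
  by_cases hz : z ∈ Metric.closedBall (0 : Euc d × Euc d) R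
  · rw [indicator_of_mem hz]
    rw [mem_closedBall_zero_iff] at hz
    have hz1 : ‖z.1‖ ≤ R := (norm_fst_le z).trans hz
    have hz2 : ‖z.2‖ ≤ R := (norm_snd_le z).trans hz
    have hz3 : ‖z.1 - z.2‖ ≤ 2 * R := (norm_sub_le _ _).trans (by linarith)
    set q := a ^ 2 + (‖z.1 - z.2‖ : ℂ) ^ 2 with hq
    have hq1 : a.re ^ 2 ≤ ‖q‖ := sq_re_le_norm_sq_add_sq a _
    have hq2 : ‖q‖ ≤ ‖a‖ ^ 2 + (2 * R) ^ 2 := by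
      refine (norm_add_le _ _).trans ?_
      rw [norm_pow, norm_pow, Complex.norm_real, norm_norm]
      have := pow_le_pow_left₀ (norm_nonneg (z.1 - z.2)) hz3 2
      linarith
    have ha2 : 0 < a.re ^ 2 := by positivity
    have hlog : |Real.log ‖q‖| ≤ L := by
      have h1 := Real.log_le_log ha2 hq1
      have h2 := Real.log_le_log (ha2.trans_le hq1) hq2
      rw [hL, abs_le]
      constructor
      · linarith [neg_abs_le (Real.log (a.re ^ 2)), abs_nonneg (Real.log (‖a‖ ^ 2 + (2 * R) ^ 2))]
      · linarith [le_abs_self (Real.log (‖a‖ ^ 2 + (2 * R) ^ 2)), abs_nonneg (Real.log (a.re ^ 2))]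
    have hcp : ‖q ^ (-(k * ζ))‖ ≤ rexp (k * L * 2) * rexp (k * π * |ζ.im|) := by
      rw [← Real.exp_add]
      refine (norm_cpow_le_exp (sq_add_sq_ne_zero ha _) hk ζ).trans (Real.exp_le_exp.2 ?_)
      have : k * |Real.log ‖q‖| * |ζ.re| ≤ k * L * 2 :=
        mul_le_mul (mul_le_mul_of_nonneg_left hlog hk) hζ.le (abs_nonneg _) (by positivity)
      linarith
    rw [steinIntegrand, norm_mul, norm_mul, mul_assoc (Af * Ag)]
    exact mul_le_mul (mul_le_mul (hAf ζ hζ _) (hAg ζ hζ _) (norm_nonneg _) hAf0) hcp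
      (norm_nonneg _) (by positivity)
  · rw [indicator_of_notMem hz]
    rw [mem_closedBall_zero_iff, not_le, Prod.norm_def, lt_max_iff] at hz
    have : steinIntegrand d r k a f g ζ z = 0 := by
      rcases hz with h | h
      · simp [steinIntegrand, twist, hRf z.1 ((le_max_left _ _).trans_lt h)]
      · simp [steinIntegrand, twist, hRg z.2 ((le_max_right _ _).trans_lt h)]
    rw [this, norm_zero]

theorem measurable_steinIntegrand (hr : 0 < r) (hf : IsTest f) (hg : IsTest g) {ζ : ℂ}
    (hζ : ζ.re < 2) : Measurable (steinIntegrand d r k a f g ζ) := by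
  unfold steinIntegrand
  refine (((hf.twist hr hζ).measurable.comp measurable_fst).mul
    ((hg.twist hr hζ).measurable.comp measurable_snd)).mul (Measurable.pow_const ?_ _)
  apply Continuous.measurable
  fun_prop

theorem integrable_indicator_closedBall {E : Type*} [NormedAddCommGroup E] [MeasurableSpace E]
    [OpensMeasurableSpace E] [ProperSpace E] {μ : Measure E} [IsFiniteMeasureOnCompacts μ] (R c : ℝ) :
    Integrable ((Metric.closedBall 0 R).indicator fun _ : E => c) μ :=
  (integrable_indicator_iff measurableSet_closedBall).2
    (integrableOn_const (isCompact_closedBall 0 R).measure_lt_top.ne)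

theorem differentiableOn_integral_steinIntegrand (hr : 0 < r) (hk : 0 ≤ k) (ha : 0 < a.re)
    (hf : IsTest f) (hg : IsTest g) :
    DifferentiableOn ℂ (fun ζ => ∫ z, steinIntegrand d r k a f g ζ z) {ζ | |ζ.re| < 2} := by
  obtain ⟨A, R, hA, hAR⟩ := exists_steinIntegrand_le hr hk ha hf hg
  have hU : IsOpen {ζ : ℂ | |ζ.re| < 2} :=
    isOpen_lt (by fun_prop) continuous_const
  refine differentiableOn_integral_of_dominated hU (fun ζ hζ => ?_) ?_ (fun ζ hζ => ?_)
  · exact (measurable_steinIntegrand hr hf hg (abs_lt.1 hζ).2).aestronglyMeasurable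
  · refine Filter.Eventually.of_forall fun z => Differentiable.differentiableOn ?_
    unfold steinIntegrand
    refine ((differentiable_twist f z.1).mul (differentiable_twist g z.2)).mul fun ζ =>
      DifferentiableAt.const_cpow (by fun_prop) (Or.inl (sq_add_sq_ne_zero ha _))
  · refine ⟨1, one_pos, (Metric.closedBall 0 R).indicator
      (fun _ => A * rexp (k * π * (|ζ.im| + 1))), integrable_indicator_closedBall _ _,
      Filter.Eventually.of_forall fun z w hw hwU => (hAR w hwU z).trans ?_⟩
    refine indicator_le_indicator (mul_le_mul_of_nonneg_left (Real.exp_le_exp.2 ?_) hA)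
    refine mul_le_mul_of_nonneg_left ?_ (by positivity)
    have h1 : |w.im - ζ.im| ≤ 1 := by
      have := Complex.abs_im_le_norm (w - ζ)
      rw [Complex.sub_im] at this
      exact this.trans (by rw [← dist_eq_norm]; exact (Metric.mem_ball.1 hw).le)
    linarith [abs_sub_abs_le_abs_sub w.im ζ.im]

theorem exists_integral_steinIntegrand_le (hr : 0 < r) (hk : 0 ≤ k) (ha : 0 < a.re)
    (hf : IsTest f) (hg : IsTest g) :
    ∃ A : ℝ, 0 ≤ A ∧ ∀ ζ : ℂ, |ζ.re| < 2 → ‖∫ z, steinIntegrand d r k a f g ζ z‖ ≤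
      A * rexp (k * π * |ζ.im|) := by
  obtain ⟨A, R, hA, hAR⟩ := exists_steinIntegrand_le hr hk ha hf hg
  refine ⟨A * (volume : Measure (Euc d × Euc d)).real (Metric.closedBall 0 R), by positivity,
    fun ζ hζ => ?_⟩
  refine (norm_integral_le_of_norm_le (integrable_indicator_closedBall _ _)
    (Filter.Eventually.of_forall (hAR ζ hζ))).trans (le_of_eq ?_)
  rw [integral_indicator measurableSet_closedBall, setIntegral_const, smul_eq_mul]
  ring

end WaveStrichartz

namespace WaveStrichartz

variable {d : ℕ} {r k : ℝ} {a : ℂ} {f g : Euc d → ℂ}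

theorem norm_integral_steinIntegrand_zero_le (hr : 0 < r) (hk : 0 ≤ k) (ha : 0 < a.re)
    (hf : IsTest f) (hg : IsTest g) {ζ : ℂ} (hζ : ζ.re = 0) :
    ‖∫ z, steinIntegrand d r k a f g ζ z‖ ≤
      rexp (k * π * |ζ.im|) * ((∫ x, ‖f x‖ ^ r) * (∫ x, ‖g x‖ ^ r)) := by
  have h2 : ζ.re < 2 := by rw [hζ]; norm_num
  have h_integrable : Integrable (fun z : Euc d × Euc d => ‖f z.1‖ ^ r * ‖g z.2‖ ^ r) :=
    (hf.integrable_norm_rpow hr).mul_prod (hg.integrable_norm_rpow hr)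
  calc _ ≤ ∫ z : Euc d × Euc d, rexp (k * π * |ζ.im|) * (‖f z.1‖ ^ r * ‖g z.2‖ ^ r) := by
        refine norm_integral_le_of_norm_le (h_integrable.const_mul _) (Filter.Eventually.of_forall fun z => ?_)
        rw [steinIntegrand, norm_mul, norm_mul, norm_twist hr f h2, norm_twist hr g h2, hζ, zero_div,
          sub_zero, mul_one, mul_comm]
        refine mul_le_mul_of_nonneg_right ?_ (by positivity)
        refine (norm_cpow_le_exp (sq_add_sq_ne_zero ha _) hk ζ).trans (le_of_eq ?_)
        rw [hζ, abs_zero, mul_zero, zero_add]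
    _ = _ := by
        rw [integral_const_mul]
        congr 1
        exact integral_prod_mul (fun x => ‖f x‖ ^ r) (fun x => ‖g x‖ ^ r)

theorem integrable_besselMultiplier (hd : 1 ≤ d) (y : ℝ) (ha : 0 < a.re) :
    Integrable (fun ξ : Euc d => besselMultiplier y a ‖ξ‖) := by
  have h0 := integrable_norm_rpow_mul_exp hd (k := 0) (c := 2 * π * a.re)
    (by simp; omega) (by positivity)
  simp only [Real.rpow_zero, one_mul] at h0
  refine (h0.const_mul (rexp (π * |y|) / (2 * π * ‖a‖))).mono'
    ((measurable_besselMultiplier y a).comp measurable_norm).aestronglyMeasurable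
    (Filter.Eventually.of_forall fun ξ => norm_besselMultiplier_le y ha (norm_nonneg ξ))

theorem norm_besselConst (d : ℕ) (y : ℝ) : ‖besselConst d y‖ =
    √π / 2 * ‖Complex.Gamma (1 + y * Complex.I)‖ * π ^ (-2 : ℝ) *
      (π ^ (-((d : ℝ) / 2)) * ‖Complex.Gamma (1 / 2 + y * Complex.I + d / 2)‖) := by
  have e1 : (-2 * (1 + y * Complex.I) : ℂ).re = -2 := by simp
  have e2 : (-((d : ℂ) / 2)).re = -((d : ℝ) / 2) := by simp
  have e3 : ‖(√π / 2 : ℂ)‖ = √π / 2 := by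
    rw [norm_div, Complex.norm_real, Real.norm_of_nonneg (Real.sqrt_nonneg _)]; simp
  rw [besselConst, norm_mul, norm_mul, norm_mul, norm_mul,
    Complex.norm_cpow_eq_rpow_re_of_pos pi_pos, Complex.norm_cpow_eq_rpow_re_of_pos pi_pos, e1, e2,
    e3]

theorem norm_integral_bessel_le (hd : 1 ≤ d) (y : ℝ) (ha : 0 < a.re) (hf : IsTest f)
    (hg : IsTest g) :
    ‖Complex.Gamma (1 / 2 + y * Complex.I + d / 2)‖ *
      ‖∫ z : Euc d × Euc d, f z.1 * g z.2 *
        (a ^ 2 + (‖z.1 - z.2‖ : ℂ) ^ 2) ^ (-(1 / 2 + y * Complex.I + d / 2))‖ ≤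
      2 / √π * π ^ (2 : ℝ) * π ^ ((d : ℝ) / 2) / (2 * π) * (rexp (2 * π * |y|) / ‖a‖ *
        ((∫ x, ‖f x‖ ^ 2) ^ (1 / 2 : ℝ) * (∫ x, ‖g x‖ ^ 2) ^ (1 / 2 : ℝ))) := by
  have hM : ∀ ξ : Euc d, ‖besselMultiplier y a ‖ξ‖‖ ≤ rexp (π * |y|) / (2 * π * ‖a‖) := fun ξ => by
    refine (norm_besselMultiplier_le y ha (norm_nonneg ξ)).trans ?_
    refine mul_le_of_le_one_right (by positivity) (Real.exp_le_one_iff.2 ?_)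
    have := mul_nonneg (mul_nonneg two_pos.le pi_pos.le) ha.le
    nlinarith [norm_nonneg ξ]
  have h := norm_integral_convolution_kernel_le hf hg (integrable_besselMultiplier hd y ha) hM
  simp only [integral_besselMultiplier hd y ha] at h
  have e : ∀ z : Euc d × Euc d, f z.1 * g z.2 * (besselConst d y *
      (a ^ 2 + (‖z.1 - z.2‖ : ℂ) ^ 2) ^ (-(1 / 2 + y * Complex.I + d / 2))) = besselConst d y *
      (f z.1 * g z.2 * (a ^ 2 + (‖z.1 - z.2‖ : ℂ) ^ 2) ^ (-(1 / 2 + y * Complex.I + d / 2))) :=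
    fun z => by ring
  simp only [e] at h
  rw [integral_const_mul, norm_mul, norm_besselConst] at h
  set I := ‖∫ z : Euc d × Euc d, f z.1 * g z.2 *
        (a ^ 2 + (‖z.1 - z.2‖ : ℂ) ^ 2) ^ (-(1 / 2 + y * Complex.I + d / 2))‖
  set G := ‖Complex.Gamma (1 / 2 + y * Complex.I + d / 2)‖
  set Y := (∫ x, ‖f x‖ ^ 2) ^ (1 / 2 : ℝ) * (∫ x, ‖g x‖ ^ 2) ^ (1 / 2 : ℝ) with hY
  have hY0 : 0 ≤ Y := by positivity
  set Γ1 := ‖Complex.Gamma (1 + y * Complex.I)‖ with hΓ1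
  have hΓ : 1 ≤ rexp (π * |y|) * Γ1 := one_le_exp_mul_norm_Gamma y
  have ha0 : 0 < ‖a‖ := norm_pos_iff.2 fun h => by simp [h] at ha
  have hGI : 0 ≤ G * I := mul_nonneg (norm_nonneg _) (norm_nonneg _)
  have hs : 0 < √π := Real.sqrt_pos.2 pi_pos
  rw [Real.rpow_neg pi_pos.le, Real.rpow_neg pi_pos.le] at h
  have hp1 : 0 < π ^ (2 : ℝ) := by positivity
  have hp2 : 0 < π ^ ((d : ℝ) / 2) := by positivity
  set P := π ^ (2 : ℝ)
  set Q := π ^ ((d : ℝ) / 2)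
  calc G * I ≤ (rexp (π * |y|) * Γ1) * (G * I) := le_mul_of_one_le_left hGI hΓ
    _ = 2 / √π * P * Q * rexp (π * |y|) * (√π / 2 * Γ1 * P⁻¹ * (Q⁻¹ * G) * I) := by
        field_simp
    _ ≤ 2 / √π * P * Q * rexp (π * |y|) * (rexp (π * |y|) / (2 * π * ‖a‖) * Y) :=
        mul_le_mul_of_nonneg_left h (by positivity)
    _ = _ := by
        rw [show (2 * π * |y|) = π * |y| + π * |y| by ring, Real.exp_add]
        field_simp

theorem norm_integral_steinIntegrand_one_le (hd : 1 ≤ d) (hr : 0 < r) (ha : 0 < a.re)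
    (hf : IsTest f) (hg : IsTest g) {ζ : ℂ} (hζ : ζ.re = 1) :
    ‖Complex.Gamma ((((d : ℝ) + 1) / 2 : ℝ) * ζ + 1)‖ *
      ‖∫ z, steinIntegrand d r (((d : ℝ) + 1) / 2) a f g ζ z‖ ≤
      (((d : ℝ) + 1) / 2) * (2 / √π * π ^ (2 : ℝ) * π ^ ((d : ℝ) / 2) / (2 * π)) *
      (rexp (|ζ.im| + π * (d + 1) * |ζ.im|) / ‖a‖ *
        ((∫ x, ‖f x‖ ^ r) * (∫ x, ‖g x‖ ^ r)) ^ (1 / 2 : ℝ)) := by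
  have h2 : ζ.re < 2 := by rw [hζ]; norm_num
  set k := ((d : ℝ) + 1) / 2 with hk
  have hk0 : 0 < k := by positivity
  have hζ0 : (k : ℂ) * ζ ≠ 0 := by
    refine mul_ne_zero (by exact_mod_cast hk0.ne') fun h => ?_
    simp [h] at hζ
  have hζe : ζ = 1 + ζ.im * Complex.I := by
    apply Complex.ext <;> simp [hζ]
  have hkζ : (1 / 2 + ((k * ζ.im : ℝ) : ℂ) * Complex.I + d / 2 : ℂ) = k * ζ := by
    rw [hζe]
    simp [hk]
    ring
  have h := norm_integral_bessel_le hd (k * ζ.im) ha (hf.twist hr h2) (hg.twist hr h2)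
  rw [hkζ] at h
  have hsq : ∀ (φ : Euc d → ℂ) x, ‖twist r φ ζ x‖ ^ 2 = ‖φ x‖ ^ r := fun φ x => by
    rw [norm_twist hr φ h2, hζ, ← Real.rpow_natCast, ← Real.rpow_mul (norm_nonneg _)]
    congr 1
    push_cast
    ring
  simp only [hsq] at h
  have hn : ‖ζ‖ ≤ rexp |ζ.im| := by
    calc ‖ζ‖ ≤ |ζ.re| + |ζ.im| := Complex.norm_le_abs_re_add_abs_im ζ
      _ ≤ _ := by rw [hζ, abs_one, add_comm]; exact Real.add_one_le_exp _
  rw [Complex.Gamma_add_one _ hζ0, norm_mul, norm_mul, Complex.norm_real,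
    Real.norm_of_nonneg hk0.le, Real.mul_rpow (by positivity) (by positivity), mul_assoc]
  have habs : 2 * π * |k * ζ.im| = π * (d + 1) * |ζ.im| := by
    rw [abs_mul, abs_of_pos hk0, hk]; ring
  rw [habs] at h
  calc _ ≤ k * rexp |ζ.im| * _ :=
        mul_le_mul (mul_le_mul_of_nonneg_left hn hk0.le) h (by positivity) (by positivity)
    _ = _ := by
        rw [Real.exp_add]; ring

end WaveStrichartz

namespace WaveStrichartz

/-- The dual Strichartz exponent `2(d+1)/(d+3)`. -/
def dualExp (d : ℕ) : ℝ := 2 * ((d : ℝ) + 1) / ((d : ℝ) + 3)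

/-- The decay rate `(d-1)/(d+1)` of the wave propagator between dual Strichartz spaces. -/
def decayExp (d : ℕ) : ℝ := ((d : ℝ) - 1) / ((d : ℝ) + 1)

theorem decayExp_pos {d : ℕ} (hd : 2 ≤ d) : 0 < decayExp d := by
  have : (2 : ℝ) ≤ d := by exact_mod_cast hd
  exact div_pos (by linarith) (by linarith)

theorem decayExp_lt_one (d : ℕ) : decayExp d < 1 := by
  have : (0 : ℝ) ≤ d := by positivity
  exact (div_lt_one (by linarith)).2 (by linarith)

theorem dualExp_pos (d : ℕ) : 0 < dualExp d := by
  unfold dualExp; positivity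

theorem one_div_dualExp (d : ℕ) : 1 / dualExp d = 1 - decayExp d / 2 := by
  have : (0 : ℝ) ≤ d := by positivity
  rw [dualExp, decayExp]
  have h1 : (d : ℝ) + 1 ≠ 0 := by linarith
  have h3 : (d : ℝ) + 3 ≠ 0 := by linarith
  field_simp
  ring

theorem exists_Gamma_strip_bound {k : ℝ} (hk : 0 ≤ k) : ∃ M : ℝ, ∀ ζ : ℂ, 0 ≤ ζ.re → ζ.re ≤ 1 →
    ‖Complex.Gamma (k * ζ + 1)‖ ≤ M := by
  have hc : ContinuousOn Real.Gamma (Icc 1 (k + 1)) := fun x hx =>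
    (Real.differentiableAt_Gamma fun m => by
      have : (0 : ℝ) ≤ m := by positivity
      linarith [hx.1]).continuousAt.continuousWithinAt
  obtain ⟨M, hM⟩ := isCompact_Icc.exists_bound_of_continuousOn hc
  refine ⟨M, fun ζ h0 h1 => ?_⟩
  have hre : ((k : ℂ) * ζ + 1).re = k * ζ.re + 1 := by simp
  have h2 : 0 ≤ k * ζ.re := mul_nonneg hk h0
  have h3 : k * ζ.re ≤ k := mul_le_of_le_one_right hk h1
  refine (norm_Gamma_le_Gamma_re (by rw [hre]; linarith)).trans ?_
  rw [hre]
  exact (le_abs_self _).trans (hM _ ⟨by linarith, by linarith⟩)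

theorem norm_cexp_sq (ζ : ℂ) : ‖Complex.exp (ζ ^ 2)‖ = rexp (ζ.re ^ 2 - ζ.im ^ 2) := by
  rw [Complex.norm_exp]
  congr 1
  simp [sq, Complex.mul_re]

/-- The dispersive estimate for the (regularised) half-wave propagator, by Stein interpolation. -/
theorem exists_norm_integral_waveKernel_le {d : ℕ} (hd : 2 ≤ d) :
    ∃ C : ℝ, 0 ≤ C ∧ ∀ (a : ℂ) (_ : 0 < a.re) (f g : Euc d → ℂ) (_ : IsTest f) (_ : IsTest g),
      ‖∫ z : Euc d × Euc d, f z.1 * g z.2 * waveKernel a (z.1 - z.2)‖ ≤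
        C * ‖a‖ ^ (-decayExp d) *
          ((∫ x, ‖f x‖ ^ dualExp d) * (∫ x, ‖g x‖ ^ dualExp d)) ^ (1 / dualExp d) := by
  set k : ℝ := ((d : ℝ) + 1) / 2 with hk
  have hk0 : 0 < k := by positivity
  set r := dualExp d with hr
  have hr0 : 0 < r := dualExp_pos d
  set θ := decayExp d with hθ
  have hθ0 : 0 < θ := decayExp_pos hd
  have hθ1 : θ < 1 := decayExp_lt_one d
  set C₁ : ℝ := k * (2 / √π * π ^ (2 : ℝ) * π ^ ((d : ℝ) / 2) / (2 * π)) with hC₁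
  have hC₁0 : 0 ≤ C₁ := by positivity
  set B₀ := rexp ((k * π) ^ 2) with hB₀
  set B₁ := rexp 1 * rexp ((1 + π * (d + 1)) ^ 2) * C₁ with hB₁
  have hkθ : k * θ = ((d : ℝ) - 1) / 2 := by
    rw [hk, hθ, decayExp]
    have : (d : ℝ) + 1 ≠ 0 := by positivity
    field_simp
  have hG0 : 0 < Real.Gamma (k * θ + 1) := Real.Gamma_pos_of_pos (by positivity)
  refine ⟨‖waveConst d‖ * (B₀ ^ (1 - θ) * B₁ ^ θ / Real.Gamma (k * θ + 1)), by positivity,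
    fun a ha f g hf hg => ?_⟩
  set X := (∫ x, ‖f x‖ ^ r) * (∫ x, ‖g x‖ ^ r) with hX
  have hX0 : 0 ≤ X := by positivity
  have ha0 : 0 < ‖a‖ := norm_pos_iff.2 fun h => by simp [h] at ha
  set S : ℂ → ℂ := fun ζ => ∫ z, steinIntegrand d r k a f g ζ z with hS
  set Φ : ℂ → ℂ := fun ζ => Complex.exp (ζ ^ 2) * Complex.Gamma (k * ζ + 1) * S ζ with hΦ
  have hdiff : DifferentiableOn ℂ Φ {ζ | |ζ.re| < 2 ∧ 0 < k * ζ.re + 1} := by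
    refine DifferentiableOn.mul (DifferentiableOn.mul (by fun_prop) fun ζ hζ => ?_)
      ((differentiableOn_integral_steinIntegrand hr0 hk0.le ha hf hg).mono fun ζ hζ => hζ.1)
    refine DifferentiableAt.differentiableWithinAt (DifferentiableAt.comp (g := Complex.Gamma) ζ
      (Complex.differentiableAt_Gamma _ fun m h => ?_) (by fun_prop))
    have h1 : ((k : ℂ) * ζ + 1).re = -(m : ℝ) := by rw [h]; simp
    have h2 : ((k : ℂ) * ζ + 1).re = k * ζ.re + 1 := by simp
    have h3 : (0 : ℝ) ≤ m := by positivity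
    linarith [hζ.2]
  have hcl : DiffContOnCl ℂ Φ (Complex.HadamardThreeLines.verticalStrip 0 1) := by
    refine (hdiff.mono fun ζ hζ => ?_).diffContOnCl
    have h1 : ζ ∈ Complex.re ⁻¹' Icc 0 1 := by
      refine closure_minimal ?_ (isClosed_Icc.preimage Complex.continuous_re) hζ
      exact fun w hw => ⟨hw.1.le, hw.2.le⟩
    obtain ⟨h2, h3⟩ := h1
    refine ⟨abs_lt.2 ⟨by linarith, by linarith⟩, ?_⟩
    have := mul_nonneg hk0.le h2
    linarith
  have hbdd : BddAbove ((norm ∘ Φ) '' Complex.HadamardThreeLines.verticalClosedStrip 0 1) := by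
    obtain ⟨M, hM⟩ := exists_Gamma_strip_bound hk0.le
    obtain ⟨A, hA0, hA⟩ := exists_integral_steinIntegrand_le hr0 hk0.le ha hf hg
    refine ⟨rexp 1 * M * A * rexp ((k * π) ^ 2), ?_⟩
    rintro _ ⟨ζ, ⟨h0, h1⟩, rfl⟩
    have hM0 : 0 ≤ M := (norm_nonneg _).trans (hM ζ h0 h1)
    have he : ‖Complex.exp (ζ ^ 2)‖ ≤ rexp 1 * rexp (-ζ.im ^ 2) := by
      rw [norm_cexp_sq, ← Real.exp_add]
      refine Real.exp_le_exp.2 ?_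
      nlinarith
    simp only [Function.comp, hΦ, norm_mul]
    calc _ ≤ rexp 1 * rexp (-ζ.im ^ 2) * M * (A * rexp (k * π * |ζ.im|)) := by
          refine mul_le_mul (mul_le_mul he (hM ζ h0 h1) (norm_nonneg _) (by positivity))
            (hA ζ (abs_lt.2 ⟨by linarith, by linarith⟩)) (norm_nonneg _) (by positivity)
      _ = rexp 1 * M * A * rexp (k * π * |ζ.im| - ζ.im ^ 2) := by
          rw [sub_eq_add_neg, Real.exp_add]; ring
      _ ≤ _ := mul_le_mul_of_nonneg_left (exp_mul_sub_sq_le _ _) (by positivity)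
  have hline0 : ∀ ζ ∈ Complex.re ⁻¹' {0}, ‖Φ ζ‖ ≤ B₀ * X := by
    intro ζ hζ
    have hζ' : ζ.re = 0 := hζ
    have hΓ : ‖Complex.Gamma (k * ζ + 1)‖ ≤ 1 := by
      have hre : ((k : ℂ) * ζ + 1).re = 1 := by simp [hζ']
      refine (norm_Gamma_le_Gamma_re (by rw [hre]; norm_num)).trans ?_
      rw [hre, Real.Gamma_one]
    simp only [hΦ, norm_mul, norm_cexp_sq, hζ']
    calc _ ≤ rexp (0 ^ 2 - ζ.im ^ 2) * 1 * (rexp (k * π * |ζ.im|) * X) := by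
          refine mul_le_mul (mul_le_mul_of_nonneg_left hΓ (Real.exp_pos _).le)
            (norm_integral_steinIntegrand_zero_le hr0 hk0.le ha hf hg hζ') (norm_nonneg _)
            (by positivity)
      _ = rexp (k * π * |ζ.im| - ζ.im ^ 2) * X := by
          rw [sub_eq_add_neg (k * π * |ζ.im|), Real.exp_add]; ring_nf
      _ ≤ _ := mul_le_mul_of_nonneg_right (exp_mul_sub_sq_le _ _) hX0
  have hline1 : ∀ ζ ∈ Complex.re ⁻¹' {1}, ‖Φ ζ‖ ≤ B₁ * (X ^ (1 / 2 : ℝ) / ‖a‖) := by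
    intro ζ hζ
    have hζ' : ζ.re = 1 := hζ
    have h := norm_integral_steinIntegrand_one_le (by omega) hr0 ha hf hg hζ'
    simp only [hΦ, norm_mul, norm_cexp_sq, hζ', mul_assoc]
    calc _ ≤ rexp (1 ^ 2 - ζ.im ^ 2) * (C₁ * (rexp (|ζ.im| + π * (d + 1) * |ζ.im|) / ‖a‖ *
          X ^ (1 / 2 : ℝ))) := mul_le_mul_of_nonneg_left h (Real.exp_pos _).le
      _ = rexp 1 * rexp ((1 + π * (d + 1)) * |ζ.im| - ζ.im ^ 2) * C₁ * (X ^ (1 / 2 : ℝ) / ‖a‖) := by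
          rw [sub_eq_add_neg, sub_eq_add_neg, Real.exp_add, Real.exp_add _ (-ζ.im ^ 2),
            show |ζ.im| + π * (d + 1) * |ζ.im| = (1 + π * (d + 1)) * |ζ.im| by ring]
          ring_nf
      _ ≤ _ := by
          refine mul_le_mul_of_nonneg_right (mul_le_mul_of_nonneg_right
            (mul_le_mul_of_nonneg_left (exp_mul_sub_sq_le _ _) (Real.exp_pos _).le) hC₁0)
            (by positivity)
  have hmem : (θ : ℂ) ∈ Complex.HadamardThreeLines.verticalClosedStrip 0 1 := by
    refine ⟨?_, ?_⟩ <;> simp [hθ0.le, hθ1.le]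
  have hfin := Complex.HadamardThreeLines.norm_le_interp_of_mem_verticalClosedStrip₀₁' Φ hmem hcl
    hbdd hline0 hline1
  rw [Complex.ofReal_re] at hfin
  have hrθ : ((r : ℂ) * (1 - (θ : ℂ) / 2) - 1) = 0 := by
    have h1 := one_div_dualExp d
    rw [← hr, ← hθ] at h1
    have h2 : r * (1 - θ / 2) - 1 = 0 := by rw [← h1]; field_simp; simp
    exact_mod_cast congrArg (fun x : ℝ => (x : ℂ)) h2
  have htw : ∀ φ : Euc d → ℂ, twist r φ θ = φ := fun φ => by
    funext x; simp [twist, hrθ]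
  have hSθ : ∫ z : Euc d × Euc d, f z.1 * g z.2 * waveKernel a (z.1 - z.2) =
      waveConst d * S θ := by
    rw [hS, ← integral_const_mul]
    refine integral_congr_ae (Filter.Eventually.of_forall fun z => ?_)
    have he : (-((k : ℂ) * (θ : ℂ))) = -(((d : ℂ) - 1) / 2) := by
      rw [← Complex.ofReal_mul, hkθ]; push_cast; ring
    simp only [steinIntegrand, htw, waveKernel, he]
    ring
  have hΦθ : Real.Gamma (k * θ + 1) * ‖S θ‖ ≤ ‖Φ θ‖ := by
    have h1 : (k : ℂ) * θ + 1 = ((k * θ + 1 : ℝ) : ℂ) := by push_cast; ring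
    simp only [hΦ, norm_mul, norm_cexp_sq, h1, Complex.Gamma_ofReal, Complex.norm_real,
      Real.norm_of_nonneg hG0.le, Complex.ofReal_re, Complex.ofReal_im]
    rw [mul_assoc]
    refine le_mul_of_one_le_left (by positivity) (Real.one_le_exp ?_)
    nlinarith
  have hpow : (B₀ * X) ^ (1 - θ) * (B₁ * (X ^ (1 / 2 : ℝ) / ‖a‖)) ^ θ =
      B₀ ^ (1 - θ) * B₁ ^ θ * ‖a‖ ^ (-θ) * X ^ (1 / r) := by
    clear_value X
    have h1 : X ^ (1 / r) = X ^ (1 - θ) * X ^ (θ / 2) := by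
      rw [one_div_dualExp, ← Real.rpow_add_of_nonneg hX0 (by linarith) (by linarith)]
      congr 1; ring
    rw [Real.mul_rpow (by positivity) hX0, Real.mul_rpow (by positivity) (by positivity),
      Real.div_rpow (by positivity) ha0.le, ← Real.rpow_mul hX0, Real.rpow_neg ha0.le, h1,
      show (1 / 2 * θ : ℝ) = θ / 2 by ring]
    ring
  rw [hSθ, norm_mul]
  calc _ ≤ ‖waveConst d‖ * ((B₀ * X) ^ (1 - θ) * (B₁ * (X ^ (1 / 2 : ℝ) / ‖a‖)) ^ θ /
        Real.Gamma (k * θ + 1)) := by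
        refine mul_le_mul_of_nonneg_left ?_ (norm_nonneg _)
        rw [le_div_iff₀ hG0, mul_comm]
        exact hΦθ.trans hfin
    _ = _ := by rw [hpow]; ring

end WaveStrichartz

namespace WaveStrichartz

theorem lintegral_Ioc_rpow {s ρ : ℝ} (hs : -1 < s) (hρ : 0 ≤ ρ) :
    ∫⁻ x in Ioc 0 ρ, ENNReal.ofReal (x ^ s) = ENNReal.ofReal (ρ ^ (s + 1) / (s + 1)) := by
  have h1 : IntegrableOn (fun x : ℝ => x ^ s) (Ioc 0 ρ) := by
    rw [← uIoc_of_le hρ, ← intervalIntegrable_iff]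
    exact intervalIntegral.intervalIntegrable_rpow' hs
  rw [← ofReal_integral_eq_lintegral_ofReal h1
    ((ae_restrict_iff' measurableSet_Ioc).2 (Filter.Eventually.of_forall fun x hx =>
      Real.rpow_nonneg hx.1.le _)), ← intervalIntegral.integral_of_le hρ,
    integral_rpow (Or.inl hs), Real.zero_rpow (by linarith), sub_zero]

/-- The one-dimensional Riesz kernel. -/
def rieszKernel (θ x : ℝ) : ℝ≥0∞ := ENNReal.ofReal (|x| ^ (-θ))

theorem measurable_rieszKernel (θ : ℝ) : Measurable (rieszKernel θ) := by
  unfold rieszKernel; fun_prop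

theorem setLIntegral_rieszKernel_le {θ : ℝ} (h0 : 0 < θ) (h1 : θ < 1) (B : Set ℝ)
    (s : ℝ) :
    ∫⁻ t in B, rieszKernel θ (t - s) ≤ ENNReal.ofReal (2 / (1 - θ) + 1) * volume B ^ (1 - θ) := by
  rcases eq_or_ne (volume B) 0 with hv | hv
  · rw [Measure.restrict_eq_zero.2 hv]; simp
  rcases eq_or_ne (volume B) ∞ with hi | hi
  · rw [hi, ENNReal.top_rpow_of_pos (by linarith), ENNReal.mul_top]
    · exact le_top
    · rw [Ne, ENNReal.ofReal_eq_zero, not_le]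
      have : 0 < 2 / (1 - θ) := div_pos two_pos (by linarith)
      linarith
  set ρ := (volume B).toReal with hρ
  have hρ0 : 0 < ρ := ENNReal.toReal_pos hv hi
  set ψ : ℝ → ℝ≥0∞ := (Ioc 0 ρ).indicator fun x => ENNReal.ofReal (x ^ (-θ)) with hψ
  have hψm : Measurable ψ := by
    refine Measurable.indicator ?_ measurableSet_Ioc
    fun_prop
  have hpt : ∀ x : ℝ, rieszKernel θ x ≤ ψ x + ψ (-x) + ENNReal.ofReal (ρ ^ (-θ)) := by
    intro x
    rcases lt_or_ge ρ |x| with hx | hx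
    · refine le_add_left (ENNReal.ofReal_le_ofReal ?_)
      exact Real.rpow_le_rpow_of_nonpos hρ0 hx.le (by linarith)
    · rcases lt_trichotomy x 0 with hx0 | hx0 | hx0
      · rw [abs_of_neg hx0] at hx
        have : ψ (-x) = rieszKernel θ x := by
          rw [hψ, indicator_of_mem (show -x ∈ Ioc 0 ρ from ⟨by linarith, hx⟩), rieszKernel, abs_of_neg hx0]
        rw [this]
        exact le_add_right le_add_self
      · rw [rieszKernel, hx0, abs_zero, Real.zero_rpow (by linarith), ENNReal.ofReal_zero]
        exact zero_le
      · rw [abs_of_pos hx0] at hx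
        have : ψ x = rieszKernel θ x := by
          rw [hψ, indicator_of_mem (show x ∈ Ioc 0 ρ from ⟨hx0, hx⟩), rieszKernel, abs_of_pos hx0]
        rw [this, add_assoc]
        exact le_self_add
  have hψi : ∫⁻ x, ψ x = ENNReal.ofReal (ρ ^ (1 - θ) / (1 - θ)) := by
    rw [hψ, lintegral_indicator measurableSet_Ioc, lintegral_Ioc_rpow (by linarith) hρ0.le]
    ring_nf
  have hvB : volume B = ENNReal.ofReal ρ := (ENNReal.ofReal_toReal hi).symm
  calc _ ≤ ∫⁻ t in B, (ψ (t - s) + ψ (-(t - s)) + ENNReal.ofReal (ρ ^ (-θ))) :=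
        lintegral_mono fun t => hpt _
    _ = (∫⁻ t in B, (ψ (t - s) + ψ (-(t - s)))) + ENNReal.ofReal (ρ ^ (-θ)) * volume B := by
        rw [lintegral_add_right _ measurable_const, setLIntegral_const]
    _ ≤ (∫⁻ t, (ψ (t - s) + ψ (-(t - s)))) + ENNReal.ofReal (ρ ^ (-θ)) * volume B := by
        gcongr
        exact Measure.restrict_le_self
    _ = _ := by
        rw [lintegral_sub_right_eq_self (fun x => ψ x + ψ (-x)) s, lintegral_add_left hψm,
          lintegral_neg_eq_self ψ, hψi, hvB, ENNReal.ofReal_rpow_of_pos hρ0,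
          ← ENNReal.ofReal_add (by positivity) (by positivity), ← ENNReal.ofReal_mul (by positivity),
          ← ENNReal.ofReal_add (by positivity) (by positivity), ← ENNReal.ofReal_mul (by positivity)]
        · congr 1
          have h2 : ρ ^ (1 - θ) = ρ ^ (-θ) * ρ := by
            rw [← Real.rpow_add_one hρ0.ne']; ring_nf
          rw [← h2]
          ring

theorem setLIntegral_rpow_le {θ : ℝ} (h0 : 0 < θ) (h1 : θ < 1) {w : ℝ → ℝ≥0∞} (hw : Measurable w)
    {a : ℝ} (ha : 0 < a) :
    ∫⁻ b in Ioc 0 a, w b ^ (1 - θ) ≤ ENNReal.ofReal 2 * ENNReal.ofReal (a ^ (θ / (2 - θ))) *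
      (∫⁻ b in Ioi 0, w b * ENNReal.ofReal (b ^ (θ / (2 - θ)))) ^ (1 - θ) := by
  have h2 : 0 < 2 - θ := by linarith
  have he : ∀ b ∈ Ioc 0 a, w b ^ (1 - θ) = (w b * ENNReal.ofReal (b ^ (θ / (2 - θ)))) ^ (1 - θ) *
      ENNReal.ofReal (b ^ (-((1 - θ) / (2 - θ)))) ^ θ := by
    intro b hb
    have hb0 : 0 < b := hb.1
    rw [ENNReal.mul_rpow_of_nonneg _ _ (by linarith), mul_assoc,
      ENNReal.ofReal_rpow_of_pos (by positivity), ENNReal.ofReal_rpow_of_pos (by positivity),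
      ← ENNReal.ofReal_mul (by positivity), ← Real.rpow_mul hb0.le, ← Real.rpow_mul hb0.le,
      ← Real.rpow_add hb0, show θ / (2 - θ) * (1 - θ) + -((1 - θ) / (2 - θ)) * θ = 0 by ring,
      Real.rpow_zero, ENNReal.ofReal_one, mul_one]
  have hμ : -1 < -((1 - θ) / (2 - θ)) := by
    rw [neg_lt_neg_iff, div_lt_one h2]; linarith
  rw [setLIntegral_congr_fun measurableSet_Ioc he]
  refine (ENNReal.lintegral_mul_norm_pow_le (by fun_prop) (by fun_prop) (by linarith) h0.le
    (by ring)).trans ?_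
  rw [lintegral_Ioc_rpow hμ ha.le, mul_comm]
  refine mul_le_mul' ?_ (ENNReal.rpow_le_rpow (lintegral_mono_set Ioc_subset_Ioi_self) (by linarith))
  have h3 : -((1 - θ) / (2 - θ)) + 1 = 1 / (2 - θ) := by field_simp; ring
  rw [h3, ENNReal.ofReal_rpow_of_nonneg (by positivity) h0.le, ← ENNReal.ofReal_mul two_pos.le]
  refine ENNReal.ofReal_le_ofReal ?_
  rw [div_div_eq_mul_div, div_one, Real.mul_rpow (by positivity) h2.le, ← Real.rpow_mul ha.le, mul_comm,
    one_div_mul_eq_div]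
  refine mul_le_mul_of_nonneg_right ?_ (by positivity)
  calc (2 - θ) ^ θ ≤ (2 : ℝ) ^ θ := Real.rpow_le_rpow h2.le (by linarith) h0.le
    _ ≤ 2 ^ (1 : ℝ) := Real.rpow_le_rpow_of_exponent_le one_le_two h1.le
    _ = 2 := Real.rpow_one 2

theorem lintegral_mul_eq_layercake {f : ℝ → ℝ} (hf : Measurable f) (hf0 : ∀ x, 0 ≤ f x)
    {P : ℝ → ℝ≥0∞} (hP : Measurable P) :
    ∫⁻ s, P s * ENNReal.ofReal (f s) = ∫⁻ a in Ioi 0, ∫⁻ s in {s | a < f s}, P s := by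
  have h1 := lintegral_eq_lintegral_meas_lt (volume.withDensity P)
    (Filter.Eventually.of_forall hf0) hf.aemeasurable
  rw [lintegral_withDensity_eq_lintegral_mul _ hP (by fun_prop)] at h1
  refine h1.trans (lintegral_congr fun a => ?_)
  exact withDensity_apply _ (measurableSet_lt measurable_const hf)

theorem measurable_volume_lt (f : ℝ → ℝ) : Measurable fun a => volume {x | a < f x} :=
  Antitone.measurable fun _ _ h => measure_mono fun _ hx => lt_of_le_of_lt h hx

end WaveStrichartz

namespace WaveStrichartz

theorem rieszKernel_neg (θ x : ℝ) : rieszKernel θ (-x) = rieszKernel θ x := by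
  simp [rieszKernel]

/-- The distributional form of the one-dimensional Riesz potential estimate. -/
theorem lintegral_rieszKernel_le_add {θ : ℝ} (h0 : 0 < θ) (h1 : θ < 1) {f g : ℝ → ℝ}
    (hf : Measurable f) (hf0 : ∀ x, 0 ≤ f x) (hg : Measurable g) (hg0 : ∀ x, 0 ≤ g x) :
    ∫⁻ s, (∫⁻ t, rieszKernel θ (t - s) * ENNReal.ofReal (g t)) * ENNReal.ofReal (f s) ≤
      ENNReal.ofReal (2 / (1 - θ) + 1) * ENNReal.ofReal 2 *
      ((∫⁻ a in Ioi 0, volume {x | a < f x} * ENNReal.ofReal (a ^ (θ / (2 - θ)))) *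
        (∫⁻ b in Ioi 0, volume {x | b < g x} * ENNReal.ofReal (b ^ (θ / (2 - θ)))) ^ (1 - θ) +
      (∫⁻ b in Ioi 0, volume {x | b < g x} * ENNReal.ofReal (b ^ (θ / (2 - θ)))) *
        (∫⁻ a in Ioi 0, volume {x | a < f x} * ENNReal.ofReal (a ^ (θ / (2 - θ)))) ^ (1 - θ)) := by
  set v : ℝ → ℝ≥0∞ := fun a => volume {x | a < f x} with hv
  set w : ℝ → ℝ≥0∞ := fun b => volume {x | b < g x} with hw
  have hvm : Measurable v := measurable_volume_lt f
  have hwm : Measurable w := measurable_volume_lt g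
  set V := ∫⁻ a in Ioi 0, v a * ENNReal.ofReal (a ^ (θ / (2 - θ))) with hV
  set W := ∫⁻ b in Ioi 0, w b * ENNReal.ofReal (b ^ (θ / (2 - θ))) with hW
  set c := ENNReal.ofReal (2 / (1 - θ) + 1) with hc
  have hB : ∀ b, MeasurableSet {t | b < g t} := fun b => measurableSet_lt measurable_const hg
  have hKm : Measurable (fun p : ℝ × ℝ => rieszKernel θ (p.2 - p.1)) :=
    (measurable_rieszKernel θ).comp (measurable_snd.sub measurable_fst)
  have hPm : Measurable fun s => ∫⁻ t, rieszKernel θ (t - s) * ENNReal.ofReal (g t) := by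
    refine Measurable.lintegral_prod_right'
      (f := fun p : ℝ × ℝ => rieszKernel θ (p.2 - p.1) * ENNReal.ofReal (g p.2)) ?_
    exact hKm.mul (by fun_prop)
  have hQm : Measurable fun p : ℝ × ℝ => ∫⁻ t in {t | p.2 < g t}, rieszKernel θ (t - p.1) := by
    have : ∀ p : ℝ × ℝ, ∫⁻ t in {t | p.2 < g t}, rieszKernel θ (t - p.1) =
        ∫⁻ t, {q : (ℝ × ℝ) × ℝ | q.1.2 < g q.2}.indicator
          (fun q => rieszKernel θ (q.2 - q.1.1)) (p, t) := fun p => by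
      rw [← lintegral_indicator (hB p.2)]
      rfl
    simp only [this]
    refine Measurable.lintegral_prod_right' (Measurable.indicator ?_ ?_)
    · exact (measurable_rieszKernel θ).comp (by fun_prop)
    · exact measurableSet_lt (by fun_prop) (by fun_prop)
  set J : ℝ → ℝ → ℝ≥0∞ := fun a b => ∫⁻ s in {s | a < f s}, ∫⁻ t in {t | b < g t},
    rieszKernel θ (t - s) with hJ
  have hJ1 : ∀ a b, J a b ≤ c * (v a * w b ^ (1 - θ)) := fun a b => by
    calc J a b ≤ ∫⁻ s in {s | a < f s}, c * w b ^ (1 - θ) :=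
          lintegral_mono fun s => setLIntegral_rieszKernel_le h0 h1 _ s
      _ = _ := by rw [setLIntegral_const]; ring
  have hJ2 : ∀ a b, J a b ≤ c * (w b * v a ^ (1 - θ)) := fun a b => by
    calc J a b = ∫⁻ t in {t | b < g t}, ∫⁻ s in {s | a < f s}, rieszKernel θ (t - s) :=
          lintegral_lintegral_swap hKm.aemeasurable
      _ ≤ ∫⁻ t in {t | b < g t}, c * v a ^ (1 - θ) := lintegral_mono fun t => by
          simp only [← rieszKernel_neg θ (t - _), neg_sub]
          exact setLIntegral_rieszKernel_le h0 h1 _ t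
      _ = _ := by rw [setLIntegral_const]; ring
  have hI : ∫⁻ s, (∫⁻ t, rieszKernel θ (t - s) * ENNReal.ofReal (g t)) * ENNReal.ofReal (f s) =
      ∫⁻ a in Ioi 0, ∫⁻ b in Ioi 0, J a b := by
    rw [lintegral_mul_eq_layercake hf hf0 hPm]
    refine lintegral_congr fun a => ?_
    have : ∀ s, ∫⁻ t, rieszKernel θ (t - s) * ENNReal.ofReal (g t) =
        ∫⁻ b in Ioi 0, ∫⁻ t in {t | b < g t}, rieszKernel θ (t - s) := fun s =>
      lintegral_mul_eq_layercake hg hg0 (P := fun t => rieszKernel θ (t - s))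
        ((measurable_rieszKernel θ).comp (by fun_prop))
    simp only [this]
    exact lintegral_lintegral_swap hQm.aemeasurable
  set J₁ : ℝ → ℝ → ℝ≥0∞ := fun a => (Ioc 0 a).indicator fun b => c * (v a * w b ^ (1 - θ))
  set J₂ : ℝ → ℝ → ℝ≥0∞ := fun a b => (Ioc 0 b).indicator (fun a => c * (w b * v a ^ (1 - θ))) a
  have hJ₁m : Measurable (Function.uncurry J₁) := by
    have : Function.uncurry J₁ = {p : ℝ × ℝ | 0 < p.2 ∧ p.2 ≤ p.1}.indicator
        fun p => c * (v p.1 * w p.2 ^ (1 - θ)) := rfl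
    rw [this]
    refine Measurable.indicator (by fun_prop) ?_
    exact (measurableSet_lt measurable_const measurable_snd).inter
      (measurableSet_le measurable_snd measurable_fst)
  have hJ₂m : Measurable (Function.uncurry J₂) := by
    have : Function.uncurry J₂ = {p : ℝ × ℝ | 0 < p.1 ∧ p.1 ≤ p.2}.indicator
        fun p => c * (w p.2 * v p.1 ^ (1 - θ)) := rfl
    rw [this]
    refine Measurable.indicator (by fun_prop) ?_
    exact (measurableSet_lt measurable_const measurable_fst).inter
      (measurableSet_le measurable_fst measurable_snd)
  have hI₁ : ∫⁻ a in Ioi 0, ∫⁻ b in Ioi 0, J₁ a b ≤ c * ENNReal.ofReal 2 * (V * W ^ (1 - θ)) := by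
    calc _ ≤ ∫⁻ a in Ioi 0, c * ENNReal.ofReal 2 * W ^ (1 - θ) *
          (v a * ENNReal.ofReal (a ^ (θ / (2 - θ)))) := by
          refine setLIntegral_mono' measurableSet_Ioi fun a ha => ?_
          calc ∫⁻ b in Ioi 0, J₁ a b ≤ ∫⁻ b, J₁ a b := setLIntegral_le_lintegral _ _
            _ = c * (v a * ∫⁻ b in Ioc 0 a, w b ^ (1 - θ)) := by
                rw [lintegral_indicator measurableSet_Ioc, lintegral_const_mul _ (by fun_prop),
                  lintegral_const_mul _ (by fun_prop)]
            _ ≤ c * (v a * (ENNReal.ofReal 2 * ENNReal.ofReal (a ^ (θ / (2 - θ))) *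
                W ^ (1 - θ))) := by gcongr; exact setLIntegral_rpow_le h0 h1 hwm ha
            _ = _ := by ring
      _ = _ := by rw [lintegral_const_mul _ (by fun_prop)]; ring
  have hI₂ : ∫⁻ a in Ioi 0, ∫⁻ b in Ioi 0, J₂ a b ≤ c * ENNReal.ofReal 2 * (W * V ^ (1 - θ)) := by
    rw [lintegral_lintegral_swap hJ₂m.aemeasurable]
    calc _ ≤ ∫⁻ b in Ioi 0, c * ENNReal.ofReal 2 * V ^ (1 - θ) *
          (w b * ENNReal.ofReal (b ^ (θ / (2 - θ)))) := by
          refine setLIntegral_mono' measurableSet_Ioi fun b hb => ?_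
          calc ∫⁻ a in Ioi 0, J₂ a b ≤ ∫⁻ a, J₂ a b := setLIntegral_le_lintegral _ _
            _ = c * (w b * ∫⁻ a in Ioc 0 b, v a ^ (1 - θ)) := by
                rw [lintegral_indicator measurableSet_Ioc, lintegral_const_mul _ (by fun_prop),
                  lintegral_const_mul _ (by fun_prop)]
            _ ≤ c * (w b * (ENNReal.ofReal 2 * ENNReal.ofReal (b ^ (θ / (2 - θ))) *
                V ^ (1 - θ))) := by gcongr; exact setLIntegral_rpow_le h0 h1 hvm hb
            _ = _ := by ring
      _ = _ := by rw [lintegral_const_mul _ (by fun_prop)]; ring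
  rw [hI]
  calc _ ≤ ∫⁻ a in Ioi 0, ∫⁻ b in Ioi 0, (J₁ a b + J₂ a b) := by
        refine setLIntegral_mono' measurableSet_Ioi fun a ha => ?_
        refine setLIntegral_mono' measurableSet_Ioi fun b hb => ?_
        rcases le_total b a with h | h
        · refine le_trans ((hJ1 a b).trans (le_of_eq ?_)) (le_self_add (a := J₁ a b))
          exact (indicator_of_mem (show b ∈ Ioc 0 a from ⟨hb, h⟩)
            (fun b => c * (v a * w b ^ (1 - θ)))).symm
        · refine le_trans ((hJ2 a b).trans (le_of_eq ?_)) (le_add_self (a := J₂ a b))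
          exact (indicator_of_mem (show a ∈ Ioc 0 b from ⟨ha, h⟩)
            (fun a => c * (w b * v a ^ (1 - θ)))).symm
    _ = (∫⁻ a in Ioi 0, ∫⁻ b in Ioi 0, J₁ a b) + ∫⁻ a in Ioi 0, ∫⁻ b in Ioi 0, J₂ a b := by
        have hm : Measurable fun a => ∫⁻ b in Ioi 0, J₁ a b := hJ₁m.lintegral_prod_right'
        rw [← lintegral_add_left hm]
        refine lintegral_congr fun a => lintegral_add_left (hJ₁m.comp measurable_prodMk_left) _
    _ ≤ _ := by
        rw [mul_add]
        exact add_le_add hI₁ hI₂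

end WaveStrichartz

namespace WaveStrichartz

theorem lintegral_volume_lt_le {θ : ℝ} (h0 : 0 < θ) (h1 : θ < 1) {f : ℝ → ℝ} (hf : Measurable f)
    (hf0 : ∀ x, 0 ≤ f x) :
    ∫⁻ a in Ioi 0, volume {x | a < f x} * ENNReal.ofReal (a ^ (θ / (2 - θ))) ≤
      ∫⁻ x, ENNReal.ofReal (f x ^ (2 / (2 - θ))) := by
  have h2 : 0 < 2 - θ := by linarith
  have hr : 2 / (2 - θ) - 1 = θ / (2 - θ) := by field_simp; ring
  rw [lintegral_rpow_eq_lintegral_meas_lt_mul volume (Filter.Eventually.of_forall hf0)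
    hf.aemeasurable (by positivity : 0 < 2 / (2 - θ)), hr]
  refine le_mul_of_one_le_left' ?_
  rw [ENNReal.one_le_ofReal, one_le_div h2]
  linarith

/-- The Hardy–Littlewood–Sobolev inequality on the line, in the diagonal case. -/
theorem lintegral_rieszKernel_le {θ : ℝ} (h0 : 0 < θ) (h1 : θ < 1) {f g : ℝ → ℝ}
    (hf : Measurable f) (hf0 : ∀ x, 0 ≤ f x) (hg : Measurable g) (hg0 : ∀ x, 0 ≤ g x) :
    ∫⁻ s, (∫⁻ t, rieszKernel θ (t - s) * ENNReal.ofReal (g t)) * ENNReal.ofReal (f s) ≤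
      ENNReal.ofReal (4 * (2 / (1 - θ) + 1)) *
      ((∫⁻ x, ENNReal.ofReal (f x ^ (2 / (2 - θ)))) *
        ∫⁻ x, ENNReal.ofReal (g x ^ (2 / (2 - θ)))) ^ ((2 - θ) / 2) := by
  have h2 : 0 < 2 - θ := by linarith
  set r := 2 / (2 - θ) with hr
  have hr0 : 0 < r := by positivity
  have hC : 0 < 2 / (1 - θ) + 1 := by
    have : 0 < 2 / (1 - θ) := div_pos two_pos (by linarith)
    linarith
  have key : ∀ f g : ℝ → ℝ, Measurable f → (∀ x, 0 ≤ f x) → Measurable g → (∀ x, 0 ≤ g x) →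
      ∫⁻ s, (∫⁻ t, rieszKernel θ (t - s) * ENNReal.ofReal (g t)) * ENNReal.ofReal (f s) ≤
      ENNReal.ofReal (2 * (2 / (1 - θ) + 1)) *
      ((∫⁻ x, ENNReal.ofReal (f x ^ r)) * (∫⁻ x, ENNReal.ofReal (g x ^ r)) ^ (1 - θ) +
        (∫⁻ x, ENNReal.ofReal (g x ^ r)) * (∫⁻ x, ENNReal.ofReal (f x ^ r)) ^ (1 - θ)) := by
    intro f g hf hf0 hg hg0
    refine (lintegral_rieszKernel_le_add h0 h1 hf hf0 hg hg0).trans ?_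
    rw [← ENNReal.ofReal_mul hC.le, mul_comm (2 / (1 - θ) + 1)]
    have hV := lintegral_volume_lt_le h0 h1 hf hf0
    have hW := lintegral_volume_lt_le h0 h1 hg hg0
    have h1' : 0 ≤ 1 - θ := by linarith
    exact mul_le_mul_right (add_le_add (mul_le_mul' hV (ENNReal.rpow_le_rpow hW h1'))
      (mul_le_mul' hW (ENNReal.rpow_le_rpow hV h1'))) _
  have hzero : ∀ f : ℝ → ℝ, Measurable f → (∀ x, 0 ≤ f x) → ∫⁻ x, ENNReal.ofReal (f x ^ r) = 0 →
      ∀ᵐ x, f x = 0 := by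
    intro f hf hf0 h
    rw [lintegral_eq_zero_iff (by fun_prop)] at h
    filter_upwards [h] with x hx
    have hx' : ENNReal.ofReal (f x ^ r) = 0 := hx
    rw [ENNReal.ofReal_eq_zero] at hx'
    exact (Real.rpow_eq_zero (hf0 x) hr0.ne').1 (le_antisymm hx' (Real.rpow_nonneg (hf0 x) _))
  set V := ∫⁻ x, ENNReal.ofReal (f x ^ r) with hV
  set W := ∫⁻ x, ENNReal.ofReal (g x ^ r) with hW
  rcases eq_or_ne V 0 with hV0 | hV0
  · refine le_of_eq_of_le ?_ zero_le
    rw [← lintegral_zero (μ := (volume : Measure ℝ))]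
    refine lintegral_congr_ae ?_
    filter_upwards [hzero f hf hf0 hV0] with x hx
    simp [hx]
  rcases eq_or_ne W 0 with hW0 | hW0
  · refine le_of_eq_of_le ?_ zero_le
    rw [← lintegral_zero (μ := (volume : Measure ℝ))]
    refine lintegral_congr fun s => ?_
    have : ∫⁻ t, rieszKernel θ (t - s) * ENNReal.ofReal (g t) = 0 := by
      rw [← lintegral_zero (μ := (volume : Measure ℝ))]
      refine lintegral_congr_ae ?_
      filter_upwards [hzero g hg hg0 hW0] with x hx
      simp [hx]
    rw [this, zero_mul]
  have hC4 : ENNReal.ofReal (4 * (2 / (1 - θ) + 1)) ≠ 0 := by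
    rw [Ne, ENNReal.ofReal_eq_zero, not_le]; positivity
  rcases eq_or_ne V ∞ with hVi | hVi
  · rw [hVi, ENNReal.top_mul hW0, ENNReal.top_rpow_of_pos (by positivity), ENNReal.mul_top hC4]
    exact le_top
  rcases eq_or_ne W ∞ with hWi | hWi
  · rw [hWi, ENNReal.mul_top hV0, ENNReal.top_rpow_of_pos (by positivity), ENNReal.mul_top hC4]
    exact le_top
  have hv0 : 0 < V.toReal := ENNReal.toReal_pos hV0 hVi
  have hw0 : 0 < W.toReal := ENNReal.toReal_pos hW0 hWi
  set v := V.toReal with hv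
  set w := W.toReal with hw
  have hVv : V = ENNReal.ofReal v := (ENNReal.ofReal_toReal hVi).symm
  have hWw : W = ENNReal.ofReal w := (ENNReal.ofReal_toReal hWi).symm
  set c := (w / v) ^ (1 / (2 * r)) with hc
  have hc0 : 0 < c := by positivity
  have hcr : c ^ r = (w / v) ^ (1 / 2 : ℝ) := by
    rw [hc, ← Real.rpow_mul (by positivity)]; congr 1; field_simp
  have hscale : ∀ (f : ℝ → ℝ) (_ : Measurable f) (_ : ∀ x, 0 ≤ f x) (c : ℝ) (_ : 0 < c),
      ∫⁻ x, ENNReal.ofReal ((c * f x) ^ r) =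
        ENNReal.ofReal (c ^ r) * ∫⁻ x, ENNReal.ofReal (f x ^ r) := by
    intro f hf hf0 c hc
    rw [← lintegral_const_mul _ (by fun_prop)]
    refine lintegral_congr fun x => ?_
    rw [Real.mul_rpow hc.le (hf0 x), ENNReal.ofReal_mul (by positivity)]
  have h := key (fun x => c * f x) (fun x => c⁻¹ * g x) (by fun_prop)
    (fun x => mul_nonneg hc0.le (hf0 x)) (by fun_prop)
    (fun x => mul_nonneg (inv_nonneg.2 hc0.le) (hg0 x))
  rw [hscale f hf hf0 c hc0, hscale g hg hg0 c⁻¹ (inv_pos.2 hc0), ← hV, ← hW] at h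
  have hI : ∫⁻ s, (∫⁻ t, rieszKernel θ (t - s) * ENNReal.ofReal (c⁻¹ * g t)) *
      ENNReal.ofReal (c * f s) =
      ∫⁻ s, (∫⁻ t, rieszKernel θ (t - s) * ENNReal.ofReal (g t)) * ENNReal.ofReal (f s) := by
    refine lintegral_congr fun s => ?_
    have hm : Measurable fun t => rieszKernel θ (t - s) * ENNReal.ofReal (g t) :=
      ((measurable_rieszKernel θ).comp (by fun_prop)).mul (by fun_prop)
    simp only [ENNReal.ofReal_mul (inv_nonneg.2 hc0.le), ENNReal.ofReal_mul hc0.le]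
    have : ∀ t, rieszKernel θ (t - s) * (ENNReal.ofReal c⁻¹ * ENNReal.ofReal (g t)) =
        ENNReal.ofReal c⁻¹ * (rieszKernel θ (t - s) * ENNReal.ofReal (g t)) := fun t => by ring
    simp only [this]
    rw [lintegral_const_mul _ hm]
    have hcc : ENNReal.ofReal c⁻¹ * ENNReal.ofReal c = 1 := by
      rw [← ENNReal.ofReal_mul (by positivity), inv_mul_cancel₀ hc0.ne', ENNReal.ofReal_one]
    calc _ = (ENNReal.ofReal c⁻¹ * ENNReal.ofReal c) *
        ((∫⁻ t, rieszKernel θ (t - s) * ENNReal.ofReal (g t)) * ENNReal.ofReal (f s)) := by ring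
      _ = _ := by rw [hcc, one_mul]
  have hs : ∀ {a b : ℝ}, 0 < a → 0 < b → (a / b) ^ (1 / 2 : ℝ) * b = (b * a) ^ (1 / 2 : ℝ) := by
    intro a b ha hb
    rw [← Real.sqrt_eq_rpow, ← Real.sqrt_eq_rpow, Real.sqrt_div ha.le, Real.sqrt_mul hb.le]
    have := Real.mul_self_sqrt hb.le
    have h3 : 0 < √b := Real.sqrt_pos.2 hb
    field_simp
    nlinarith
  have e1 : ENNReal.ofReal (c ^ r) * V = ENNReal.ofReal ((v * w) ^ (1 / 2 : ℝ)) := by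
    rw [hVv, ← ENNReal.ofReal_mul (by positivity), hcr, hs hw0 hv0]
  have e2 : ENNReal.ofReal (c⁻¹ ^ r) * W = ENNReal.ofReal ((v * w) ^ (1 / 2 : ℝ)) := by
    rw [hWw, ← ENNReal.ofReal_mul (by positivity), Real.inv_rpow hc0.le, hcr,
      ← Real.inv_rpow (by positivity), inv_div, hs hv0 hw0, mul_comm]
  rw [hI, e1, e2] at h
  refine h.trans (le_of_eq ?_)
  have hvw : 0 < v * w := mul_pos hv0 hw0
  rw [hVv, hWw, ← ENNReal.ofReal_mul hv0.le, ENNReal.ofReal_rpow_of_pos hvw,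
    ENNReal.ofReal_rpow_of_pos (by positivity), ← ENNReal.ofReal_mul (by positivity),
    ← ENNReal.ofReal_add (by positivity) (by positivity), ← ENNReal.ofReal_mul (by positivity),
    ← ENNReal.ofReal_mul (by positivity), ← Real.rpow_mul hvw.le, ← Real.rpow_add hvw]
  congr 1
  rw [show (1 / 2 : ℝ) + 1 / 2 * (1 - θ) = (2 - θ) / 2 by ring]
  ring

end WaveStrichartz

namespace WaveStrichartz

theorem norm_cpow_sq_add_sq_le {a : ℂ} (ha : 0 < a.re) (c : ℝ) {k : ℝ} (hk : 0 ≤ k) :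
    ‖(a ^ 2 + (c : ℂ) ^ 2) ^ (-(k : ℂ))‖ ≤ (a.re ^ 2) ^ (-k) := by
  have h : (-(k : ℂ)) = ((-k : ℝ) : ℂ) := by push_cast; ring
  rw [h, Complex.norm_cpow_real]
  exact Real.rpow_le_rpow_of_nonpos (by positivity) (sq_re_le_norm_sq_add_sq a c) (by linarith)

theorem continuous_cpow_sq_add_sq {X : Type*} [TopologicalSpace X] {d : ℕ} {a : X → ℂ}
    {x : X → Euc d} (ha : Continuous a) (hx : Continuous x) (h : ∀ p, 0 < (a p).re) (k : ℂ) :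
    Continuous fun p => (a p ^ 2 + (‖x p‖ : ℂ) ^ 2) ^ k :=
  Continuous.cpow (by fun_prop) continuous_const fun p => sq_add_sq_mem_slitPlane (h p) _

theorem norm_waveKernel_le {d : ℕ} (hd : 1 ≤ d) {a : ℂ} (ha : 0 < a.re) (x : Euc d) :
    ‖waveKernel a x‖ ≤ ‖waveConst d‖ * (a.re ^ 2) ^ (-(((d : ℝ) - 1) / 2)) := by
  have hd' : (1 : ℝ) ≤ d := by exact_mod_cast hd
  rw [waveKernel, norm_mul]
  have := norm_cpow_sq_add_sq_le ha ‖x‖ (k := ((d : ℝ) - 1) / 2) (by linarith)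
  push_cast at this
  gcongr

theorem continuous_waveKernel {X : Type*} [TopologicalSpace X] {d : ℕ} {a : X → ℂ}
    {x : X → Euc d} (ha : Continuous a) (hx : Continuous x) (h : ∀ p, 0 < (a p).re) :
    Continuous fun p => waveKernel (a p) (x p) :=
  continuous_const.mul (continuous_cpow_sq_add_sq ha hx h _)

/-- Exchanging the two middle factors of a product of four spaces preserves volume. -/
theorem exists_measurePreserving_prodComm (α β : Type*) [MeasureSpace α] [MeasureSpace β]
    [SFinite (volume : Measure α)] [SFinite (volume : Measure β)] :
    ∃ e : ((α × β) × (α × β)) ≃ᵐ ((α × α) × (β × β)), MeasurePreserving e ∧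
      ∀ p, e p = ((p.1.1, p.2.1), (p.1.2, p.2.2)) := by
  let e : ((α × β) × (α × β)) ≃ᵐ ((α × α) × (β × β)) :=
    { toFun := fun p => ((p.1.1, p.2.1), (p.1.2, p.2.2))
      invFun := fun p => ((p.1.1, p.2.1), (p.1.2, p.2.2))
      left_inv := fun _ => rfl
      right_inv := fun _ => rfl
      measurable_toFun := by dsimp; fun_prop
      measurable_invFun := by dsimp; fun_prop }
  refine ⟨e, ?_, fun _ => rfl⟩
  have h1 : MeasurePreserving (MeasurableEquiv.prodAssoc : (α × β) × (α × β) ≃ᵐ _) :=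
    volume_preserving_prodAssoc
  have h2 : MeasurePreserving (MeasurableEquiv.prodAssoc : (α × α) × (β × β) ≃ᵐ _) :=
    volume_preserving_prodAssoc
  have h3 : MeasurePreserving (MeasurableEquiv.prodAssoc : (β × α) × β ≃ᵐ _) :=
    volume_preserving_prodAssoc
  have h4 : MeasurePreserving (MeasurableEquiv.prodAssoc : (α × β) × β ≃ᵐ _) :=
    volume_preserving_prodAssoc
  have h5 : MeasurePreserving (Prod.map Prod.swap id : (β × α) × β → (α × β) × β) :=
    Measure.measurePreserving_swap.prod (MeasurePreserving.id _)
  have h6 := (h4.comp h5).comp (h3.symm)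
  have h7 := (MeasurePreserving.id (volume : Measure α)).prod h6
  exact (h2.symm.comp (h7.comp h1))

theorem IsTest.slice {d : ℕ} {G : ℝ × Euc d → ℂ} (hG : IsTest G) (t : ℝ) :
    IsTest fun x => G (t, x) := by
  obtain ⟨M, hM⟩ := hG.bdd
  obtain ⟨R, hR⟩ := hG.supp
  refine ⟨hG.measurable.comp (by fun_prop), ⟨M, fun x => hM _⟩, ⟨R, fun x hx => hR _ ?_⟩⟩
  exact hx.trans_le (norm_snd_le (t, x))

/-- Phase of the half-wave propagator. -/
def wavePhase (ε σ τ : ℝ) : ℂ := ε - σ * τ * Complex.I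

theorem wavePhase_re (ε σ τ : ℝ) : (wavePhase ε σ τ).re = ε := by simp [wavePhase]

theorem wavePhase_im (ε σ τ : ℝ) : (wavePhase ε σ τ).im = -(σ * τ) := by simp [wavePhase]

@[fun_prop]
theorem continuous_wavePhase (ε σ : ℝ) : Continuous (wavePhase ε σ) := by
  unfold wavePhase; fun_prop

theorem abs_le_norm_wavePhase (ε : ℝ) {σ : ℝ} (hσ : |σ| = 1) (τ : ℝ) :
    |τ| ≤ ‖wavePhase ε σ τ‖ := by
  have := Complex.abs_im_le_norm (wavePhase ε σ τ)
  rwa [wavePhase_im, abs_neg, abs_mul, hσ, one_mul] at this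

/-- The integrand of the space-time bilinear form of the wave propagator. -/
def waveForm {d : ℕ} (ε σ : ℝ) (w : ℝ × ℝ → ℂ) (G H : ℝ × Euc d → ℂ)
    (P : (ℝ × Euc d) × (ℝ × Euc d)) : ℂ :=
  w (P.1.1, P.2.1) * (G P.1 * H P.2 *
    waveKernel (wavePhase ε σ (P.1.1 - P.2.1)) (P.1.2 - P.2.2))

theorem integrable_waveForm {d : ℕ} (hd : 1 ≤ d) {ε σ : ℝ} (hε : 0 < ε) {w : ℝ × ℝ → ℂ}
    (hw : Measurable w) (hw1 : ∀ p, ‖w p‖ ≤ 1) {G H : ℝ × Euc d → ℂ} (hG : IsTest G)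
    (hH : IsTest H) : Integrable (waveForm ε σ w G H) := by
  obtain ⟨M, hM⟩ := hG.bdd
  obtain ⟨R, hR⟩ := hG.supp
  obtain ⟨M', hM'⟩ := hH.bdd
  obtain ⟨R', hR'⟩ := hH.supp
  have hmG := hG.measurable
  have hmH := hH.measurable
  have hM0 : 0 ≤ M := (norm_nonneg _).trans (hM 0)
  have hM0' : 0 ≤ M' := (norm_nonneg _).trans (hM' 0)
  have hc : Continuous fun P : (ℝ × Euc d) × (ℝ × Euc d) =>
      waveKernel (wavePhase ε σ (P.1.1 - P.2.1)) (P.1.2 - P.2.2) :=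
    continuous_waveKernel (by fun_prop) (by fun_prop) fun p => by rwa [wavePhase_re]
  refine integrable_of_bdd_of_supp (R := max R R') (M := 1 * (M * M' *
    (‖waveConst d‖ * (ε ^ 2) ^ (-(((d : ℝ) - 1) / 2))))) ?_ (fun P => ?_) (fun P hP => ?_)
  · refine Measurable.aestronglyMeasurable ?_
    unfold waveForm
    exact (hw.comp (by fun_prop)).mul (((hmG.comp measurable_fst).mul
      (hmH.comp measurable_snd)).mul hc.measurable)
  · unfold waveForm
    rw [norm_mul, norm_mul, norm_mul]
    have h := norm_waveKernel_le hd (a := wavePhase ε σ (P.1.1 - P.2.1))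
      (by rwa [wavePhase_re]) (P.1.2 - P.2.2)
    rw [wavePhase_re] at h
    gcongr
    · exact hw1 _
    · exact hM _
    · exact hM' _
  · unfold waveForm
    rw [Prod.norm_def] at hP
    rcases lt_max_iff.1 hP with h | h
    · rw [hR _ ((le_max_left _ _).trans_lt h)]; ring
    · rw [hR' _ ((le_max_right _ _).trans_lt h)]; ring

theorem integral_waveForm {d : ℕ} (hd : 1 ≤ d) {ε σ : ℝ} (hε : 0 < ε) {w : ℝ × ℝ → ℂ}
    (hw : Measurable w) (hw1 : ∀ p, ‖w p‖ ≤ 1) {G H : ℝ × Euc d → ℂ} (hG : IsTest G)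
    (hH : IsTest H) : ∫ P, waveForm ε σ w G H P =
      ∫ p : ℝ × ℝ, w p * ∫ z : Euc d × Euc d, G (p.1, z.1) * H (p.2, z.2) *
        waveKernel (wavePhase ε σ (p.1 - p.2)) (z.1 - z.2) := by
  obtain ⟨e, he, he'⟩ := exists_measurePreserving_prodComm ℝ (Euc d)
  set f : (ℝ × ℝ) × (Euc d × Euc d) → ℂ := fun q => w q.1 * (G (q.1.1, q.2.1) * H (q.1.2, q.2.2) *
        waveKernel (wavePhase ε σ (q.1.1 - q.1.2)) (q.2.1 - q.2.2)) with hf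
  have h1 : waveForm ε σ w G H = fun P => f (e P) := by
    funext P
    simp only [hf, he', waveForm]
  have h2 : Integrable f := by
    have := integrable_waveForm hd hε (σ := σ) hw hw1 hG hH
    rw [h1] at this
    exact (he.integrable_comp_emb e.measurableEmbedding).1 this
  rw [h1, he.integral_comp e.measurableEmbedding, Measure.volume_eq_prod, integral_prod f h2]
  refine integral_congr_ae (Filter.Eventually.of_forall fun p => ?_)
  simp only [hf]
  rw [integral_const_mul]

end WaveStrichartz

namespace WaveStrichartz

theorem lintegral_ofReal_slice_rpow {d : ℕ} {r : ℝ} (hr : 0 < r) {G : ℝ × Euc d → ℂ}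
    (hG : IsTest G) :
    ∫⁻ t, ENNReal.ofReal (((∫ x, ‖G (t, x)‖ ^ r) ^ (1 / r)) ^ r) =
      ENNReal.ofReal (∫ p, ‖G p‖ ^ r) := by
  have hi : Integrable (fun p => ‖G p‖ ^ r) := hG.integrable_norm_rpow hr
  have h0 : ∀ t, 0 ≤ ∫ x, ‖G (t, x)‖ ^ r := fun t => integral_nonneg fun x => by positivity
  simp only [fun t => show ((∫ x, ‖G (t, x)‖ ^ r) ^ (1 / r)) ^ r = ∫ x, ‖G (t, x)‖ ^ r by
    rw [← Real.rpow_mul (h0 t), one_div_mul_cancel hr.ne', Real.rpow_one]]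
  rw [Measure.volume_eq_prod] at hi ⊢
  rw [integral_prod _ hi, ofReal_integral_eq_lintegral_ofReal hi.integral_prod_left
    (Filter.Eventually.of_forall h0)]

theorem lintegral_prod_rieszKernel (θ : ℝ) {g h : ℝ → ℝ} (hg : Measurable g) (hh : Measurable h)
    (c : ℝ≥0∞) :
    ∫⁻ p : ℝ × ℝ, c * ((rieszKernel θ (p.1 - p.2) * ENNReal.ofReal (g p.1)) *
      ENNReal.ofReal (h p.2)) ∂(volume.prod volume) =
    c * ∫⁻ s, (∫⁻ t, rieszKernel θ (t - s) * ENNReal.ofReal (g t)) * ENNReal.ofReal (h s) := by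
  have hm1 : Measurable fun p : ℝ × ℝ => rieszKernel θ (p.1 - p.2) * ENNReal.ofReal (g p.1) :=
    ((measurable_rieszKernel θ).comp (by fun_prop)).mul (by fun_prop)
  have hm2 : Measurable fun p : ℝ × ℝ => (rieszKernel θ (p.1 - p.2) *
      ENNReal.ofReal (g p.1)) * ENNReal.ofReal (h p.2) := hm1.mul (by fun_prop)
  refine (lintegral_const_mul c hm2).trans ?_
  refine congrArg (c * ·) ((lintegral_prod_symm _ hm2.aemeasurable).trans ?_)
  refine lintegral_congr fun s => ?_
  have hm3 : Measurable fun t => rieszKernel θ (t - s) * ENNReal.ofReal (g t) :=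
    ((measurable_rieszKernel θ).comp (by fun_prop)).mul (by fun_prop)
  exact lintegral_mul_const (ENNReal.ofReal (h s)) hm3

theorem exists_norm_integral_waveForm_le {d : ℕ} (hd : 2 ≤ d) :
    ∃ C, 0 ≤ C ∧ ∀ (ε σ : ℝ) (_ : 0 < ε) (_ : |σ| = 1) (w : ℝ × ℝ → ℂ) (_ : Measurable w)
      (_ : ∀ p, ‖w p‖ ≤ 1) (G H : ℝ × Euc d → ℂ) (_ : IsTest G) (_ : IsTest H),
      ‖∫ P, waveForm ε σ w G H P‖ ≤
        C * ((∫ p, ‖G p‖ ^ dualExp d) * ∫ p, ‖H p‖ ^ dualExp d) ^ (1 / dualExp d) := by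
  obtain ⟨C, hC, hmain⟩ := exists_norm_integral_waveKernel_le hd
  set θ := decayExp d with hθ
  set r := dualExp d with hr
  have hθ0 : 0 < θ := decayExp_pos hd
  have hθ1 : θ < 1 := decayExp_lt_one d
  have hr0 : 0 < r := dualExp_pos d
  have hr1 : 1 / r = (2 - θ) / 2 := by rw [hr, one_div_dualExp, ← hθ]; ring
  have hr2 : 2 / (2 - θ) = r := by
    rw [← one_div_one_div r, hr1, one_div_div]
  refine ⟨C * (4 * (2 / (1 - θ) + 1)), ?_, ?_⟩
  · have : 0 < 1 - θ := by linarith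
    positivity
  intro ε σ hε hσ w hw hw1 G H hG hH
  rw [integral_waveForm (by omega) hε hw hw1 hG hH]
  set g : ℝ → ℝ := fun t => (∫ x, ‖G (t, x)‖ ^ r) ^ (1 / r) with hg
  set h : ℝ → ℝ := fun t => (∫ x, ‖H (t, x)‖ ^ r) ^ (1 / r) with hh
  have hG0 : ∀ t, 0 ≤ ∫ x, ‖G (t, x)‖ ^ r := fun t => integral_nonneg fun x => by positivity
  have hH0 : ∀ t, 0 ≤ ∫ x, ‖H (t, x)‖ ^ r := fun t => integral_nonneg fun x => by positivity
  have hg0 : ∀ t, 0 ≤ g t := fun t => Real.rpow_nonneg (hG0 t) _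
  have hh0 : ∀ t, 0 ≤ h t := fun t => Real.rpow_nonneg (hH0 t) _
  have hgm : Measurable g :=
    ((hG.measurable.norm.pow_const r).stronglyMeasurable.integral_prod_right'
      ).measurable.pow_const _
  have hhm : Measurable h :=
    ((hH.measurable.norm.pow_const r).stronglyMeasurable.integral_prod_right'
      ).measurable.pow_const _
  have key : ∀ t s, t ≠ s → ‖w (t, s) * ∫ z : Euc d × Euc d, G (t, z.1) * H (s, z.2) *
      waveKernel (wavePhase ε σ (t - s)) (z.1 - z.2)‖ ≤ C * (|t - s| ^ (-θ) * (g t * h s)) := by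
    intro t s hts
    have hpos : 0 < |t - s| := abs_pos.2 (sub_ne_zero.2 hts)
    have h1 := hmain (wavePhase ε σ (t - s)) (by rwa [wavePhase_re]) _ _ (hG.slice t) (hH.slice s)
    rw [norm_mul]
    refine (mul_le_mul (hw1 _) h1 (norm_nonneg _) zero_le_one).trans ?_
    rw [one_mul, Real.mul_rpow (hG0 t) (hH0 s), mul_assoc]
    have h2 : ‖wavePhase ε σ (t - s)‖ ^ (-θ) ≤ |t - s| ^ (-θ) :=
      Real.rpow_le_rpow_of_nonpos hpos (abs_le_norm_wavePhase ε hσ _) (by linarith)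
    exact mul_le_mul_of_nonneg_left (mul_le_mul_of_nonneg_right h2
      (mul_nonneg (hg0 t) (hh0 s))) hC
  have hle : ENNReal.ofReal ‖∫ p : ℝ × ℝ, w p * ∫ z : Euc d × Euc d, G (p.1, z.1) * H (p.2, z.2) *
        waveKernel (wavePhase ε σ (p.1 - p.2)) (z.1 - z.2)‖ ≤
      ENNReal.ofReal C * ∫⁻ s, (∫⁻ t, rieszKernel θ (t - s) * ENNReal.ofReal (g t)) *
        ENNReal.ofReal (h s) := by
    rw [ofReal_norm]
    refine (enorm_integral_le_lintegral_enorm _).trans ?_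
    rw [Measure.volume_eq_prod]
    calc _ ≤ ∫⁻ p : ℝ × ℝ, ENNReal.ofReal C * ((rieszKernel θ (p.1 - p.2) *
          ENNReal.ofReal (g p.1)) * ENNReal.ofReal (h p.2)) ∂(volume.prod volume) := by
          refine lintegral_mono_ae ?_
          have hne : ∀ᵐ p : ℝ × ℝ ∂(volume.prod volume), p.1 ≠ p.2 := by
            have hms : MeasurableSet {p : ℝ × ℝ | p.1 ≠ p.2} :=
              (measurableSet_eq_fun measurable_fst measurable_snd).compl
            refine (Measure.ae_prod_iff_ae_ae hms).2 ?_
            filter_upwards with t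
            have : ∀ᵐ s : ℝ, s ≠ t := Measure.ae_ne volume t
            filter_upwards [this] with s hs using hs.symm
          filter_upwards [hne] with p hp
          rw [← ofReal_norm]
          refine (ENNReal.ofReal_le_ofReal (key p.1 p.2 hp)).trans (le_of_eq ?_)
          rw [ENNReal.ofReal_mul hC, ENNReal.ofReal_mul (by positivity), ENNReal.ofReal_mul (hg0 _),
            rieszKernel]
          ring
      _ = _ := lintegral_prod_rieszKernel θ hgm hhm _
  have hls := lintegral_rieszKernel_le hθ0 hθ1 hhm hh0 hgm hg0
  rw [hr2, ← hr1, lintegral_ofReal_slice_rpow hr0 hH, lintegral_ofReal_slice_rpow hr0 hG,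
    ← ENNReal.ofReal_mul (integral_nonneg fun x => by positivity),
    ENNReal.ofReal_rpow_of_nonneg (by positivity) (by positivity),
    ← ENNReal.ofReal_mul (by have : 0 < 1 - θ := by linarith
                             positivity)] at hls
  have hfin := hle.trans (mul_le_mul_right hls _)
  have hR : 0 ≤ 4 * (2 / (1 - θ) + 1) := by
    have : 0 < 1 - θ := by linarith
    positivity
  rw [← ENNReal.ofReal_mul hC] at hfin
  rw [ENNReal.ofReal_le_ofReal_iff (by positivity)] at hfin
  refine hfin.trans (le_of_eq ?_)
  rw [mul_comm (∫ p, ‖H p‖ ^ r)]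
  ring

end WaveStrichartz

namespace WaveStrichartz

theorem eLpNorm_restrict_le_of_duality {E : Type*} [NormedAddCommGroup E] [MeasurableSpace E]
    [ProperSpace E] {μ : Measure E} [IsFiniteMeasureOnCompacts μ] {p r A M R : ℝ} (hp : 2 < p)
    (hpr : (p - 1) * r = p) {W : E → ℂ} (hW : Measurable W) {Q : Set E} (hQ : MeasurableSet Q)
    (hM : ∀ x ∈ Q, ‖W x‖ ≤ M) (hR : ∀ x ∈ Q, ‖x‖ ≤ R) (hA : 0 ≤ A)
    (h : ∀ G : E → ℂ, IsTest G → (∀ x, x ∉ Q → G x = 0) →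
      ‖∫ x, G x * W x ∂μ‖ ≤ A * (∫ x, ‖G x‖ ^ r ∂μ) ^ (1 / r)) :
    eLpNorm W (ENNReal.ofReal p) (μ.restrict Q) ≤ ENNReal.ofReal A := by
  have hr0 : 0 < r := by
    by_contra hr
    nlinarith [mul_nonpos_of_nonneg_of_nonpos (by linarith : 0 ≤ p - 1) (not_lt.1 hr)]
  set G : E → ℂ := Q.indicator fun x => (starRingEnd ℂ) (W x) * ((‖W x‖ ^ (p - 2) : ℝ) : ℂ) with hG
  have hnorm : ∀ x ∈ Q, ‖G x‖ = ‖W x‖ ^ (p - 1) := by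
    intro x hx
    rw [hG, indicator_of_mem hx, norm_mul, RCLike.norm_conj, Complex.norm_real,
      Real.norm_of_nonneg (by positivity), show p - 1 = 1 + (p - 2) by ring,
      Real.rpow_add_of_nonneg (norm_nonneg _) zero_le_one (by linarith), Real.rpow_one]
  have hoff : ∀ x, x ∉ Q → G x = 0 := fun x hx => by rw [hG, indicator_of_notMem hx]
  have hT : IsTest G := by
    refine ⟨?_, ⟨max (M ^ (p - 1)) 0, fun x => ?_⟩, ⟨R, fun x hx => ?_⟩⟩
    · refine Measurable.indicator ?_ hQ
      exact (Complex.continuous_conj.measurable.comp hW).mul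
        (Complex.measurable_ofReal.comp (hW.norm.pow_const _))
    · by_cases hx : x ∈ Q
      · rw [hnorm x hx]
        exact le_max_of_le_left (Real.rpow_le_rpow (norm_nonneg _) (hM x hx) (by linarith))
      · rw [hoff x hx, norm_zero]
        exact le_max_right _ _
    · exact hoff x fun hxQ => absurd (hR x hxQ) (not_le.2 hx)
  have e1 : ∀ x, ‖G x‖ ^ r = Q.indicator (fun x => ‖W x‖ ^ p) x := by
    intro x
    by_cases hx : x ∈ Q
    · rw [indicator_of_mem hx, hnorm x hx, ← Real.rpow_mul (norm_nonneg _), hpr]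
    · rw [indicator_of_notMem hx, hoff x hx, norm_zero, Real.zero_rpow hr0.ne']
  have e2 : ∀ x, G x * W x = ((Q.indicator (fun x => ‖W x‖ ^ p) x : ℝ) : ℂ) := by
    intro x
    by_cases hx : x ∈ Q
    · rw [indicator_of_mem hx, hG, indicator_of_mem hx]
      have h1 : (starRingEnd ℂ) (W x) * W x = ((‖W x‖ ^ 2 : ℝ) : ℂ) := by
        rw [mul_comm, Complex.mul_conj, Complex.normSq_eq_norm_sq]
      have h2 : ‖W x‖ ^ p = ‖W x‖ ^ 2 * ‖W x‖ ^ (p - 2) := by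
        rw [← Real.rpow_natCast, ← Real.rpow_add_of_nonneg (norm_nonneg _) (by norm_num)
          (by linarith)]
        congr 1
        push_cast
        ring
      rw [h2, Complex.ofReal_mul, ← h1]
      ring
    · rw [indicator_of_notMem hx, hoff x hx, zero_mul, Complex.ofReal_zero]
  have h_integrable := hT.integrable_norm_rpow (μ := μ) hr0
  simp only [e1] at h_integrable
  have hkey := h G hT hoff
  simp only [e1, e2, integral_complex_ofReal, Complex.norm_real] at hkey
  set X : ℝ := ∫ x, Q.indicator (fun x => ‖W x‖ ^ p) x ∂μ with hX
  have hX0 : 0 ≤ X := integral_nonneg fun x => indicator_nonneg (fun y _ => by positivity) x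
  rw [Real.norm_of_nonneg hX0] at hkey
  have hXA : X ^ (1 / p) ≤ A := by
    rcases hX0.eq_or_lt with h0 | h0
    · rw [← h0, Real.zero_rpow (by positivity)]
      exact hA
    · have h3 : (1 : ℝ) / p = 1 - 1 / r := by
        have : p ≠ 0 := by linarith
        field_simp
        linarith
      rw [h3, Real.rpow_sub h0, Real.rpow_one, div_le_iff₀ (by positivity)]
      exact hkey
  have hX' : ∫⁻ x in Q, ENNReal.ofReal (‖W x‖ ^ p) ∂μ = ENNReal.ofReal X := by
    rw [hX, ofReal_integral_eq_lintegral_ofReal h_integrable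
      (Filter.Eventually.of_forall fun x => indicator_nonneg (fun y _ => by positivity) x),
      ← lintegral_indicator hQ]
    refine lintegral_congr fun x => ?_
    by_cases hx : x ∈ Q
    · simp [hx]
    · simp [hx]
  have hp0 : 0 < p := by linarith
  rw [eLpNorm_eq_lintegral_rpow_enorm_toReal (by simpa using hp0) ENNReal.ofReal_ne_top,
    ENNReal.toReal_ofReal hp0.le]
  have h5 : ∀ x, ‖W x‖ₑ ^ p = ENNReal.ofReal (‖W x‖ ^ p) := fun x => by
    rw [← ofReal_norm, ENNReal.ofReal_rpow_of_nonneg (norm_nonneg _) hp0.le]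
  simp only [h5]
  rw [hX', ENNReal.ofReal_rpow_of_nonneg hX0 (by positivity)]
  exact ENNReal.ofReal_le_ofReal hXA

end WaveStrichartz

namespace WaveStrichartz

/-- The plane wave `exp (2πi(σt‖ξ‖ + ⟪x, ξ⟫))` on the light cone. -/
def planeWave {d : ℕ} (σ : ℝ) (p : ℝ × Euc d) (ξ : Euc d) : ℂ :=
  Complex.exp (((2 * π * (σ * p.1 * ‖ξ‖ + ⟪p.2, ξ⟫) : ℝ) : ℂ) * Complex.I)

theorem norm_planeWave {d : ℕ} (σ : ℝ) (p : ℝ × Euc d) (ξ : Euc d) : ‖planeWave σ p ξ‖ = 1 :=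
  Complex.norm_exp_ofReal_mul_I _

@[fun_prop]
theorem continuous_planeWave {d : ℕ} {X : Type*} [TopologicalSpace X] (σ : ℝ) {p : X → ℝ × Euc d}
    {ξ : X → Euc d} (hp : Continuous p) (hξ : Continuous ξ) :
    Continuous fun x => planeWave σ (p x) (ξ x) := by
  unfold planeWave
  fun_prop

theorem planeWave_mul_conj {d : ℕ} (σ : ℝ) (p q : ℝ × Euc d) (ξ : Euc d) :
    planeWave σ p ξ * (starRingEnd ℂ) (planeWave σ q ξ) = planeWave σ (p - q) ξ := by
  unfold planeWave
  rw [← Complex.exp_conj, ← Complex.exp_add, map_mul, Complex.conj_ofReal, Complex.conj_I]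
  congr 1
  rw [Prod.snd_sub, Prod.fst_sub, inner_sub_left]
  push_cast
  ring

/-- The adjoint of the extension operator to the light cone. -/
def coneRestrict {d : ℕ} (σ : ℝ) (G : ℝ × Euc d → ℂ) (ξ : Euc d) : ℂ :=
  ∫ p, G p * planeWave σ p ξ

theorem norm_coneRestrict_le {d : ℕ} (σ : ℝ) (G : ℝ × Euc d → ℂ) (ξ : Euc d) :
    ‖coneRestrict σ G ξ‖ ≤ ∫ p, ‖G p‖ := by
  refine (norm_integral_le_integral_norm _).trans (le_of_eq ?_)
  simp only [norm_mul, norm_planeWave, mul_one]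

theorem stronglyMeasurable_coneRestrict {d : ℕ} (σ : ℝ) {G : ℝ × Euc d → ℂ} (hG : Measurable G) :
    StronglyMeasurable (coneRestrict σ G) := by
  have : StronglyMeasurable (Function.uncurry fun (ξ : Euc d) (p : ℝ × Euc d) =>
      G p * planeWave σ p ξ) := by
    refine Measurable.stronglyMeasurable ?_
    have h : Continuous fun q : Euc d × (ℝ × Euc d) => planeWave σ q.2 q.1 := by fun_prop
    exact (hG.comp measurable_snd).mul h.measurable
  exact this.integral_prod_right

theorem integral_integral_planeWave_swap {d : ℕ} (σ : ℝ) {G : ℝ × Euc d → ℂ} (hG : Integrable G)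
    {m : Euc d → ℂ} (hm : Integrable m) :
    ∫ p, G p * ∫ ξ, m ξ * planeWave σ p ξ = ∫ ξ, m ξ * coneRestrict σ G ξ := by
  set H : ℝ × Euc d → Euc d → ℂ := fun p ξ => G p * (m ξ * planeWave σ p ξ) with hH
  have h_integrable : Integrable (Function.uncurry H) ((volume : Measure (ℝ × Euc d)).prod volume) := by
    have h1 := hG.mul_prod hm
    refine (h1.norm).mono' ?_ (Filter.Eventually.of_forall fun p => ?_)
    · have h2 : AEStronglyMeasurable (fun p : (ℝ × Euc d) × Euc d => planeWave σ p.1 p.2)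
          ((volume : Measure (ℝ × Euc d)).prod volume) := by
        apply Continuous.aestronglyMeasurable; fun_prop
      refine (h1.aestronglyMeasurable.mul h2).congr (Filter.Eventually.of_forall fun p => ?_)
      simp only [hH, Pi.mul_apply, Function.uncurry_def]
      ring
    · simp only [hH, Function.uncurry_def, norm_mul, norm_planeWave, mul_one, le_refl]
  calc _ = ∫ p, ∫ ξ, H p ξ := by simp only [hH, integral_const_mul]
    _ = ∫ ξ, ∫ p, H p ξ := integral_integral_swap h_integrable
    _ = _ := by
        simp only [coneRestrict, ← integral_const_mul, hH]
        refine integral_congr_ae (Filter.Eventually.of_forall fun ξ => ?_)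
        refine integral_congr_ae (Filter.Eventually.of_forall fun p => ?_)
        ring

theorem integrable_exp_div_norm {d : ℕ} (hd : 2 ≤ d) {c : ℝ} (hc : 0 < c) :
    Integrable fun ξ : Euc d => rexp (-c * ‖ξ‖) / ‖ξ‖ := by
  have hd' : (2 : ℝ) ≤ d := by exact_mod_cast hd
  have := integrable_norm_rpow_mul_exp (d := d) (by omega) (k := -1) (by linarith) hc
  refine this.congr (Filter.Eventually.of_forall fun ξ => ?_)
  simp only [Real.rpow_neg_one]
  ring

theorem IsTest.conj {E : Type*} [NormedAddCommGroup E] [MeasurableSpace E] {f : E → ℂ}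
    (hf : IsTest f) : IsTest fun x => (starRingEnd ℂ) (f x) := by
  obtain ⟨M, hM⟩ := hf.bdd
  obtain ⟨R, hR⟩ := hf.supp
  refine ⟨Complex.continuous_conj.measurable.comp hf.measurable, ⟨M, fun x => ?_⟩,
    ⟨R, fun x hx => ?_⟩⟩
  · rw [RCLike.norm_conj]; exact hM x
  · rw [hR x hx, map_zero]

theorem integral_exp_div_norm_mul_planeWave {d : ℕ} (hd : 2 ≤ d) {ε : ℝ} (hε : 0 < ε) (σ : ℝ)
    (p : ℝ × Euc d) :
    ∫ ξ, ((rexp (-(2 * π * ε) * ‖ξ‖) / ‖ξ‖ : ℝ) : ℂ) * planeWave σ p ξ =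
      waveKernel (wavePhase ε σ p.1) p.2 := by
  rw [← integral_exp_div_norm hd (a := wavePhase ε σ p.1) (by rwa [wavePhase_re]) p.2]
  refine integral_congr_ae (Filter.Eventually.of_forall fun ξ => ?_)
  simp only [planeWave, wavePhase]
  push_cast
  rw [div_mul_eq_mul_div, div_mul_eq_mul_div, ← Complex.exp_add, ← Complex.exp_add]
  congr 2
  ring

theorem integral_exp_mul_norm_coneRestrict_sq {d : ℕ} (hd : 2 ≤ d) {ε : ℝ} (hε : 0 < ε) (σ : ℝ)
    {G : ℝ × Euc d → ℂ} (hG : IsTest G) :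
    ((∫ ξ, rexp (-(2 * π * ε) * ‖ξ‖) / ‖ξ‖ * ‖coneRestrict σ G ξ‖ ^ 2 : ℝ) : ℂ) =
      ∫ P, waveForm ε σ (fun _ => 1) G (fun p => (starRingEnd ℂ) (G p)) P := by
  set m : Euc d → ℂ := fun ξ => ((rexp (-(2 * π * ε) * ‖ξ‖) / ‖ξ‖ : ℝ) : ℂ) with hm
  have hmi : Integrable m := (integrable_exp_div_norm hd (by positivity)).ofReal
  set G' : ℝ × Euc d → ℂ := fun p => (starRingEnd ℂ) (G p) with hG'
  set Gm : (ℝ × Euc d) × (ℝ × Euc d) → ℂ := fun P => G P.1 * G' P.2 with hGm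
  have hGG : Integrable Gm := hG.integrable.mul_prod hG.conj.integrable
  set H : (ℝ × Euc d) × (ℝ × Euc d) → Euc d → ℂ :=
    fun P ξ => Gm P * (m ξ * planeWave σ (P.1 - P.2) ξ) with hH
  have h_integrable : Integrable (Function.uncurry H)
      ((volume : Measure ((ℝ × Euc d) × (ℝ × Euc d))).prod volume) := by
    have h1 := hGG.mul_prod hmi
    refine (h1.norm).mono' ?_ (Filter.Eventually.of_forall fun p => ?_)
    · have h2 : AEStronglyMeasurable (fun p : ((ℝ × Euc d) × (ℝ × Euc d)) × Euc d =>
          planeWave σ (p.1.1 - p.1.2) p.2)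
          ((volume : Measure ((ℝ × Euc d) × (ℝ × Euc d))).prod volume) := by
        apply Continuous.aestronglyMeasurable; fun_prop
      refine (h1.aestronglyMeasurable.mul h2).congr (Filter.Eventually.of_forall fun p => ?_)
      simp only [hH, Pi.mul_apply, Function.uncurry_def]
      ring
    · simp only [hH, Function.uncurry_def, norm_mul, norm_planeWave, mul_one, le_refl]
  symm
  calc _ = ∫ P, ∫ ξ, H P ξ := by
        refine integral_congr_ae (Filter.Eventually.of_forall fun P => ?_)
        simp only [hH, integral_const_mul, hm]
        rw [integral_exp_div_norm_mul_planeWave hd hε]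
        simp only [waveForm, one_mul, hGm, Prod.fst_sub, Prod.snd_sub]
    _ = ∫ ξ, ∫ P, H P ξ := integral_integral_swap h_integrable
    _ = _ := by
        rw [← integral_complex_ofReal]
        refine integral_congr_ae (Filter.Eventually.of_forall fun ξ => ?_)
        have h3 : ((‖coneRestrict σ G ξ‖ ^ 2 : ℝ) : ℂ) =
            coneRestrict σ G ξ * (starRingEnd ℂ) (coneRestrict σ G ξ) := by
          rw [Complex.mul_conj, Complex.normSq_eq_norm_sq]
        simp only
        rw [Complex.ofReal_mul, h3]
        conv_rhs => rw [coneRestrict, ← integral_conj, ← integral_prod_mul, ← integral_const_mul]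
        refine integral_congr_ae (Filter.Eventually.of_forall fun P => ?_)
        simp only [hH, hGm, hm, hG', map_mul, ← planeWave_mul_conj]
        ring

end WaveStrichartz

namespace WaveStrichartz

theorem integrable_exp_mul_of_integrable_norm_mul_sq {d : ℕ} (hd : 2 ≤ d) {ε : ℝ} (hε : 0 < ε)
    {m : Euc d → ℂ} (hm : AEStronglyMeasurable m) (hm2 : Integrable fun ξ => ‖ξ‖ * ‖m ξ‖ ^ 2) :
    Integrable fun ξ => ((rexp (-(2 * π * ε) * ‖ξ‖) : ℝ) : ℂ) * m ξ := by
  have h1 := integrable_exp_div_norm hd (c := 2 * π * (2 * ε)) (by positivity)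
  refine (h1.add hm2).mono' ?_ ?_
  · refine AEStronglyMeasurable.mul ?_ hm
    apply Continuous.aestronglyMeasurable
    fun_prop
  · filter_upwards [ae_norm_pos (d := d) (by omega)] with ξ hξ
    rw [norm_mul, Complex.norm_real, Real.norm_of_nonneg (by positivity), Pi.add_apply,
      show -(2 * π * (2 * ε)) * ‖ξ‖ = -(2 * π * ε) * ‖ξ‖ + -(2 * π * ε) * ‖ξ‖ by ring, Real.exp_add]
    set e := rexp (-(2 * π * ε) * ‖ξ‖)
    have h2 : 0 ≤ (e - ‖ξ‖ * ‖m ξ‖) ^ 2 / ‖ξ‖ := by positivity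
    have h3 : (e - ‖ξ‖ * ‖m ξ‖) ^ 2 / ‖ξ‖ = e * e / ‖ξ‖ + ‖ξ‖ * ‖m ξ‖ ^ 2 - 2 * (e * ‖m ξ‖) := by
      field_simp
      ring
    have h4 : 0 ≤ e * ‖m ξ‖ := by positivity
    linarith

theorem exists_norm_integral_planeWave_le {d : ℕ} (hd : 2 ≤ d) :
    ∃ C, 0 ≤ C ∧ ∀ (ε σ : ℝ) (_ : 0 < ε) (_ : |σ| = 1) (m : Euc d → ℂ)
      (_ : AEStronglyMeasurable m) (_ : Integrable fun ξ => ‖ξ‖ * ‖m ξ‖ ^ 2)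
      (G : ℝ × Euc d → ℂ) (_ : IsTest G),
      ‖∫ p, G p * ∫ ξ, (((rexp (-(2 * π * ε) * ‖ξ‖) : ℝ) : ℂ) * m ξ) * planeWave σ p ξ‖ ≤
        C * (∫ ξ, ‖ξ‖ * ‖m ξ‖ ^ 2) ^ (1 / 2 : ℝ) * (∫ p, ‖G p‖ ^ dualExp d) ^ (1 / dualExp d) := by
  obtain ⟨C, hC, hmain⟩ := exists_norm_integral_waveForm_le hd
  refine ⟨C ^ (1 / 2 : ℝ), by positivity, ?_⟩
  intro ε σ hε hσ m hm hm2 G hG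
  rw [integral_integral_planeWave_swap σ hG.integrable
    (integrable_exp_mul_of_integrable_norm_mul_sq hd hε hm hm2)]
  set K := coneRestrict σ G with hK
  have hKm : StronglyMeasurable K := stronglyMeasurable_coneRestrict σ hG.measurable
  set f : Euc d → ℝ := fun ξ => √‖ξ‖ * ‖m ξ‖ with hf
  set g : Euc d → ℝ := fun ξ => rexp (-(2 * π * ε) * ‖ξ‖) / √‖ξ‖ * ‖K ξ‖ with hg
  have hf2 : ∀ ξ, f ξ ^ 2 = ‖ξ‖ * ‖m ξ‖ ^ 2 := fun ξ => by
    simp only [hf, mul_pow, Real.sq_sqrt (norm_nonneg ξ)]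
  have hg2 : ∀ ξ, g ξ ^ 2 = rexp (-(2 * π * (2 * ε)) * ‖ξ‖) / ‖ξ‖ * ‖K ξ‖ ^ 2 := fun ξ => by
    simp only [hg, mul_pow, div_pow, Real.sq_sqrt (norm_nonneg ξ)]
    rw [← Real.exp_nat_mul, show ((2 : ℕ) : ℝ) * (-(2 * π * ε) * ‖ξ‖) =
      -(2 * π * (2 * ε)) * ‖ξ‖ by push_cast; ring]
  have hfm : AEStronglyMeasurable f :=
    (by fun_prop : Continuous fun ξ : Euc d => √‖ξ‖).aestronglyMeasurable.mul hm.norm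
  have hgm : AEStronglyMeasurable g := by
    refine AEStronglyMeasurable.mul ?_ hKm.aestronglyMeasurable.norm
    refine Measurable.aestronglyMeasurable ?_
    fun_prop
  have hg2i : Integrable fun ξ => g ξ ^ 2 := by
    simp only [hg2]
    refine (integrable_exp_div_norm hd (c := 2 * π * (2 * ε)) (by positivity)).mul_bdd
      (c := (∫ p, ‖G p‖) ^ 2) (hKm.aestronglyMeasurable.norm.pow 2)
      (Filter.Eventually.of_forall fun ξ => ?_)
    rw [norm_pow, norm_norm]
    have := norm_coneRestrict_le σ G ξ
    gcongr
  have hfL : MemLp f (ENNReal.ofReal 2) := by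
    rw [show ENNReal.ofReal 2 = 2 by simp]
    refine (memLp_two_iff_integrable_sq hfm).2 ?_
    simpa only [hf2] using hm2
  have hgL : MemLp g (ENNReal.ofReal 2) := by
    rw [show ENNReal.ofReal 2 = 2 by simp]
    exact (memLp_two_iff_integrable_sq hgm).2 hg2i
  have hcs := integral_mul_le_Lp_mul_Lq_of_nonneg Real.HolderConjugate.two_two
    (Filter.Eventually.of_forall fun ξ => (by positivity : 0 ≤ f ξ))
    (Filter.Eventually.of_forall fun ξ => (by positivity : 0 ≤ g ξ)) hfL hgL
  simp only [Real.rpow_two, hf2, hg2] at hcs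
  have hform : ∫ ξ, rexp (-(2 * π * (2 * ε)) * ‖ξ‖) / ‖ξ‖ * ‖K ξ‖ ^ 2 ≤
      C * ((∫ p, ‖G p‖ ^ dualExp d) ^ (1 / dualExp d)) ^ 2 := by
    have h1 := hmain (2 * ε) σ (by positivity) hσ (fun _ => 1) measurable_const (fun _ => by simp)
      G _ hG hG.conj
    rw [← integral_exp_mul_norm_coneRestrict_sq hd (by positivity) σ hG, Complex.norm_real] at h1
    simp only [RCLike.norm_conj] at h1
    rw [Real.mul_rpow (by positivity) (by positivity), ← sq] at h1
    exact (le_abs_self _).trans h1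
  have hN : 0 ≤ (∫ p, ‖G p‖ ^ dualExp d) ^ (1 / dualExp d) := by positivity
  calc _ ≤ ∫ ξ, ‖(((rexp (-(2 * π * ε) * ‖ξ‖) : ℝ) : ℂ) * m ξ) * K ξ‖ :=
        norm_integral_le_integral_norm _
    _ = ∫ ξ, f ξ * g ξ := by
        refine integral_congr_ae ?_
        filter_upwards [ae_norm_pos (d := d) (by omega)] with ξ hξ
        have h0 : 0 < √‖ξ‖ := Real.sqrt_pos.2 hξ
        rw [norm_mul, norm_mul, Complex.norm_real, Real.norm_of_nonneg (by positivity)]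
        simp only [hf, hg]
        field_simp
    _ ≤ _ := hcs
    _ ≤ (∫ ξ, ‖ξ‖ * ‖m ξ‖ ^ 2) ^ (1 / 2 : ℝ) *
        (C * ((∫ p, ‖G p‖ ^ dualExp d) ^ (1 / dualExp d)) ^ 2) ^ (1 / 2 : ℝ) := by
        refine mul_le_mul_of_nonneg_left (Real.rpow_le_rpow ?_ hform (by norm_num)) (by positivity)
        exact integral_nonneg fun ξ => by positivity
    _ = _ := by
        rw [Real.mul_rpow hC (by positivity), ← Real.sqrt_eq_rpow (_ ^ 2), Real.sqrt_sq hN]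
        ring

end WaveStrichartz

namespace WaveStrichartz

/-- The signed indicator function of the time interval between `0` and `t`. -/
def timeWindow (t s : ℝ) : ℝ := (Ioc 0 t).indicator 1 s - (Ioc t 0).indicator 1 s

theorem abs_timeWindow_le (t s : ℝ) : |timeWindow t s| ≤ 1 := by
  unfold timeWindow
  by_cases h1 : s ∈ Ioc 0 t
  · have h2 : s ∉ Ioc t 0 := fun h => absurd h.2 (not_le.2 h1.1)
    simp [h1, h2]
  · by_cases h2 : s ∈ Ioc t 0 <;> simp [h1, h2]

theorem timeWindow_eq_zero {t s : ℝ} (h : |t| < |s|) : timeWindow t s = 0 := by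
  have h1 : s ∉ Ioc 0 t := fun hs => by
    rw [abs_of_pos hs.1] at h
    exact absurd hs.2 (not_le.2 ((le_abs_self t).trans_lt h))
  have h2 : s ∉ Ioc t 0 := fun hs => by
    rw [abs_of_nonpos hs.2] at h
    have := neg_abs_le t
    linarith [hs.1]
  simp [timeWindow, h1, h2]

theorem measurable_timeWindow : Measurable fun p : ℝ × ℝ => timeWindow p.1 p.2 := by
  have h1 : MeasurableSet {p : ℝ × ℝ | p.2 ∈ Ioc 0 p.1} :=
    (measurableSet_lt measurable_const measurable_snd).inter
      (measurableSet_le measurable_snd measurable_fst)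
  have h2 : MeasurableSet {p : ℝ × ℝ | p.2 ∈ Ioc p.1 0} :=
    (measurableSet_lt measurable_fst measurable_snd).inter
      (measurableSet_le measurable_snd measurable_const)
  exact ((measurable_const (a := (1 : ℝ))).indicator h1).sub
    ((measurable_const (a := (1 : ℝ))).indicator h2)

theorem integral_timeWindow_mul (t : ℝ) {f : ℝ → ℂ} (hf : Continuous f) :
    ∫ s, (timeWindow t s : ℂ) * f s = ∫ s in (0 : ℝ)..t, f s := by
  have h0 : ∀ a b : ℝ, Integrable ((Ioc a b).indicator f) := fun a b =>
    (integrable_indicator_iff measurableSet_Ioc).2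
      ((hf.intervalIntegrable _ _).1.congr_set_ae (by rfl))
  rw [intervalIntegral, ← integral_indicator measurableSet_Ioc,
    ← integral_indicator measurableSet_Ioc, ← integral_sub (h0 _ _) (h0 _ _)]
  refine integral_congr_ae (Filter.Eventually.of_forall fun s => ?_)
  by_cases h1 : s ∈ Ioc 0 t <;> by_cases h2 : s ∈ Ioc t 0 <;> simp [timeWindow, h1, h2]

/-- Duhamel's integral for the mollified half-wave kernels. -/
def halfDuhamel {d : ℕ} (ε σ : ℝ) (H : ℝ × Euc d → ℂ) (p : ℝ × Euc d) : ℂ :=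
  ∫ q, (timeWindow p.1 q.1 : ℂ) *
    (H q * waveKernel (wavePhase ε σ (p.1 - q.1)) (p.2 - q.2))

variable {d : ℕ} {ε σ : ℝ} {H : ℝ × Euc d → ℂ}

theorem measurable_duhamelIntegrand (hε : 0 < ε) (hH : Measurable H) :
    Measurable fun P : (ℝ × Euc d) × (ℝ × Euc d) => (timeWindow P.1.1 P.2.1 : ℂ) *
      (H P.2 * waveKernel (wavePhase ε σ (P.1.1 - P.2.1)) (P.1.2 - P.2.2)) := by
  have hc : Continuous fun P : (ℝ × Euc d) × (ℝ × Euc d) =>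
      waveKernel (wavePhase ε σ (P.1.1 - P.2.1)) (P.1.2 - P.2.2) :=
    continuous_waveKernel (by fun_prop) (by fun_prop) fun p => by rwa [wavePhase_re]
  have hw : Measurable fun P : (ℝ × Euc d) × (ℝ × Euc d) => timeWindow P.1.1 P.2.1 :=
    measurable_timeWindow.comp
      (by fun_prop : Measurable fun P : (ℝ × Euc d) × (ℝ × Euc d) => (P.1.1, P.2.1))
  exact (Complex.measurable_ofReal.comp hw).mul ((hH.comp measurable_snd).mul hc.measurable)

theorem norm_duhamelIntegrand_le (hd : 1 ≤ d) (hε : 0 < ε) (p q : ℝ × Euc d) :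
    ‖(timeWindow p.1 q.1 : ℂ) * (H q * waveKernel (wavePhase ε σ (p.1 - q.1)) (p.2 - q.2))‖ ≤
      ‖H q‖ * (‖waveConst d‖ * (ε ^ 2) ^ (-(((d : ℝ) - 1) / 2))) := by
  have h := norm_waveKernel_le hd (a := wavePhase ε σ (p.1 - q.1))
    (by rwa [wavePhase_re]) (p.2 - q.2)
  rw [wavePhase_re] at h
  rw [norm_mul, norm_mul, Complex.norm_real]
  refine (mul_le_of_le_one_left (by positivity) (abs_timeWindow_le _ _)).trans ?_
  gcongr

theorem integrable_duhamelIntegrand (hd : 1 ≤ d) (hε : 0 < ε) (hH : Measurable H)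
    (hHi : Integrable H) (p : ℝ × Euc d) :
    Integrable fun q => (timeWindow p.1 q.1 : ℂ) *
      (H q * waveKernel (wavePhase ε σ (p.1 - q.1)) (p.2 - q.2)) :=
  (hHi.norm.mul_const _).mono'
    ((measurable_duhamelIntegrand hε hH).comp measurable_prodMk_left).aestronglyMeasurable
    (Filter.Eventually.of_forall fun q => norm_duhamelIntegrand_le hd hε p q)

theorem measurable_halfDuhamel (hε : 0 < ε) (hH : Measurable H) :
    Measurable (halfDuhamel ε σ H) :=
  (measurable_duhamelIntegrand hε hH).stronglyMeasurable.integral_prod_right'.measurable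

theorem exists_norm_halfDuhamel_le (hd : 1 ≤ d) (hε : 0 < ε) (hHi : Integrable H) :
    ∃ M, ∀ p, ‖halfDuhamel ε σ H p‖ ≤ M :=
  ⟨∫ q, ‖H q‖ * (‖waveConst d‖ * (ε ^ 2) ^ (-(((d : ℝ) - 1) / 2))), fun p =>
    norm_integral_le_of_norm_le (hHi.norm.mul_const _)
      (Filter.Eventually.of_forall fun q => norm_duhamelIntegrand_le hd hε p q)⟩

theorem exists_norm_integral_halfDuhamel_le {d : ℕ} (hd : 2 ≤ d) :
    ∃ C, 0 ≤ C ∧ ∀ (ε σ : ℝ) (_ : 0 < ε) (_ : |σ| = 1) (G H : ℝ × Euc d → ℂ) (_ : IsTest G)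
      (_ : IsTest H), ‖∫ p, G p * halfDuhamel ε σ H p‖ ≤
        C * (∫ p, ‖H p‖ ^ dualExp d) ^ (1 / dualExp d) *
          (∫ p, ‖G p‖ ^ dualExp d) ^ (1 / dualExp d) := by
  obtain ⟨C, hC, hmain⟩ := exists_norm_integral_waveForm_le hd
  refine ⟨C, hC, fun ε σ hε hσ G H hG hH => ?_⟩
  have hw : Measurable fun p : ℝ × ℝ => (timeWindow p.1 p.2 : ℂ) :=
    Complex.measurable_ofReal.comp measurable_timeWindow
  have hw1 : ∀ p : ℝ × ℝ, ‖(timeWindow p.1 p.2 : ℂ)‖ ≤ 1 := fun p => by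
    rw [Complex.norm_real]; exact abs_timeWindow_le _ _
  have h1 := hmain ε σ hε hσ _ hw hw1 G H hG hH
  rw [Real.mul_rpow (by positivity) (by positivity)] at h1
  have hi := integrable_waveForm (by omega) hε (σ := σ) hw hw1 hG hH
  have h2 : ∫ p, G p * halfDuhamel ε σ H p =
      ∫ P, waveForm ε σ (fun p => (timeWindow p.1 p.2 : ℂ)) G H P := by
    rw [Measure.volume_eq_prod (ℝ × Euc d) (ℝ × Euc d)] at hi ⊢
    rw [integral_prod _ hi]
    refine integral_congr_ae (Filter.Eventually.of_forall fun p => ?_)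
    simp only [halfDuhamel, waveForm]
    rw [← integral_const_mul]
    refine integral_congr_ae (Filter.Eventually.of_forall fun q => ?_)
    simp only
    ring
  rw [h2]
  refine h1.trans (le_of_eq ?_)
  ring

end WaveStrichartz

namespace WaveStrichartz

/-- The mollified half-wave with profile `m`. -/
def halfWave {d : ℕ} (ε σ : ℝ) (m : Euc d → ℂ) (p : ℝ × Euc d) : ℂ :=
  ∫ ξ, (((rexp (-(2 * π * ε) * ‖ξ‖) : ℝ) : ℂ) * m ξ) * planeWave σ p ξ

theorem norm_halfWave_le {d : ℕ} (ε σ : ℝ) (m : Euc d → ℂ) (p : ℝ × Euc d) :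
    ‖halfWave ε σ m p‖ ≤ ∫ ξ, ‖((rexp (-(2 * π * ε) * ‖ξ‖) : ℝ) : ℂ) * m ξ‖ := by
  refine (norm_integral_le_integral_norm _).trans (le_of_eq ?_)
  simp only [norm_mul, norm_planeWave, mul_one]

theorem continuous_halfWave {d : ℕ} {ε : ℝ} (σ : ℝ) {m : Euc d → ℂ}
    (hm : Integrable fun ξ => ((rexp (-(2 * π * ε) * ‖ξ‖) : ℝ) : ℂ) * m ξ) :
    Continuous (halfWave ε σ m) := by
  refine continuous_of_dominated (bound := fun ξ =>
    ‖((rexp (-(2 * π * ε) * ‖ξ‖) : ℝ) : ℂ) * m ξ‖) (fun p => ?_) (fun p => ?_) hm.norm ?_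
  · exact hm.aestronglyMeasurable.mul
      (by fun_prop : Continuous fun ξ => planeWave σ p ξ).aestronglyMeasurable
  · refine Filter.Eventually.of_forall fun ξ => ?_
    rw [norm_mul _ (planeWave σ p ξ), norm_planeWave, mul_one]
  · exact Filter.Eventually.of_forall fun ξ => by fun_prop

/-- The velocity profile `b(ξ) / (4πi‖ξ‖)` of the half-waves. -/
def velocityProfile {d : ℕ} (b : Euc d → ℂ) (ξ : Euc d) : ℂ :=
  1 / (4 * π * Complex.I) * (b ξ / ‖ξ‖)

theorem norm_four_pi_I : ‖1 / (4 * π * Complex.I : ℂ)‖ ≤ 1 := by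
  have : (1 : ℝ) ≤ 4 * π := by linarith [Real.pi_gt_three]
  have h4 : ‖(4 : ℂ)‖ = 4 := by norm_num
  rw [norm_div, norm_one, norm_mul, norm_mul, Complex.norm_I, Complex.norm_real,
    Real.norm_of_nonneg Real.pi_pos.le, mul_one, h4]
  exact (div_le_one (by positivity)).2 this

/-- The mollified solution with Cauchy data given by the Fourier transforms `a`, `b` and
forcing term `H`. -/
def approxSol {d : ℕ} (ε : ℝ) (a b : Euc d → ℂ) (H : ℝ × Euc d → ℂ) (p : ℝ × Euc d) : ℂ :=
  1 / 2 * (halfWave ε 1 a p + halfWave ε (-1) a p) +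
    (halfWave ε 1 (velocityProfile b) p - halfWave ε (-1) (velocityProfile b) p) -
    1 / (4 * π * Complex.I) * (halfDuhamel ε 1 H p - halfDuhamel ε (-1) H p)

theorem norm_velocityProfile_le {d : ℕ} (b : Euc d → ℂ) (ξ : Euc d) :
    ‖ξ‖ * ‖velocityProfile b ξ‖ ^ 2 ≤ ‖b ξ‖ ^ 2 / ‖ξ‖ := by
  have h1 : ‖velocityProfile b ξ‖ ≤ ‖b ξ‖ / ‖ξ‖ := by
    rw [velocityProfile, norm_mul, norm_div (b ξ), Complex.norm_real, norm_norm]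
    exact mul_le_of_le_one_left (by positivity) norm_four_pi_I
  rcases (norm_nonneg ξ).eq_or_lt with h0 | h0
  · rw [← h0]; simp
  · calc _ ≤ ‖ξ‖ * (‖b ξ‖ / ‖ξ‖) ^ 2 := by gcongr
      _ = _ := by field_simp

theorem aestronglyMeasurable_velocityProfile {d : ℕ} {b : Euc d → ℂ}
    (hb : AEStronglyMeasurable b) : AEStronglyMeasurable (velocityProfile b) := by
  have hi : AEStronglyMeasurable (fun ξ : Euc d => ((‖ξ‖ : ℂ))⁻¹) := by
    refine Measurable.aestronglyMeasurable ?_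
    fun_prop
  exact (hb.mul hi).const_mul _

theorem integrable_velocityProfile {d : ℕ} {b : Euc d → ℂ} (hb : AEStronglyMeasurable b)
    (hb2 : Integrable fun ξ => ‖b ξ‖ ^ 2 / ‖ξ‖) :
    Integrable fun ξ => ‖ξ‖ * ‖velocityProfile b ξ‖ ^ 2 := by
  refine hb2.mono' ?_ (Filter.Eventually.of_forall fun ξ => ?_)
  · exact (by fun_prop : Continuous fun ξ : Euc d => ‖ξ‖).aestronglyMeasurable.mul
      ((aestronglyMeasurable_velocityProfile hb).norm.pow 2)
  · rw [Real.norm_of_nonneg (by positivity)]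
    exact norm_velocityProfile_le b ξ

theorem exists_norm_integral_approxSol_le {d : ℕ} (hd : 2 ≤ d) :
    ∃ C, 0 ≤ C ∧ ∀ (ε : ℝ) (_ : 0 < ε) (a b : Euc d → ℂ) (_ : AEStronglyMeasurable a)
      (_ : AEStronglyMeasurable b) (_ : Integrable fun ξ => ‖ξ‖ * ‖a ξ‖ ^ 2)
      (_ : Integrable fun ξ => ‖b ξ‖ ^ 2 / ‖ξ‖) (G H : ℝ × Euc d → ℂ) (_ : IsTest G)
      (_ : IsTest H), ‖∫ p, G p * approxSol ε a b H p‖ ≤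
        C * ((∫ ξ, ‖ξ‖ * ‖a ξ‖ ^ 2) ^ (1 / 2 : ℝ) + (∫ ξ, ‖b ξ‖ ^ 2 / ‖ξ‖) ^ (1 / 2 : ℝ) +
          (∫ p, ‖H p‖ ^ dualExp d) ^ (1 / dualExp d)) *
          (∫ p, ‖G p‖ ^ dualExp d) ^ (1 / dualExp d) := by
  obtain ⟨C₁, hC₁, h1⟩ := exists_norm_integral_planeWave_le hd
  obtain ⟨C₂, hC₂, h2⟩ := exists_norm_integral_halfDuhamel_le hd
  refine ⟨2 * C₁ + 2 * C₂, by positivity, ?_⟩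
  intro ε hε a b ha hb ha2 hb2 G H hG hH
  have hc2 := integrable_velocityProfile hb hb2
  have hc := aestronglyMeasurable_velocityProfile hb
  set c := velocityProfile b with hcdef
  set A := (∫ ξ, ‖ξ‖ * ‖a ξ‖ ^ 2) ^ (1 / 2 : ℝ) with hA
  set B := (∫ ξ, ‖b ξ‖ ^ 2 / ‖ξ‖) ^ (1 / 2 : ℝ) with hB
  set N := (∫ p, ‖H p‖ ^ dualExp d) ^ (1 / dualExp d) with hN
  set X := (∫ p, ‖G p‖ ^ dualExp d) ^ (1 / dualExp d) with hX
  have hX0 : 0 ≤ X := by positivity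
  have hN0 : 0 ≤ N := by positivity
  have hA0 : 0 ≤ A := by positivity
  have hB0 : 0 ≤ B := Real.rpow_nonneg (integral_nonneg fun ξ => by positivity) _
  have hcB : (∫ ξ, ‖ξ‖ * ‖c ξ‖ ^ 2) ^ (1 / 2 : ℝ) ≤ B :=
    Real.rpow_le_rpow (integral_nonneg fun ξ => by positivity)
      (integral_mono hc2 hb2 fun ξ => norm_velocityProfile_le b ξ) (by norm_num)
  have s1 : |(1 : ℝ)| = 1 := abs_one
  have s2 : |(-1 : ℝ)| = 1 := by simp
  have iW : ∀ (σ : ℝ) {m : Euc d → ℂ}, AEStronglyMeasurable m →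
      (Integrable fun ξ => ‖ξ‖ * ‖m ξ‖ ^ 2) → Integrable fun p => G p * halfWave ε σ m p := by
    intro σ m hm hm2
    have h := integrable_exp_mul_of_integrable_norm_mul_sq hd hε hm hm2
    exact hG.integrable.mul_bdd (continuous_halfWave σ h).aestronglyMeasurable
      (Filter.Eventually.of_forall fun p => norm_halfWave_le ε σ m p)
  have iD : ∀ σ : ℝ, Integrable fun p => G p * halfDuhamel ε σ H p := by
    intro σ
    obtain ⟨M, hM⟩ := exists_norm_halfDuhamel_le (σ := σ) (by omega) hε hH.integrable
    exact hG.integrable.mul_bdd (measurable_halfDuhamel hε hH.measurable).aestronglyMeasurable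
      (Filter.Eventually.of_forall hM)
  have e : ∫ p, G p * approxSol ε a b H p =
      1 / 2 * ((∫ p, G p * halfWave ε 1 a p) + ∫ p, G p * halfWave ε (-1) a p) +
      ((∫ p, G p * halfWave ε 1 c p) - ∫ p, G p * halfWave ε (-1) c p) -
      1 / (4 * π * Complex.I) *
        ((∫ p, G p * halfDuhamel ε 1 H p) - ∫ p, G p * halfDuhamel ε (-1) H p) := by
    rw [← integral_add (iW _ ha ha2) (iW _ ha ha2), ← integral_sub (iW _ hc hc2) (iW _ hc hc2),
      ← integral_sub (iD _) (iD _), ← integral_const_mul, ← integral_const_mul,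
      ← integral_add, ← integral_sub]
    · refine integral_congr_ae (Filter.Eventually.of_forall fun p => ?_)
      simp only [approxSol, ← hcdef]
      ring
    · exact (((iW _ ha ha2).add (iW _ ha ha2)).const_mul _).add
        ((iW _ hc hc2).sub (iW _ hc hc2))
    · exact ((iD _).sub (iD _)).const_mul _
    · exact ((iW _ ha ha2).add (iW _ ha ha2)).const_mul _
    · exact (iW _ hc hc2).sub (iW _ hc hc2)
  rw [e]
  have b1 := h1 ε 1 hε s1 a ha ha2 G hG
  have b2 := h1 ε (-1) hε s2 a ha ha2 G hG
  have b3 := (h1 ε 1 hε s1 c hc hc2 G hG).trans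
    (mul_le_mul_of_nonneg_right (mul_le_mul_of_nonneg_left hcB hC₁) hX0)
  have b4 := (h1 ε (-1) hε s2 c hc hc2 G hG).trans
    (mul_le_mul_of_nonneg_right (mul_le_mul_of_nonneg_left hcB hC₁) hX0)
  have b5 := h2 ε 1 hε s1 G H hG hH
  have b6 := h2 ε (-1) hε s2 G H hG hH
  have t1 : ‖(1 / 2 : ℂ) * ((∫ p, G p * halfWave ε 1 a p) + ∫ p, G p * halfWave ε (-1) a p)‖ ≤
      C₁ * A * X := by
    rw [norm_mul]
    have := norm_add_le (∫ p, G p * halfWave ε 1 a p) (∫ p, G p * halfWave ε (-1) a p)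
    have h12 : ‖(1 / 2 : ℂ)‖ = 1 / 2 := by norm_num
    rw [h12]
    unfold halfWave at *
    linarith
  have t2 : ‖(∫ p, G p * halfWave ε 1 c p) - ∫ p, G p * halfWave ε (-1) c p‖ ≤
      2 * (C₁ * B * X) := by
    have := norm_sub_le (∫ p, G p * halfWave ε 1 c p) (∫ p, G p * halfWave ε (-1) c p)
    unfold halfWave at *
    linarith
  have t3 : ‖(1 / (4 * π * Complex.I) : ℂ) *
      ((∫ p, G p * halfDuhamel ε 1 H p) - ∫ p, G p * halfDuhamel ε (-1) H p)‖ ≤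
      2 * (C₂ * N * X) := by
    rw [norm_mul]
    refine (mul_le_of_le_one_left (norm_nonneg _) norm_four_pi_I).trans ?_
    have := norm_sub_le (∫ p, G p * halfDuhamel ε 1 H p) (∫ p, G p * halfDuhamel ε (-1) H p)
    linarith
  refine (norm_sub_le _ _).trans ((add_le_add ((norm_add_le _ _).trans (add_le_add t1 t2)) t3).trans
    ?_)
  have p1 : 0 ≤ C₁ * A * X := by positivity
  have p2 : 0 ≤ C₁ * N * X := by positivity
  have p3 : 0 ≤ C₂ * A * X := by positivity
  have p4 : 0 ≤ C₂ * B * X := by positivity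
  nlinarith

end WaveStrichartz

namespace WaveStrichartz

theorem measurable_approxSol {d : ℕ} (hd : 2 ≤ d) {ε : ℝ} (hε : 0 < ε) {a b : Euc d → ℂ}
    {H : ℝ × Euc d → ℂ} (ha : AEStronglyMeasurable a) (hb : AEStronglyMeasurable b)
    (ha2 : Integrable fun ξ => ‖ξ‖ * ‖a ξ‖ ^ 2) (hb2 : Integrable fun ξ => ‖b ξ‖ ^ 2 / ‖ξ‖)
    (hH : Measurable H) : Measurable (approxSol ε a b H) := by
  have h1 := integrable_exp_mul_of_integrable_norm_mul_sq hd hε ha ha2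
  have h2 := integrable_exp_mul_of_integrable_norm_mul_sq hd hε
    (aestronglyMeasurable_velocityProfile hb) (integrable_velocityProfile hb hb2)
  have m1 := fun σ => (continuous_halfWave σ h1).measurable
  have m2 := fun σ => (continuous_halfWave σ h2).measurable
  have m3 := fun σ => measurable_halfDuhamel (σ := σ) hε hH
  exact ((((m1 1).add (m1 (-1))).const_mul _).add ((m2 1).sub (m2 (-1)))).sub
    (((m3 1).sub (m3 (-1))).const_mul _)

theorem exists_norm_approxSol_le {d : ℕ} (hd : 1 ≤ d) {ε : ℝ} (hε : 0 < ε) (a b : Euc d → ℂ)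
    {H : ℝ × Euc d → ℂ} (hH : Integrable H) : ∃ M, ∀ p, ‖approxSol ε a b H p‖ ≤ M := by
  have m1 := fun σ => norm_halfWave_le ε σ a
  have m2 := fun σ => norm_halfWave_le ε σ (velocityProfile b)
  obtain ⟨M₁, h₁⟩ := exists_norm_halfDuhamel_le (σ := 1) hd hε hH
  obtain ⟨M₂, h₂⟩ := exists_norm_halfDuhamel_le (σ := -1) hd hε hH
  refine ⟨‖(1 / 2 : ℂ)‖ * ((∫ ξ, ‖((rexp (-(2 * π * ε) * ‖ξ‖) : ℝ) : ℂ) * a ξ‖) +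
      ∫ ξ, ‖((rexp (-(2 * π * ε) * ‖ξ‖) : ℝ) : ℂ) * a ξ‖) +
    ((∫ ξ, ‖((rexp (-(2 * π * ε) * ‖ξ‖) : ℝ) : ℂ) * velocityProfile b ξ‖) +
      ∫ ξ, ‖((rexp (-(2 * π * ε) * ‖ξ‖) : ℝ) : ℂ) * velocityProfile b ξ‖) +
    ‖1 / (4 * π * Complex.I : ℂ)‖ * (M₁ + M₂), fun p => ?_⟩
  refine (norm_sub_le _ _).trans (add_le_add ((norm_add_le _ _).trans (add_le_add ?_
    ((norm_sub_le _ _).trans (add_le_add (m2 1 p) (m2 (-1) p))))) ?_)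
  · rw [norm_mul]
    exact mul_le_mul_of_nonneg_left ((norm_add_le _ _).trans (add_le_add (m1 1 p) (m1 (-1) p)))
      (norm_nonneg _)
  · rw [norm_mul]
    exact mul_le_mul_of_nonneg_left ((norm_sub_le _ _).trans (add_le_add (h₁ p) (h₂ p)))
      (norm_nonneg _)

theorem exists_eLpNorm_approxSol_le {d : ℕ} (hd : 2 ≤ d) :
    ∃ C, 0 ≤ C ∧ ∀ (ε : ℝ) (_ : 0 < ε) (a b : Euc d → ℂ) (_ : AEStronglyMeasurable a)
      (_ : AEStronglyMeasurable b) (_ : Integrable fun ξ => ‖ξ‖ * ‖a ξ‖ ^ 2)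
      (_ : Integrable fun ξ => ‖b ξ‖ ^ 2 / ‖ξ‖) (H : ℝ × Euc d → ℂ) (_ : IsTest H) (R : ℝ),
      eLpNorm (approxSol ε a b H) (ENNReal.ofReal (2 * ((d : ℝ) + 1) / ((d : ℝ) - 1)))
        (volume.restrict (Metric.closedBall 0 R)) ≤ ENNReal.ofReal
        (C * ((∫ ξ, ‖ξ‖ * ‖a ξ‖ ^ 2) ^ (1 / 2 : ℝ) + (∫ ξ, ‖b ξ‖ ^ 2 / ‖ξ‖) ^ (1 / 2 : ℝ) +
          (∫ p, ‖H p‖ ^ dualExp d) ^ (1 / dualExp d))) := by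
  obtain ⟨C, hC, hmain⟩ := exists_norm_integral_approxSol_le hd
  refine ⟨C, hC, fun ε hε a b ha hb ha2 hb2 H hH R => ?_⟩
  have hd' : (2 : ℝ) ≤ d := by exact_mod_cast hd
  have hd1 : (0 : ℝ) < d - 1 := by linarith
  obtain ⟨M, hM⟩ := exists_norm_approxSol_le (by omega) hε a b hH.integrable
  refine eLpNorm_restrict_le_of_duality (r := dualExp d) (M := M) (R := R) ?_ ?_
    (measurable_approxSol hd hε ha hb ha2 hb2 hH.measurable)
    Metric.isClosed_closedBall.measurableSet (fun x _ => hM x)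
    (fun x hx => mem_closedBall_zero_iff.1 hx) ?_
    fun G hG _ => hmain ε hε a b ha hb ha2 hb2 G H hG hH
  · rw [lt_div_iff₀ hd1]; linarith
  · rw [dualExp]; field_simp; ring
  · have : 0 ≤ ∫ ξ, ‖b ξ‖ ^ 2 / ‖ξ‖ := integral_nonneg fun ξ => by positivity
    positivity

end WaveStrichartz

namespace WaveStrichartz

open scoped FourierTransform

variable {d : ℕ}

theorem besselFactor_zero (a : ℂ) (b : ℝ) : besselFactor 0 a b = 1 / (2 * π) := by
  have h1 : ∫ r in Ioi (0 : ℝ), rexp (-(2 * π) * r) = 1 / (2 * π) := by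
    rw [integral_exp_mul_Ioi (by linarith [Real.pi_pos])]
    simp
  calc besselFactor 0 a b = ∫ r in Ioi (0 : ℝ), ((rexp (-(2 * π) * r) : ℝ) : ℂ) := by
        simp [besselFactor]
    _ = _ := by rw [integral_complex_ofReal, h1]; push_cast; ring

/-- The (complexified) Poisson kernel. -/
def poissonKernel (a : ℂ) (x : Euc d) : ℂ :=
  2 * π * a * (besselConst d 0 * (a ^ 2 + (‖x‖ : ℂ) ^ 2) ^ (-(((d : ℂ) + 1) / 2)))

theorem integral_exp_mul_planeWave (hd : 1 ≤ d) {ε : ℝ} (hε : 0 < ε) (σ : ℝ)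
    (p : ℝ × Euc d) :
    ∫ ξ, ((rexp (-(2 * π * ε) * ‖ξ‖) : ℝ) : ℂ) * planeWave σ p ξ =
      poissonKernel (wavePhase ε σ p.1) p.2 := by
  have ha : 0 < (wavePhase ε σ p.1).re := by rwa [wavePhase_re]
  have ha0 : wavePhase ε σ p.1 ≠ 0 := fun h => by rw [h] at ha; simp at ha
  have h := integral_besselMultiplier hd 0 ha p.2
  have he : (-(1 / 2 + ((0 : ℝ) : ℂ) * Complex.I + (d : ℂ) / 2)) = -(((d : ℂ) + 1) / 2) := by
    push_cast; ring
  rw [he] at h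
  rw [poissonKernel, ← h, ← integral_const_mul]
  refine integral_congr_ae (Filter.Eventually.of_forall fun ξ => ?_)
  simp only [besselMultiplier, besselFactor_zero]
  have hp : (π : ℂ) ≠ 0 := by exact_mod_cast Real.pi_ne_zero
  have h2 : ((rexp (-(2 * π * ε) * ‖ξ‖) : ℝ) : ℂ) * planeWave σ p ξ =
      Complex.exp (-2 * π * wavePhase ε σ p.1 * ‖ξ‖) *
        Complex.exp (2 * π * Complex.I * ⟪p.2, ξ⟫) := by
    rw [planeWave, Complex.ofReal_exp, ← Complex.exp_add, ← Complex.exp_add]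
    congr 1
    simp only [wavePhase]
    push_cast
    ring
  rw [h2]
  set E := Complex.exp (-2 * π * wavePhase ε σ p.1 * ‖ξ‖)
  simp only [Complex.ofReal_zero, zero_mul, add_zero, Complex.cpow_neg, Complex.cpow_one]
  field_simp

theorem integral_mul_fourier_mul_planeWave {h m : Euc d → ℂ} (hh : Integrable h)
    (hm : Integrable m) (σ : ℝ) (p : ℝ × Euc d) :
    ∫ ξ, (m ξ * 𝓕 h ξ) * planeWave σ p ξ =
      ∫ y, h y * ∫ ξ, m ξ * planeWave σ (p.1, p.2 - y) ξ := by
  set H : Euc d → Euc d → ℂ := fun ξ y => m ξ * h y * planeWave σ (p.1, p.2 - y) ξ with hH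
  have h_integrable : Integrable (Function.uncurry H) ((volume : Measure (Euc d)).prod volume) := by
    have h1 := hm.mul_prod hh
    refine (h1.norm).mono' ?_ (Filter.Eventually.of_forall fun P => ?_)
    · have h2 : AEStronglyMeasurable (fun P : Euc d × Euc d => planeWave σ (p.1, p.2 - P.2) P.1)
          ((volume : Measure (Euc d)).prod volume) := by
        apply Continuous.aestronglyMeasurable; fun_prop
      exact h1.aestronglyMeasurable.mul h2
    · simp only [hH, Function.uncurry_def, norm_mul, norm_planeWave, mul_one, le_refl]
  calc _ = ∫ ξ, ∫ y, H ξ y := by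
        refine integral_congr_ae (Filter.Eventually.of_forall fun ξ => ?_)
        simp only
        rw [← osc_neg_eq_fourier, osc, mul_right_comm, ← integral_const_mul]
        refine integral_congr_ae (Filter.Eventually.of_forall fun y => ?_)
        simp only [hH, planeWave]
        rw [mul_mul_mul_comm, mul_comm (Complex.exp _) (Complex.exp _), ← mul_assoc,
          mul_assoc (m ξ * h y), ← Complex.exp_add]
        congr 2
        rw [inner_neg_right, inner_sub_left]
        push_cast
        ring
    _ = ∫ y, ∫ ξ, H ξ y := integral_integral_swap h_integrable
    _ = _ := by
        refine integral_congr_ae (Filter.Eventually.of_forall fun y => ?_)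
        simp only
        rw [← integral_const_mul]
        refine integral_congr_ae (Filter.Eventually.of_forall fun ξ => ?_)
        simp only [hH]
        ring

theorem halfWave_fourier (hd : 1 ≤ d) {ε : ℝ} (hε : 0 < ε) (σ : ℝ) {h : Euc d → ℂ}
    (hh : Integrable h) (p : ℝ × Euc d) :
    halfWave ε σ (𝓕 h) p = ∫ y, h y * poissonKernel (wavePhase ε σ p.1) (p.2 - y) := by
  have hm : Integrable fun ξ : Euc d => ((rexp (-(2 * π * ε) * ‖ξ‖) : ℝ) : ℂ) := by
    have := integrable_norm_rpow_mul_exp (d := d) hd (k := 0) (by simp; omega)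
      (c := 2 * π * ε) (by positivity)
    simp only [Real.rpow_zero, one_mul] at this
    exact this.ofReal
  rw [halfWave, integral_mul_fourier_mul_planeWave hh hm]
  simp only [integral_exp_mul_planeWave hd hε]

theorem halfWave_velocityProfile_fourier (hd : 2 ≤ d) {ε : ℝ} (hε : 0 < ε) (σ : ℝ)
    {h : Euc d → ℂ} (hh : Integrable h) (p : ℝ × Euc d) :
    halfWave ε σ (velocityProfile (𝓕 h)) p = 1 / (4 * π * Complex.I) *
      ∫ y, h y * waveKernel (wavePhase ε σ p.1) (p.2 - y) := by
  have hm : Integrable fun ξ : Euc d => ((rexp (-(2 * π * ε) * ‖ξ‖) / ‖ξ‖ : ℝ) : ℂ) :=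
    (integrable_exp_div_norm hd (by positivity)).ofReal
  have h1 := integral_mul_fourier_mul_planeWave hh hm σ p
  simp only [integral_exp_div_norm_mul_planeWave hd hε] at h1
  rw [← h1, halfWave, ← integral_const_mul]
  refine integral_congr_ae (Filter.Eventually.of_forall fun ξ => ?_)
  simp only [velocityProfile]
  push_cast
  ring

end WaveStrichartz

namespace WaveStrichartz

open scoped FourierTransform SchwartzMap ContDiff LineDeriv

variable {d : ℕ}

theorem exists_schwartzMap_complex {f : Euc d → ℝ} (hf : IsSchwartzFn d f) :
    ∃ Φ : 𝓢(Euc d, ℂ), ∀ x, Φ x = (f x : ℂ) := by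
  obtain ⟨φ, hφ⟩ := hf
  exact ⟨φ.postcompCLM Complex.ofRealCLM, fun x => by simp [hφ]⟩

theorem exists_schwartzMap_spatialLap {f : Euc d → ℝ} (hf : IsSchwartzFn d f) {Φ : 𝓢(Euc d, ℂ)}
    (hΦ : ∀ x, Φ x = (f x : ℂ)) (x : Euc d) :
    (∑ i : Fin d, ∂_{EuclideanSpace.single i (1 : ℝ)} (∂_{EuclideanSpace.single i (1 : ℝ)} Φ)) x =
      (spatialLap d f x : ℂ) := by
  obtain ⟨φ, hφ⟩ := hf
  obtain rfl : f = φ := funext hφ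
  have h1 : ∀ (ψ : 𝓢(Euc d, ℝ)) (Ψ : 𝓢(Euc d, ℂ)) (_ : ∀ x, Ψ x = (ψ x : ℂ)) (v x : Euc d),
      (∂_{v} Ψ) x = ((∂_{v} ψ) x : ℂ) := by
    intro ψ Ψ h v x
    have h2 : (Ψ : Euc d → ℂ) = fun x => Complex.ofRealCLM (ψ x) := funext h
    rw [SchwartzMap.lineDerivOp_apply_eq_fderiv, SchwartzMap.lineDerivOp_apply_eq_fderiv, h2]
    have h3 := (Complex.ofRealCLM.hasFDerivAt.comp x ψ.differentiableAt.hasFDerivAt).fderiv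
    simp only [Function.comp_def] at h3
    rw [h3]
    simp
  rw [sum_apply, spatialLap]
  push_cast
  refine Finset.sum_congr rfl fun i _ => ?_
  rw [h1 _ _ (h1 φ Φ hΦ _)]
  simp only [SchwartzMap.lineDerivOp_apply_eq_fderiv]
  rfl

theorem fourier_lineDerivOp_apply (Φ : 𝓢(Euc d, ℂ)) (v ξ : Euc d) :
    𝓕 (⇑(∂_{v} Φ : 𝓢(Euc d, ℂ))) ξ = 2 * π * Complex.I * ⟪ξ, v⟫ * 𝓕 (Φ : Euc d → ℂ) ξ := by
  have h1 := congrArg (fun Ψ : 𝓢(Euc d, ℂ) => Ψ ξ) (SchwartzMap.fourier_lineDerivOp_eq Φ v)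
  have ht : (fun x : Euc d => inner ℝ x v).HasTemperateGrowth := by fun_prop
  simp only [smul_apply, SchwartzMap.smulLeftCLM_apply_apply ht,
    SchwartzMap.fourier_coe] at h1
  rw [h1]
  simp only [smul_eq_mul, Complex.real_smul]
  ring

theorem fourier_spatialLap {f : Euc d → ℝ} (hf : IsSchwartzFn d f) (ξ : Euc d) :
    𝓕 (fun x => (spatialLap d f x : ℂ)) ξ =
      -((2 * π * ‖ξ‖ : ℝ) : ℂ) ^ 2 * 𝓕 (fun x => (f x : ℂ)) ξ := by
  obtain ⟨Φ, hΦ⟩ := exists_schwartzMap_complex hf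
  have h1 : (fun x => (f x : ℂ)) = Φ := funext fun x => (hΦ x).symm
  have h2 : (fun x => (spatialLap d f x : ℂ)) =
      ∑ i : Fin d, ⇑(∂_{EuclideanSpace.single i (1 : ℝ)}
        (∂_{EuclideanSpace.single i (1 : ℝ)} Φ : 𝓢(Euc d, ℂ)) : 𝓢(Euc d, ℂ)) := by
    funext x
    rw [← exists_schwartzMap_spatialLap hf hΦ x, sum_apply, Finset.sum_apply]
  rw [h1, h2]
  have h3 : 𝓕 (∑ i : Fin d, ⇑(∂_{EuclideanSpace.single i (1 : ℝ)}
        (∂_{EuclideanSpace.single i (1 : ℝ)} Φ : 𝓢(Euc d, ℂ)) : 𝓢(Euc d, ℂ))) ξ = ∑ i : Fin d,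
      𝓕 ⇑(∂_{EuclideanSpace.single i (1 : ℝ)}
        (∂_{EuclideanSpace.single i (1 : ℝ)} Φ : 𝓢(Euc d, ℂ)) : 𝓢(Euc d, ℂ)) ξ := by
    simp only [Real.fourier_eq, Finset.sum_apply, Finset.smul_sum]
    refine integral_finsetSum _ fun i _ => ?_
    exact (Real.fourierIntegral_convergent_iff ξ).2 (SchwartzMap.integrable _)
  rw [h3]
  simp only [fourier_lineDerivOp_apply]
  have h4 : ((2 * π * ‖ξ‖ : ℝ) : ℂ) ^ 2 = (2 * π) ^ 2 * ∑ i : Fin d, (ξ i : ℂ) ^ 2 := by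
    rw [← Complex.ofReal_pow, mul_pow, EuclideanSpace.norm_sq_eq]
    push_cast
    congr 1
    refine Finset.sum_congr rfl fun i _ => ?_
    rw [Real.norm_eq_abs, ← Complex.ofReal_pow, sq_abs, Complex.ofReal_pow]
  rw [h4, Finset.mul_sum, ← Finset.sum_neg_distrib, Finset.sum_mul]
  refine Finset.sum_congr rfl fun i _ => ?_
  simp only [EuclideanSpace.inner_single_right, one_mul, conj_trivial]
  linear_combination (2 * π * (ξ i : ℂ)) ^ 2 * 𝓕 (Φ : Euc d → ℂ) ξ * Complex.I_sq

end WaveStrichartz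

namespace WaveStrichartz

open scoped FourierTransform

variable {d : ℕ}

theorem osc_slice_eq_setIntegral {g : ℝ → Euc d → ℂ} {R : ℝ} (hs : ∀ t y, R < ‖y‖ → g t y = 0)
    (t : ℝ) (ξ : Euc d) : osc (g t) ξ = ∫ y in Metric.closedBall (0 : Euc d) R,
      g t y * Complex.exp (2 * π * Complex.I * ⟪y, ξ⟫) := by
  refine (setIntegral_eq_integral_of_forall_compl_eq_zero fun y hy => ?_).symm
  rw [hs t y (by simpa using hy), zero_mul]

theorem continuous_osc_slice {g : ℝ → Euc d → ℂ} (hg : Continuous (Function.uncurry g)) {R : ℝ}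
    (hs : ∀ t y, R < ‖y‖ → g t y = 0) : Continuous fun P : ℝ × Euc d => osc (g P.1) P.2 := by
  simp only [osc_slice_eq_setIntegral hs]
  have hc : Continuous (Function.uncurry fun (P : ℝ × Euc d) (y : Euc d) =>
      g P.1 y * Complex.exp (2 * π * Complex.I * ⟪y, P.2⟫)) := by
    have : Continuous fun Q : (ℝ × Euc d) × Euc d => g Q.1.1 Q.2 :=
      hg.comp (by fun_prop : Continuous fun Q : (ℝ × Euc d) × Euc d => (Q.1.1, Q.2))
    simp only [Function.uncurry_def]
    fun_prop
  exact continuous_parametric_integral_of_continuous hc (isCompact_closedBall 0 R)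

theorem continuous_fourier_slice {g : ℝ → Euc d → ℂ} (hg : Continuous (Function.uncurry g)) {R : ℝ}
    (hs : ∀ t y, R < ‖y‖ → g t y = 0) : Continuous fun P : ℝ × Euc d => 𝓕 (g P.1) P.2 := by
  simp only [← osc_neg_eq_fourier]
  exact (continuous_osc_slice hg hs).comp
    (by fun_prop : Continuous fun P : ℝ × Euc d => (P.1, -P.2))

theorem hasDerivAt_fourier_slice {g g' : ℝ → Euc d → ℂ} (hg : Continuous (Function.uncurry g))
    (hg' : Continuous (Function.uncurry g'))
    (hd : ∀ t y, HasDerivAt (fun s => g s y) (g' t y) t) {R : ℝ}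
    (hs : ∀ t y, R < ‖y‖ → g t y = 0) (hs' : ∀ t y, R < ‖y‖ → g' t y = 0) (t : ℝ) (ξ : Euc d) :
    HasDerivAt (fun s => 𝓕 (g s) ξ) (𝓕 (g' t) ξ) t := by
  simp only [← osc_neg_eq_fourier]
  set η := -ξ
  obtain ⟨M, hM⟩ := ((isCompact_Icc (a := t - 1) (b := t + 1)).prod
    (isCompact_closedBall (0 : Euc d) R)).exists_bound_of_continuousOn hg'.continuousOn
  have hgt : ∀ s, Continuous (g s) := fun s => hg.comp (by fun_prop : Continuous fun y => (s, y))
  have hgt' : ∀ s, Continuous (g' s) := fun s => hg'.comp (by fun_prop : Continuous fun y => (s, y))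
  have he : ∀ y : Euc d, ‖Complex.exp (2 * π * Complex.I * ⟪y, η⟫)‖ = 1 := fun y => by
    rw [show (2 * π * Complex.I * (⟪y, η⟫ : ℂ) : ℂ) = ((2 * π * ⟪y, η⟫ : ℝ) : ℂ) * Complex.I by
      push_cast; ring, Complex.norm_exp_ofReal_mul_I]
  refine (hasDerivAt_integral_of_dominated_loc_of_deriv_le (s := Icc (t - 1) (t + 1))
    (μ := (volume : Measure (Euc d)))
    (F := fun s y => g s y * Complex.exp (2 * π * Complex.I * ⟪y, η⟫))
    (F' := fun s y => g' s y * Complex.exp (2 * π * Complex.I * ⟪y, η⟫))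
    (bound := (Metric.closedBall (0 : Euc d) R).indicator fun _ => M)
    (Icc_mem_nhds (by linarith) (by linarith)) ?_ ?_ ?_ ?_ (integrable_indicator_closedBall R M) ?_).2
  · exact Filter.Eventually.of_forall fun s =>
      (by have := hgt s; fun_prop : Continuous _).aestronglyMeasurable
  · refine Continuous.integrable_of_hasCompactSupport (by have := hgt t; fun_prop)
      (HasCompactSupport.intro (isCompact_closedBall 0 R) fun y hy => ?_)
    rw [hs t y (by simpa using hy), zero_mul]
  · exact (by have := hgt' t; fun_prop : Continuous _).aestronglyMeasurable
  · refine Filter.Eventually.of_forall fun y s hst => ?_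
    rw [norm_mul, he, mul_one]
    by_cases hy : y ∈ Metric.closedBall (0 : Euc d) R
    · rw [indicator_of_mem hy]
      exact hM (s, y) ⟨hst, hy⟩
    · rw [indicator_of_notMem hy, hs' s y (by simpa using hy), norm_zero]
  · exact Filter.Eventually.of_forall fun y s _ => (hd s y).mul_const _

/-- Duhamel's formula for one frequency of a half-wave. -/
theorem duhamel_half {c c' f : ℝ → ℂ} (ω : ℂ)
    (hf : Continuous f) (hc : ∀ t, HasDerivAt c (c' t) t)
    (hc' : ∀ t, HasDerivAt c' (-(ω ^ 2) * c t - f t) t) (t : ℝ) :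
    c' t + Complex.I * ω * c t = Complex.exp (Complex.I * ω * t) *
      (c' 0 + Complex.I * ω * c 0 - ∫ s in (0 : ℝ)..t, Complex.exp (-(Complex.I * ω * s)) * f s) := by
  have he : ∀ s : ℝ, HasDerivAt (fun s : ℝ => Complex.exp (-(Complex.I * ω * s)))
      (Complex.exp (-(Complex.I * ω * s)) * (-(Complex.I * ω))) s := fun s => by
    have h1 : HasDerivAt (fun s : ℝ => -(Complex.I * ω * (s : ℂ))) (-(Complex.I * ω)) s := by
      have := ((Complex.ofRealCLM.hasDerivAt (x := s)).const_mul (Complex.I * ω)).fun_neg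
      simpa using this
    exact h1.cexp
  have h2 : ∀ s ∈ uIcc 0 t, HasDerivAt
      (fun s : ℝ => Complex.exp (-(Complex.I * ω * s)) * (c' s + Complex.I * ω * c s))
      (-(Complex.exp (-(Complex.I * ω * s)) * f s)) s := fun s _ => by
    refine ((he s).fun_mul ((hc' s).fun_add ((hc s).const_mul (Complex.I * ω)))).congr_deriv ?_
    linear_combination -(Complex.exp (-(Complex.I * ω * s)) * ω ^ 2 * c s) * Complex.I_sq
  have h3 := intervalIntegral.integral_eq_sub_of_hasDerivAt h2
    (Continuous.intervalIntegrable (by fun_prop) _ _)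
  rw [intervalIntegral.integral_neg] at h3
  simp only [Complex.ofReal_zero, mul_zero, neg_zero, Complex.exp_zero, one_mul] at h3
  have h4 : Complex.exp (Complex.I * ω * t) * Complex.exp (-(Complex.I * ω * t)) = 1 := by
    rw [← Complex.exp_add, add_neg_cancel, Complex.exp_zero]
  linear_combination -(c' t + Complex.I * ω * c t) * h4 - Complex.exp (Complex.I * ω * t) * h3

end WaveStrichartz

namespace WaveStrichartz

open scoped FourierTransform

variable {d : ℕ}

theorem integrable_timeWindow_mul {G : ℝ → Euc d → ℂ} (hG : Continuous (Function.uncurry G))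
    {R : ℝ} (hs : ∀ t y, R < ‖y‖ → G t y = 0) (t : ℝ) :
    Integrable fun q : ℝ × Euc d => (timeWindow t q.1 : ℂ) * G q.1 q.2 := by
  obtain ⟨M, hM⟩ := (isCompact_closedBall (0 : ℝ × Euc d)
    (max |t| R)).exists_bound_of_continuousOn hG.continuousOn
  have hw : Measurable fun q : ℝ × Euc d => (timeWindow t q.1 : ℂ) :=
    Complex.measurable_ofReal.comp (measurable_timeWindow.comp
      (by fun_prop : Measurable fun q : ℝ × Euc d => (t, q.1)))
  have h0 : ∀ q : ℝ × Euc d, max |t| R < ‖q‖ → (timeWindow t q.1 : ℂ) * G q.1 q.2 = 0 := by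
    intro q hq
    rw [Prod.norm_def, lt_max_iff] at hq
    rcases hq with h | h
    · rw [timeWindow_eq_zero ((le_max_left _ _).trans_lt h), Complex.ofReal_zero, zero_mul]
    · rw [hs _ _ ((le_max_right _ _).trans_lt h), mul_zero]
  refine integrable_of_bdd_of_supp (hw.mul hG.measurable).aestronglyMeasurable (M := |M|)
    (fun q => ?_) h0
  by_cases hq : max |t| R < ‖q‖
  · rw [h0 q hq, norm_zero]; positivity
  · have h1 := hM q (mem_closedBall_zero_iff.2 (not_lt.1 hq))
    rw [norm_mul, Complex.norm_real]
    exact (mul_le_of_le_one_left (norm_nonneg _) (abs_timeWindow_le _ _)).trans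
      (h1.trans (le_abs_self M))

theorem integrable_mul_planeWave_neg {W : ℝ × Euc d → ℂ} (hW : Integrable W) (σ : ℝ) (ξ : Euc d) :
    Integrable fun q : ℝ × Euc d => W q * planeWave σ (-q) ξ := by
  refine hW.norm.mono' ?_ (Filter.Eventually.of_forall fun q => ?_)
  · exact hW.aestronglyMeasurable.mul
      (by fun_prop : Continuous fun q : ℝ × Euc d => planeWave σ (-q) ξ).aestronglyMeasurable
  · rw [norm_mul _ (planeWave _ _ _), norm_planeWave, mul_one]

instance isNegInvariant_volume_prod : (volume : Measure (ℝ × Euc d)).IsNegInvariant := by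
  have : ((volume : Measure ℝ).prod (volume : Measure (Euc d))).IsAddHaarMeasure := inferInstance
  rw [Measure.volume_eq_prod]
  infer_instance

theorem integral_timeWindow_mul_planeWave {G : ℝ → Euc d → ℂ}
    (hG : Continuous (Function.uncurry G)) {R : ℝ} (hs : ∀ t y, R < ‖y‖ → G t y = 0) (σ t : ℝ)
    (ξ : Euc d) : ∫ q : ℝ × Euc d, (timeWindow t q.1 : ℂ) * G q.1 q.2 * planeWave σ (-q) ξ =
      ∫ s in (0 : ℝ)..t,
        Complex.exp (-(Complex.I * ((2 * π * σ * ‖ξ‖ : ℝ) : ℂ) * s)) * 𝓕 (G s) ξ := by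
  have hF : Continuous fun s : ℝ => 𝓕 (G s) ξ := by
    have h := (continuous_fourier_slice hG hs).comp (f := fun s : ℝ => (s, ξ)) (by fun_prop)
    simpa only [Function.comp_def] using h
  have hF' : Continuous fun s : ℝ =>
      Complex.exp (-(Complex.I * ((2 * π * σ * ‖ξ‖ : ℝ) : ℂ) * s)) * 𝓕 (G s) ξ :=
    Continuous.mul (by fun_prop) hF
  rw [← integral_timeWindow_mul t hF']
  have hi := integrable_mul_planeWave_neg (integrable_timeWindow_mul hG hs t) σ ξ
  rw [Measure.volume_eq_prod ℝ (Euc d)] at hi ⊢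
  rw [integral_prod _ hi]
  refine integral_congr_ae (Filter.Eventually.of_forall fun s => ?_)
  simp only
  rw [← osc_neg_eq_fourier, osc, ← integral_const_mul, ← integral_const_mul]
  refine integral_congr_ae (Filter.Eventually.of_forall fun y => ?_)
  simp only [planeWave, Prod.fst_neg, Prod.snd_neg]
  rw [mul_assoc]
  congr 1
  rw [mul_left_comm, ← Complex.exp_add]
  congr 2
  rw [inner_neg_left, inner_neg_right]
  push_cast
  ring

theorem halfDuhamel_eq_integral (hd : 2 ≤ d) {ε : ℝ} (hε : 0 < ε) {G : ℝ → Euc d → ℂ}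
    (hG : Continuous (Function.uncurry G)) {R : ℝ} (hs : ∀ t y, R < ‖y‖ → G t y = 0) (σ : ℝ)
    (p : ℝ × Euc d) :
    Integrable (fun ξ : Euc d => ((rexp (-(2 * π * ε) * ‖ξ‖) / ‖ξ‖ : ℝ) : ℂ) * planeWave σ p ξ *
      ∫ s in (0 : ℝ)..p.1,
        Complex.exp (-(Complex.I * ((2 * π * σ * ‖ξ‖ : ℝ) : ℂ) * s)) * 𝓕 (G s) ξ) ∧
    halfDuhamel ε σ (Function.uncurry G) p =
      ∫ ξ : Euc d, ((rexp (-(2 * π * ε) * ‖ξ‖) / ‖ξ‖ : ℝ) : ℂ) * planeWave σ p ξ *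
        ∫ s in (0 : ℝ)..p.1,
          Complex.exp (-(Complex.I * ((2 * π * σ * ‖ξ‖ : ℝ) : ℂ) * s)) * 𝓕 (G s) ξ := by
  simp only [← integral_timeWindow_mul_planeWave hG hs]
  set W : ℝ × Euc d → ℂ := fun q => (timeWindow p.1 q.1 : ℂ) * G q.1 q.2 with hW
  have hWi : Integrable W := integrable_timeWindow_mul hG hs p.1
  set m : Euc d → ℂ := fun ξ =>
    ((rexp (-(2 * π * ε) * ‖ξ‖) / ‖ξ‖ : ℝ) : ℂ) * planeWave σ p ξ with hm
  have hmi : Integrable m := by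
    have h1 : Integrable fun ξ : Euc d => ((rexp (-(2 * π * ε) * ‖ξ‖) / ‖ξ‖ : ℝ) : ℂ) :=
      (integrable_exp_div_norm hd (by positivity)).ofReal
    refine h1.norm.mono' (h1.aestronglyMeasurable.mul
      (by fun_prop : Continuous fun ξ : Euc d => planeWave σ p ξ).aestronglyMeasurable)
      (Filter.Eventually.of_forall fun ξ => ?_)
    rw [hm, norm_mul _ (planeWave _ _ _), norm_planeWave, mul_one]
  have hcone : ∀ ξ, ∫ q, W q * planeWave σ (-q) ξ = coneRestrict σ (fun q => W (-q)) ξ := fun ξ => by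
    rw [coneRestrict, ← integral_neg_eq_self]
    simp only [neg_neg]
  have hWi' : Integrable fun q => W (-q) := hWi.comp_neg
  constructor
  · have hcc : Continuous fun ξ => ∫ q, W q * planeWave σ (-q) ξ := by
      refine continuous_of_dominated (bound := fun q => ‖W q‖) (fun ξ => ?_) (fun ξ => ?_)
        hWi.norm ?_
      · exact hWi.aestronglyMeasurable.mul
          (by fun_prop : Continuous fun q : ℝ × Euc d => planeWave σ (-q) ξ).aestronglyMeasurable
      · refine Filter.Eventually.of_forall fun q => ?_
        rw [norm_mul _ (planeWave _ _ _), norm_planeWave, mul_one]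
      · exact Filter.Eventually.of_forall fun q => by fun_prop
    refine hmi.mul_bdd (c := ∫ q, ‖W q‖) hcc.aestronglyMeasurable
      (Filter.Eventually.of_forall fun ξ => ?_)
    refine (norm_integral_le_integral_norm _).trans (le_of_eq ?_)
    simp only [norm_mul _ (planeWave _ _ _), norm_planeWave, mul_one, hW]
  · change _ = ∫ ξ, m ξ * ∫ q, W q * planeWave σ (-q) ξ
    simp only [hcone]
    rw [← integral_integral_planeWave_swap σ hWi' hmi, halfDuhamel, ← integral_neg_eq_self]
    refine integral_congr_ae (Filter.Eventually.of_forall fun q => ?_)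
    simp only [hW, Function.uncurry_def]
    rw [← Prod.fst_sub, ← Prod.snd_sub, ← integral_exp_div_norm_mul_planeWave hd hε, ← mul_assoc]
    congr 1
    refine integral_congr_ae (Filter.Eventually.of_forall fun ξ => ?_)
    simp only [hm, sub_neg_eq_add]
    rw [mul_assoc _ (planeWave σ p ξ)]
    congr 1
    simp only [planeWave]
    rw [← Complex.exp_add]
    congr 1
    rw [Prod.snd_add, Prod.fst_add, inner_add_left]
    push_cast
    ring

end WaveStrichartz

namespace WaveStrichartz

open scoped FourierTransform

variable {d : ℕ}

theorem norm_fourier_le_integral (f : Euc d → ℂ) (ξ : Euc d) : ‖𝓕 f ξ‖ ≤ ∫ y, ‖f y‖ :=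
  VectorFourier.norm_fourierIntegral_le_integral_norm _ _ _ f ξ

theorem continuous_fourier_of_integrable {f : Euc d → ℂ} (hf : Integrable f) : Continuous (𝓕 f) :=
  VectorFourier.fourierIntegral_continuous Real.continuous_fourierChar
    (by exact continuous_inner) hf

theorem integrable_mul_planeWave {m : Euc d → ℂ} (hm : Integrable m) (σ : ℝ) (p : ℝ × Euc d) :
    Integrable fun ξ => m ξ * planeWave σ p ξ := by
  refine hm.mul_bdd (c := 1)
    (by fun_prop : Continuous fun ξ => planeWave σ p ξ).aestronglyMeasurable
    (Filter.Eventually.of_forall fun ξ => ?_)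
  rw [norm_planeWave]

theorem integrable_exp_neg_mul_norm (hd : 1 ≤ d) {c : ℝ} (hc : 0 < c) :
    Integrable fun ξ : Euc d => rexp (-c * ‖ξ‖) := by
  have := integrable_norm_rpow_mul_exp (d := d) hd (k := 0) (by simp; omega) hc
  simpa only [Real.rpow_zero, one_mul] using this

theorem integral_lin_comb {α : Type*} [MeasurableSpace α] {μ : Measure α}
    {f₁ f₂ g₁ g₂ h₁ h₂ : α → ℂ} (hf₁ : Integrable f₁ μ) (hf₂ : Integrable f₂ μ)
    (hg₁ : Integrable g₁ μ) (hg₂ : Integrable g₂ μ) (hh₁ : Integrable h₁ μ)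
    (hh₂ : Integrable h₂ μ) (a b : ℂ) :
    a * (∫ x, f₁ x ∂μ + ∫ x, f₂ x ∂μ) + (∫ x, g₁ x ∂μ - ∫ x, g₂ x ∂μ) -
      b * (∫ x, h₁ x ∂μ - ∫ x, h₂ x ∂μ) =
    ∫ x, (a * (f₁ x + f₂ x) + (g₁ x - g₂ x) - b * (h₁ x - h₂ x)) ∂μ := by
  have h1 : Integrable (fun x => a * (f₁ x + f₂ x)) μ := (hf₁.add hf₂).const_mul a
  have h2 : Integrable (fun x => g₁ x - g₂ x) μ := hg₁.sub hg₂
  have h3 : Integrable (fun x => b * (h₁ x - h₂ x)) μ := (hh₁.sub hh₂).const_mul b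
  have h12 : Integrable (fun x => a * (f₁ x + f₂ x) + (g₁ x - g₂ x)) μ := h1.add h2
  rw [integral_sub h12 h3, integral_add h1 h2, integral_const_mul, integral_const_mul,
    integral_add hf₁ hf₂, integral_sub hg₁ hg₂, integral_sub hh₁ hh₂]

theorem approxSol_eq_integral (hd : 2 ≤ d) {ε : ℝ} (hε : 0 < ε) {φ φ' φ'' G : ℝ → Euc d → ℂ}
    (hφ : Continuous (Function.uncurry φ)) (hφ' : Continuous (Function.uncurry φ'))
    (hφ'' : Continuous (Function.uncurry φ'')) (hG : Continuous (Function.uncurry G))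
    (hderiv : ∀ t y, HasDerivAt (fun s => φ s y) (φ' t y) t)
    (hderiv' : ∀ t y, HasDerivAt (fun s => φ' s y) (φ'' t y) t) {R : ℝ}
    (hs : ∀ t y, R < ‖y‖ → φ t y = 0) (hs' : ∀ t y, R < ‖y‖ → φ' t y = 0)
    (hs'' : ∀ t y, R < ‖y‖ → φ'' t y = 0) (hsG : ∀ t y, R < ‖y‖ → G t y = 0)
    (heq : ∀ t ξ, 𝓕 (φ'' t) ξ = -((2 * π * ‖ξ‖ : ℝ) : ℂ) ^ 2 * 𝓕 (φ t) ξ - 𝓕 (G t) ξ)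
    (p : ℝ × Euc d) :
    approxSol ε (𝓕 (φ 0)) (𝓕 (φ' 0)) (Function.uncurry G) p =
      ∫ ξ, ((rexp (-(2 * π * ε) * ‖ξ‖) : ℝ) : ℂ) *
        (𝓕 (φ p.1) ξ * Complex.exp (2 * π * Complex.I * ⟪p.2, ξ⟫)) := by
  have hsl : ∀ {g : ℝ → Euc d → ℂ} (_ : Continuous (Function.uncurry g))
      (_ : ∀ t y, R < ‖y‖ → g t y = 0) (t : ℝ), Integrable (g t) := fun {g} hg hgs t => by
    refine Continuous.integrable_of_hasCompactSupport
      (hg.comp (by fun_prop : Continuous fun y => (t, y)))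
      (HasCompactSupport.intro (isCompact_closedBall 0 R) fun y hy => hgs t y (by simpa using hy))
  have hA := hsl hφ hs 0
  have hB := hsl hφ' hs' 0
  set e : Euc d → ℝ := fun ξ => rexp (-(2 * π * ε) * ‖ξ‖) with he
  have hf : ∀ σ, Integrable fun ξ => ((e ξ : ℂ) * 𝓕 (φ 0) ξ) * planeWave σ p ξ := fun σ =>
    integrable_mul_planeWave (((integrable_exp_neg_mul_norm (by omega)
      (by positivity)).ofReal).mul_bdd (continuous_fourier_of_integrable hA).aestronglyMeasurable
        (Filter.Eventually.of_forall fun ξ => norm_fourier_le_integral _ ξ)) σ p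
  have hg : ∀ σ, Integrable fun ξ =>
      ((e ξ : ℂ) * velocityProfile (𝓕 (φ' 0)) ξ) * planeWave σ p ξ := fun σ => by
    refine integrable_mul_planeWave ?_ σ p
    have h1 : Integrable fun ξ : Euc d => ((rexp (-(2 * π * ε) * ‖ξ‖) / ‖ξ‖ : ℝ) : ℂ) :=
      (integrable_exp_div_norm hd (by positivity)).ofReal
    refine ((h1.mul_bdd (continuous_fourier_of_integrable hB).aestronglyMeasurable
      (Filter.Eventually.of_forall fun ξ => norm_fourier_le_integral _ ξ)).const_mul
        (1 / (4 * π * Complex.I))).congr (Filter.Eventually.of_forall fun ξ => ?_)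
    simp only [velocityProfile, he]
    push_cast
    ring
  have hh := fun σ => halfDuhamel_eq_integral hd hε hG hsG σ p
  rw [approxSol, (hh 1).2, (hh (-1)).2]
  simp only [halfWave]
  rw [integral_lin_comb (hf 1) (hf (-1)) (hg 1) (hg (-1)) (hh 1).1 (hh (-1)).1]
  refine integral_congr_ae ?_
  filter_upwards [ae_norm_pos (d := d) (by omega)] with ξ hξ
  have hFc : Continuous fun s : ℝ => 𝓕 (G s) ξ := by
    have h := (continuous_fourier_slice hG hsG).comp (f := fun s : ℝ => (s, ξ)) (by fun_prop)
    simpa only [Function.comp_def] using h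
  have hduh : ∀ σ : ℝ, σ ^ 2 = 1 → _ := fun σ hσ =>
    duhamel_half (c := fun t => 𝓕 (φ t) ξ) (c' := fun t => 𝓕 (φ' t) ξ) (f := fun t => 𝓕 (G t) ξ)
      ((2 * π * σ * ‖ξ‖ : ℝ) : ℂ) hFc
      (fun t => hasDerivAt_fourier_slice hφ hφ' hderiv hs hs' t ξ)
      (fun t => (hasDerivAt_fourier_slice hφ' hφ'' hderiv' hs' hs'' t ξ).congr_deriv (by
        rw [heq, ← Complex.ofReal_pow, ← Complex.ofReal_pow,
          show (2 * π * σ * ‖ξ‖) ^ 2 = (2 * π * ‖ξ‖) ^ 2 * σ ^ 2 by ring, hσ, mul_one])) p.1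
  have h1 := hduh 1 (by norm_num)
  have h2 := hduh (-1) (by norm_num)
  clear hduh
  have hp : ∀ σ, planeWave σ p ξ = Complex.exp (Complex.I * ((2 * π * σ * ‖ξ‖ : ℝ) : ℂ) * p.1) *
      Complex.exp (2 * π * Complex.I * ⟪p.2, ξ⟫) := fun σ => by
    rw [planeWave, ← Complex.exp_add]
    congr 1
    push_cast
    ring
  have he' : ((rexp (-(2 * π * ε) * ‖ξ‖) : ℝ) : ℂ) = e ξ := rfl
  simp only [hp, velocityProfile, he', Complex.ofReal_div]
  set K1 := ∫ s in (0 : ℝ)..p.1,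
    Complex.exp (-(Complex.I * ((2 * π * 1 * ‖ξ‖ : ℝ) : ℂ) * s)) * 𝓕 (G s) ξ
  set K2 := ∫ s in (0 : ℝ)..p.1,
    Complex.exp (-(Complex.I * ((2 * π * (-1) * ‖ξ‖ : ℝ) : ℂ) * s)) * 𝓕 (G s) ξ
  set X := Complex.exp (2 * π * Complex.I * ⟪p.2, ξ⟫)
  set P1 := Complex.exp (Complex.I * ((2 * π * 1 * ‖ξ‖ : ℝ) : ℂ) * p.1)
  set P2 := Complex.exp (Complex.I * ((2 * π * (-1) * ‖ξ‖ : ℝ) : ℂ) * p.1)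
  generalize (e ξ : ℂ) = w
  clear_value K1 K2 X P1 P2
  have hn : ((‖ξ‖ : ℝ) : ℂ) ≠ 0 := by exact_mod_cast hξ.ne'
  have hpi : (π : ℂ) ≠ 0 := by exact_mod_cast Real.pi_ne_zero
  push_cast at h1 h2
  generalize 𝓕 (φ p.1) ξ = A at *
  generalize 𝓕 (φ' p.1) ξ = B at *
  generalize 𝓕 (φ 0) ξ = A0 at *
  generalize 𝓕 (φ' 0) ξ = B0 at *
  obtain ⟨k, hk⟩ : ∃ k : ℂ, 4 * π * Complex.I * ‖ξ‖ * k = 1 :=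
    ⟨(4 * π * Complex.I * ‖ξ‖)⁻¹, mul_inv_cancel₀ (by simp [hn, hpi])⟩
  have hk2 : 1 / (4 * π * Complex.I : ℂ) = ‖ξ‖ * k := by
    rw [div_eq_iff (by simp [hpi])]
    linear_combination -hk
  have hdiv : ∀ z : ℂ, z / (‖ξ‖ : ℂ) * ‖ξ‖ = z := fun z => div_mul_cancel₀ z hn
  rw [hk2]
  linear_combination (exp := 1) (-(w * X * k)) * (h1 - h2) + (w * X * A - 1 / 2 * w * X * A0 * (P1 + P2)) * hk +
    k * w * X * (P1 - P2) * hdiv B0 - k * (X * P1 * K1 - X * P2 * K2) * hdiv w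

end WaveStrichartz

namespace WaveStrichartz

open scoped FourierTransform Topology

variable {d : ℕ}

theorem continuous_wavePhase_left (σ τ : ℝ) : Continuous fun ε : ℝ => wavePhase ε σ τ := by
  simp only [wavePhase]
  fun_prop

theorem re_wavePhase_sq_add_sq (ε σ τ : ℝ) (hσ : σ ^ 2 = 1) (r : ℝ) :
    (wavePhase ε σ τ ^ 2 + (r : ℂ) ^ 2).re = ε ^ 2 - τ ^ 2 + r ^ 2 := by
  simp only [wavePhase, sq, Complex.add_re, Complex.mul_re, Complex.sub_re, Complex.sub_im,
    Complex.ofReal_re, Complex.ofReal_im, Complex.mul_im, Complex.I_re, Complex.I_im]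
  ring_nf
  rw [hσ]
  ring

theorem one_le_re_wavePhase_sq_add_sq (ε : ℝ) {σ τ : ℝ} (hσ : σ ^ 2 = 1) {r : ℝ}
    (hr : |τ| + 1 ≤ r) : 1 ≤ (wavePhase ε σ τ ^ 2 + (r : ℂ) ^ 2).re := by
  rw [re_wavePhase_sq_add_sq _ _ _ hσ, ← sq_abs τ]
  nlinarith [abs_nonneg τ, sq_nonneg ε]

theorem norm_cpow_wavePhase_le (ε : ℝ) {σ τ : ℝ} (hσ : σ ^ 2 = 1) {r : ℝ}
    (hr : |τ| + 1 ≤ r) {k : ℝ} (hk : 0 ≤ k) :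
    ‖(wavePhase ε σ τ ^ 2 + (r : ℂ) ^ 2) ^ (-(k : ℂ))‖ ≤ 1 := by
  have h1 := one_le_re_wavePhase_sq_add_sq ε hσ hr
  have h2 := h1.trans (Complex.re_le_norm _)
  rw [← Complex.ofReal_neg, Complex.norm_cpow_real]
  exact Real.rpow_le_one_of_one_le_of_nonpos h2 (by linarith)

theorem continuousAt_cpow_wavePhase {σ τ : ℝ} (hσ : σ ^ 2 = 1) {r : ℝ}
    (hr : |τ| + 1 ≤ r) (k : ℂ) :
    ContinuousAt (fun ε : ℝ => (wavePhase ε σ τ ^ 2 + (r : ℂ) ^ 2) ^ k) 0 := by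
  refine ContinuousAt.cpow ?_ continuousAt_const (Or.inl ?_)
  · exact (((continuous_wavePhase_left σ τ).pow 2).add continuous_const).continuousAt
  · exact lt_of_lt_of_le one_pos (one_le_re_wavePhase_sq_add_sq 0 hσ hr)

theorem norm_waveKernel_le_of_far (hd : 1 ≤ d) (ε : ℝ) {σ τ : ℝ} (hσ : σ ^ 2 = 1) {x : Euc d}
    (hx : |τ| + 1 ≤ ‖x‖) : ‖waveKernel (wavePhase ε σ τ) x‖ ≤ ‖waveConst d‖ := by
  have hd' : (1 : ℝ) ≤ d := by exact_mod_cast hd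
  have h := norm_cpow_wavePhase_le ε hσ hx (k := ((d : ℝ) - 1) / 2) (by linarith)
  push_cast at h
  rw [waveKernel, norm_mul]
  exact mul_le_of_le_one_right (norm_nonneg _) h

theorem norm_poissonKernel_le_of_far {ε : ℝ} (hε : 0 ≤ ε) (hε1 : ε ≤ 1) {σ τ : ℝ}
    (hσ : σ ^ 2 = 1) {x : Euc d} (hx : |τ| + 1 ≤ ‖x‖) :
    ‖poissonKernel (wavePhase ε σ τ) x‖ ≤ 2 * π * (1 + |τ|) * ‖besselConst d 0‖ := by
  have h := norm_cpow_wavePhase_le ε hσ hx (k := ((d : ℝ) + 1) / 2) (by positivity)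
  push_cast at h
  have hσ' : |σ| = 1 := by
    rw [← sq_abs] at hσ
    exact (pow_eq_one_iff_of_nonneg (abs_nonneg σ) two_ne_zero).1 hσ
  have ha : ‖wavePhase ε σ τ‖ ≤ 1 + |τ| := by
    rw [wavePhase]
    refine (norm_sub_le _ _).trans ?_
    rw [norm_mul, norm_mul, Complex.norm_I, mul_one, Complex.norm_real, Complex.norm_real,
      Complex.norm_real, Real.norm_of_nonneg hε, Real.norm_eq_abs, Real.norm_eq_abs,
      hσ', one_mul]
    linarith
  have h2 : ‖(2 * π : ℂ)‖ = 2 * π := by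
    rw [← Complex.ofReal_ofNat, ← Complex.ofReal_mul, Complex.norm_real,
      Real.norm_of_nonneg (by positivity)]
  rw [poissonKernel, norm_mul (2 * π * wavePhase ε σ τ), norm_mul (2 * π : ℂ), h2,
    norm_mul (besselConst d 0)]
  refine mul_le_mul ?_ (mul_le_of_le_one_right (norm_nonneg _) h) (by positivity) (by positivity)
  gcongr

theorem tendsto_waveKernel_sub {τ : ℝ} {x : Euc d} (hx : |τ| + 1 ≤ ‖x‖) :
    Filter.Tendsto (fun ε : ℝ => waveKernel (wavePhase ε 1 τ) x - waveKernel (wavePhase ε (-1) τ) x)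
      (𝓝[>] 0) (𝓝 0) := by
  have h : ContinuousAt (fun ε : ℝ =>
      waveKernel (wavePhase ε 1 τ) x - waveKernel (wavePhase ε (-1) τ) x) 0 := by
    simp only [waveKernel]
    exact ((continuousAt_cpow_wavePhase (by norm_num) hx _).const_mul _).sub
      ((continuousAt_cpow_wavePhase (by norm_num) hx _).const_mul _)
  have h0 : waveKernel (wavePhase 0 1 τ) x - waveKernel (wavePhase 0 (-1) τ) x = 0 := by
    have : wavePhase 0 1 τ ^ 2 = wavePhase 0 (-1) τ ^ 2 := by
      simp only [wavePhase]; push_cast; ring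
    rw [waveKernel, waveKernel, this, sub_self]
  have h1 := h.tendsto
  simp only [h0] at h1
  exact h1.mono_left nhdsWithin_le_nhds

theorem tendsto_poissonKernel_add {τ : ℝ} {x : Euc d} (hx : |τ| + 1 ≤ ‖x‖) :
    Filter.Tendsto
      (fun ε : ℝ => poissonKernel (wavePhase ε 1 τ) x + poissonKernel (wavePhase ε (-1) τ) x)
      (𝓝[>] 0) (𝓝 0) := by
  have hw : ∀ σ : ℝ, ContinuousAt (fun ε : ℝ => 2 * π * wavePhase ε σ τ) 0 := fun σ =>
    (continuous_const.mul (continuous_wavePhase_left σ τ)).continuousAt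
  have h : ContinuousAt (fun ε : ℝ =>
      poissonKernel (wavePhase ε 1 τ) x + poissonKernel (wavePhase ε (-1) τ) x) 0 := by
    simp only [poissonKernel]
    exact ((hw 1).mul ((continuousAt_cpow_wavePhase (by norm_num) hx _).const_mul _)).add
      ((hw (-1)).mul ((continuousAt_cpow_wavePhase (by norm_num) hx _).const_mul _))
  have h0 : poissonKernel (wavePhase 0 1 τ) x + poissonKernel (wavePhase 0 (-1) τ) x = 0 := by
    have h1 : wavePhase 0 1 τ = -wavePhase 0 (-1) τ := by
      simp only [wavePhase]; push_cast; ring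
    rw [poissonKernel, poissonKernel, h1, neg_sq]
    ring
  have h1 := h.tendsto
  simp only [h0] at h1
  exact h1.mono_left nhdsWithin_le_nhds

end WaveStrichartz

namespace WaveStrichartz

open scoped FourierTransform Topology

variable {d : ℕ}

theorem tendsto_integral_mul_zero {X : Type*} [MeasureSpace X] {g : X → ℂ} (hg : Integrable g)
    {P : ℝ → X → ℂ} (hP : ∀ ε, 0 < ε → AEStronglyMeasurable (P ε)) {C : ℝ}
    (hC : ∀ ε, 0 < ε → ε ≤ 1 → ∀ x, g x ≠ 0 → ‖P ε x‖ ≤ C)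
    (hlim : ∀ x, g x ≠ 0 → Filter.Tendsto (fun ε => P ε x) (𝓝[>] 0) (𝓝 0)) :
    Filter.Tendsto (fun ε => ∫ x, g x * P ε x) (𝓝[>] 0) (𝓝 0) := by
  have h := tendsto_integral_filter_of_dominated_convergence (μ := (volume : Measure X))
    (l := 𝓝[>] (0 : ℝ)) (F := fun ε x => g x * P ε x) (f := fun _ => (0 : ℂ))
    (fun x => ‖g x‖ * C)
    (by
      filter_upwards [self_mem_nhdsWithin] with ε hε
      exact hg.aestronglyMeasurable.mul (hP ε hε))
    (by
      filter_upwards [self_mem_nhdsWithin, nhdsWithin_le_nhds (Iic_mem_nhds one_pos)] with ε h1 h2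
      refine Filter.Eventually.of_forall fun x => ?_
      rw [norm_mul]
      by_cases hx : g x = 0
      · simp [hx]
      · exact mul_le_mul_of_nonneg_left (hC ε h1 h2 x hx) (norm_nonneg _))
    (hg.norm.mul_const C)
    (Filter.Eventually.of_forall fun x => by
      by_cases hx : g x = 0
      · simp [hx]
      · simpa using (hlim x hx).const_mul (g x))
  simpa using h

theorem continuous_poissonKernel_sub {ε : ℝ} (hε : 0 < ε) (σ τ : ℝ) (x : Euc d) :
    Continuous fun y => poissonKernel (wavePhase ε σ τ) (x - y) :=
  continuous_const.mul (continuous_const.mul (continuous_cpow_sq_add_sq continuous_const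
    (by fun_prop) (fun _ => by rwa [wavePhase_re]) _))

theorem continuous_waveKernel_sub {ε : ℝ} (hε : 0 < ε) (σ τ : ℝ) (x : Euc d) :
    Continuous fun y => waveKernel (wavePhase ε σ τ) (x - y) :=
  continuous_waveKernel continuous_const (by fun_prop) (fun _ => by rwa [wavePhase_re])

theorem integrable_mul_poissonKernel {ε : ℝ} (hε : 0 < ε) (σ τ : ℝ) (x : Euc d)
    {h : Euc d → ℂ} (hh : Integrable h) :
    Integrable fun y => h y * poissonKernel (wavePhase ε σ τ) (x - y) := by
  refine hh.mul_bdd (c := ‖2 * π * wavePhase ε σ τ‖ * (‖besselConst d 0‖ *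
    (ε ^ 2) ^ (-(((d : ℝ) + 1) / 2)))) (continuous_poissonKernel_sub hε σ τ x).aestronglyMeasurable
    (Filter.Eventually.of_forall fun y => ?_)
  have := norm_cpow_sq_add_sq_le (a := wavePhase ε σ τ) (by rwa [wavePhase_re]) ‖x - y‖
    (k := ((d : ℝ) + 1) / 2) (by positivity)
  rw [wavePhase_re] at this
  push_cast at this
  rw [poissonKernel, norm_mul (2 * π * wavePhase ε σ τ), norm_mul (besselConst d 0)]
  gcongr

theorem integrable_mul_waveKernel (hd : 1 ≤ d) {ε : ℝ} (hε : 0 < ε) (σ τ : ℝ) (x : Euc d)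
    {h : Euc d → ℂ} (hh : Integrable h) :
    Integrable fun y => h y * waveKernel (wavePhase ε σ τ) (x - y) :=
  hh.mul_bdd (continuous_waveKernel_sub hε σ τ x).aestronglyMeasurable
    (Filter.Eventually.of_forall fun y => norm_waveKernel_le hd (by rwa [wavePhase_re]) _)

theorem tendsto_integral_mul_poissonKernel {g : Euc d → ℂ} (hg : Integrable g) (p : ℝ × Euc d)
    (hfar : ∀ y, ‖p.2 - y‖ < |p.1| + 1 → g y = 0) :
    Filter.Tendsto (fun ε => ∫ y, g y * (poissonKernel (wavePhase ε 1 p.1) (p.2 - y) +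
      poissonKernel (wavePhase ε (-1) p.1) (p.2 - y))) (𝓝[>] 0) (𝓝 0) := by
  have hx : ∀ y, g y ≠ 0 → |p.1| + 1 ≤ ‖p.2 - y‖ := fun y hy => by
    by_contra h
    exact hy (hfar y (not_le.1 h))
  refine tendsto_integral_mul_zero hg (fun ε hε => ((continuous_poissonKernel_sub hε _ _ _).add
    (continuous_poissonKernel_sub hε _ _ _)).aestronglyMeasurable)
    (fun ε h1 h2 y hy => (norm_add_le _ _).trans (add_le_add
      (norm_poissonKernel_le_of_far h1.le h2 (by norm_num) (hx y hy))
      (norm_poissonKernel_le_of_far h1.le h2 (by norm_num) (hx y hy))))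
    fun y hy => tendsto_poissonKernel_add (hx y hy)

theorem tendsto_integral_mul_waveKernel (hd : 1 ≤ d) {g : Euc d → ℂ} (hg : Integrable g)
    (p : ℝ × Euc d) (hfar : ∀ y, ‖p.2 - y‖ < |p.1| + 1 → g y = 0) :
    Filter.Tendsto (fun ε => ∫ y, g y * (waveKernel (wavePhase ε 1 p.1) (p.2 - y) -
      waveKernel (wavePhase ε (-1) p.1) (p.2 - y))) (𝓝[>] 0) (𝓝 0) := by
  have hx : ∀ y, g y ≠ 0 → |p.1| + 1 ≤ ‖p.2 - y‖ := fun y hy => by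
    by_contra h
    exact hy (hfar y (not_le.1 h))
  refine tendsto_integral_mul_zero hg (fun ε hε => ((continuous_waveKernel_sub hε _ _ _).sub
    (continuous_waveKernel_sub hε _ _ _)).aestronglyMeasurable)
    (fun ε h1 h2 y hy => (norm_sub_le _ _).trans (add_le_add
      (norm_waveKernel_le_of_far hd ε (by norm_num) (hx y hy))
      (norm_waveKernel_le_of_far hd ε (by norm_num) (hx y hy))))
    fun y hy => tendsto_waveKernel_sub (hx y hy)

theorem tendsto_integral_timeWindow_mul_waveKernel (hd : 1 ≤ d) {H : ℝ × Euc d → ℂ}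
    (hH : Measurable H) (hHi : Integrable H) (p : ℝ × Euc d)
    (hfar : ∀ q, ‖p.2 - q.2‖ < |p.1 - q.1| + 1 → |q.1| ≤ |p.1| → H q = 0) :
    Filter.Tendsto (fun ε => ∫ q : ℝ × Euc d, (timeWindow p.1 q.1 : ℂ) * H q *
      (waveKernel (wavePhase ε 1 (p.1 - q.1)) (p.2 - q.2) -
      waveKernel (wavePhase ε (-1) (p.1 - q.1)) (p.2 - q.2))) (𝓝[>] 0) (𝓝 0) := by
  have hx : ∀ q : ℝ × Euc d, (timeWindow p.1 q.1 : ℂ) * H q ≠ 0 →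
      |p.1 - q.1| + 1 ≤ ‖p.2 - q.2‖ := fun q hq => by
    by_contra h
    refine hq ?_
    by_cases h1 : |q.1| ≤ |p.1|
    · rw [hfar q (not_le.1 h) h1, mul_zero]
    · rw [timeWindow_eq_zero (not_le.1 h1), Complex.ofReal_zero, zero_mul]
  have hw : Measurable fun q : ℝ × Euc d => timeWindow p.1 q.1 :=
    measurable_timeWindow.comp (by fun_prop : Measurable fun q : ℝ × Euc d => (p.1, q.1))
  have hc : ∀ ε, 0 < ε → ∀ σ, Continuous fun q : ℝ × Euc d =>
      waveKernel (wavePhase ε σ (p.1 - q.1)) (p.2 - q.2) := fun ε hε σ =>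
    continuous_waveKernel ((continuous_wavePhase ε σ).comp (by fun_prop)) (by fun_prop)
      (fun _ => by rwa [wavePhase_re])
  refine tendsto_integral_mul_zero ?_ (fun ε hε => ((hc ε hε _).sub
    (hc ε hε _)).aestronglyMeasurable)
    (fun ε h1 h2 y hy => (norm_sub_le _ _).trans (add_le_add
      (norm_waveKernel_le_of_far hd ε (by norm_num) (hx y hy))
      (norm_waveKernel_le_of_far hd ε (by norm_num) (hx y hy))))
    fun y hy => tendsto_waveKernel_sub (hx y hy)
  refine hHi.norm.mono' ((Complex.measurable_ofReal.comp hw).mul hH).aestronglyMeasurable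
    (Filter.Eventually.of_forall fun q => ?_)
  rw [norm_mul, Complex.norm_real]
  exact mul_le_of_le_one_left (norm_nonneg _) (abs_timeWindow_le _ _)

theorem integral_sub_sub_sub {X : Type*} [MeasureSpace X] {f₁ f₂ g₁ g₂ : X → ℂ}
    (hf₁ : Integrable f₁) (hf₂ : Integrable f₂) (hg₁ : Integrable g₁) (hg₂ : Integrable g₂) :
    ∫ x, (f₁ x - f₂ x - (g₁ x - g₂ x)) =
      (∫ x, f₁ x) - (∫ x, f₂ x) - ((∫ x, g₁ x) - ∫ x, g₂ x) := by
  rw [← integral_sub hf₁ hf₂, ← integral_sub hg₁ hg₂]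
  exact integral_sub (hf₁.sub hf₂) (hg₁.sub hg₂)

theorem approxSol_fourier_sub (hd : 2 ≤ d) {ε : ℝ} (hε : 0 < ε) {h₀ k₀ h₁ k₁ : Euc d → ℂ}
    (hh₀ : Integrable h₀) (hk₀ : Integrable k₀) (hh₁ : Integrable h₁) (hk₁ : Integrable k₁)
    {H K : ℝ × Euc d → ℂ} (hH : Measurable H) (hHi : Integrable H) (hK : Measurable K)
    (hKi : Integrable K) (p : ℝ × Euc d) :
    approxSol ε (𝓕 h₀) (𝓕 h₁) H p - approxSol ε (𝓕 k₀) (𝓕 k₁) K p =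
      1 / 2 * (∫ y, (h₀ y - k₀ y) * (poissonKernel (wavePhase ε 1 p.1) (p.2 - y) +
        poissonKernel (wavePhase ε (-1) p.1) (p.2 - y))) +
      1 / (4 * π * Complex.I) * (∫ y, (h₁ y - k₁ y) *
        (waveKernel (wavePhase ε 1 p.1) (p.2 - y) - waveKernel (wavePhase ε (-1) p.1) (p.2 - y))) -
      1 / (4 * π * Complex.I) * ∫ q : ℝ × Euc d, (timeWindow p.1 q.1 : ℂ) * (H q - K q) *
        (waveKernel (wavePhase ε 1 (p.1 - q.1)) (p.2 - q.2) -
          waveKernel (wavePhase ε (-1) (p.1 - q.1)) (p.2 - q.2)) := by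
  have hd1 : 1 ≤ d := by omega
  have e0 : ∫ y, (h₀ y - k₀ y) * (poissonKernel (wavePhase ε 1 p.1) (p.2 - y) +
      poissonKernel (wavePhase ε (-1) p.1) (p.2 - y)) =
      (halfWave ε 1 (𝓕 h₀) p + halfWave ε (-1) (𝓕 h₀) p) -
        (halfWave ε 1 (𝓕 k₀) p + halfWave ε (-1) (𝓕 k₀) p) := by
    have a := fun σ => integrable_mul_poissonKernel hε σ p.1 p.2 hh₀
    have b := fun σ => integrable_mul_poissonKernel hε σ p.1 p.2 hk₀
    simp only [halfWave_fourier hd1 hε _ hh₀, halfWave_fourier hd1 hε _ hk₀]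
    rw [← integral_add (a 1) (a (-1)), ← integral_add (b 1) (b (-1)),
      ← integral_sub ((a 1).fun_add (a (-1))) ((b 1).fun_add (b (-1)))]
    refine integral_congr_ae (Filter.Eventually.of_forall fun y => ?_)
    simp only
    ring
  have e1 : 1 / (4 * π * Complex.I) * (∫ y, (h₁ y - k₁ y) *
      (waveKernel (wavePhase ε 1 p.1) (p.2 - y) - waveKernel (wavePhase ε (-1) p.1) (p.2 - y))) =
      (halfWave ε 1 (velocityProfile (𝓕 h₁)) p - halfWave ε (-1) (velocityProfile (𝓕 h₁)) p) -
      (halfWave ε 1 (velocityProfile (𝓕 k₁)) p - halfWave ε (-1) (velocityProfile (𝓕 k₁)) p) := by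
    have a := fun σ => integrable_mul_waveKernel hd1 hε σ p.1 p.2 hh₁
    have b := fun σ => integrable_mul_waveKernel hd1 hε σ p.1 p.2 hk₁
    simp only [halfWave_velocityProfile_fourier hd hε _ hh₁,
      halfWave_velocityProfile_fourier hd hε _ hk₁]
    rw [← mul_sub, ← mul_sub, ← mul_sub, ← integral_sub_sub_sub (a 1) (a (-1)) (b 1) (b (-1))]
    congr 1
    refine integral_congr_ae (Filter.Eventually.of_forall fun y => ?_)
    simp only
    ring
  have e2 : ∫ q : ℝ × Euc d, (timeWindow p.1 q.1 : ℂ) * (H q - K q) *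
      (waveKernel (wavePhase ε 1 (p.1 - q.1)) (p.2 - q.2) -
        waveKernel (wavePhase ε (-1) (p.1 - q.1)) (p.2 - q.2)) =
      (halfDuhamel ε 1 H p - halfDuhamel ε (-1) H p) -
        (halfDuhamel ε 1 K p - halfDuhamel ε (-1) K p) := by
    have a := fun σ => integrable_duhamelIntegrand (σ := σ) hd1 hε hH hHi p
    have b := fun σ => integrable_duhamelIntegrand (σ := σ) hd1 hε hK hKi p
    simp only [halfDuhamel]
    rw [← integral_sub_sub_sub (a 1) (a (-1)) (b 1) (b (-1))]
    refine integral_congr_ae (Filter.Eventually.of_forall fun y => ?_)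
    simp only
    ring
  rw [e0, e1, e2]
  simp only [approxSol]
  ring

theorem tendsto_approxSol_sub (hd : 2 ≤ d) {h₀ k₀ h₁ k₁ : Euc d → ℂ}
    (hh₀ : Integrable h₀) (hk₀ : Integrable k₀) (hh₁ : Integrable h₁) (hk₁ : Integrable k₁)
    {H K : ℝ × Euc d → ℂ} (hH : Measurable H) (hHi : Integrable H) (hK : Measurable K)
    (hKi : Integrable K) (p : ℝ × Euc d)
    (hfar₀ : ∀ y, ‖p.2 - y‖ < |p.1| + 1 → h₀ y = k₀ y)
    (hfar₁ : ∀ y, ‖p.2 - y‖ < |p.1| + 1 → h₁ y = k₁ y)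
    (hfar : ∀ q, ‖p.2 - q.2‖ < |p.1 - q.1| + 1 → |q.1| ≤ |p.1| → H q = K q) :
    Filter.Tendsto (fun ε => approxSol ε (𝓕 h₀) (𝓕 h₁) H p - approxSol ε (𝓕 k₀) (𝓕 k₁) K p)
      (𝓝[>] 0) (𝓝 0) := by
  have hd1 : 1 ≤ d := by omega
  have t0 := (tendsto_integral_mul_poissonKernel (hh₀.sub hk₀) p fun y hy =>
    sub_eq_zero.2 (hfar₀ y hy)).const_mul (1 / 2)
  have t1 := (tendsto_integral_mul_waveKernel hd1 (hh₁.sub hk₁) p fun y hy =>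
    sub_eq_zero.2 (hfar₁ y hy)).const_mul (1 / (4 * π * Complex.I))
  have t2 := (tendsto_integral_timeWindow_mul_waveKernel hd1 (hH.sub hK) (hHi.sub hKi) p
    fun q h1 h2 => sub_eq_zero.2 (hfar q h1 h2)).const_mul (1 / (4 * π * Complex.I))
  have t := (t0.add t1).sub t2
  simp only [mul_zero, add_zero, sub_zero] at t
  refine t.congr' ?_
  filter_upwards [self_mem_nhdsWithin] with ε hε
  exact (approxSol_fourier_sub hd hε hh₀ hk₀ hh₁ hk₁ hH hHi hK hKi p).symm

end WaveStrichartz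

namespace WaveStrichartz

open scoped FourierTransform Topology

variable {d : ℕ}

theorem tendsto_integral_exp_mul_fourier {f : Euc d → ℂ} (hc : Continuous f) (hf : Integrable f)
    (hF : Integrable (𝓕 f)) (x : Euc d) :
    Filter.Tendsto (fun ε : ℝ => ∫ ξ, ((rexp (-(2 * π * ε) * ‖ξ‖) : ℝ) : ℂ) *
      (𝓕 f ξ * Complex.exp (2 * π * Complex.I * ⟪x, ξ⟫))) (𝓝[>] 0) (𝓝 (f x)) := by
  have h0 : ∫ ξ, 𝓕 f ξ * Complex.exp (2 * π * Complex.I * ⟪x, ξ⟫) = f x := by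
    have h := hf.fourierInv_fourier_eq hF hc.continuousAt (v := x)
    rw [← osc_eq_fourierInv] at h
    rw [← h, osc]
    simp only [real_inner_comm]
  have hcE : Continuous fun ξ : Euc d => Complex.exp (2 * π * Complex.I * ⟪x, ξ⟫) := by fun_prop
  have hn : ∀ ξ : Euc d, ‖Complex.exp (2 * π * Complex.I * ⟪x, ξ⟫)‖ = 1 := fun ξ => by
    have : (2 * π * Complex.I * ⟪x, ξ⟫ : ℂ) = ((2 * π * ⟪x, ξ⟫ : ℝ) : ℂ) * Complex.I := by
      push_cast; ring
    rw [this, Complex.norm_exp_ofReal_mul_I]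
  rw [← h0]
  refine tendsto_integral_filter_of_dominated_convergence (fun ξ => ‖𝓕 f ξ‖) ?_ ?_ hF.norm ?_
  · refine Filter.Eventually.of_forall fun ε => ?_
    exact (by fun_prop : Continuous fun ξ : Euc d =>
      ((rexp (-(2 * π * ε) * ‖ξ‖) : ℝ) : ℂ)).aestronglyMeasurable.mul
      (hF.aestronglyMeasurable.mul hcE.aestronglyMeasurable)
  · filter_upwards [self_mem_nhdsWithin] with ε hε
    refine Filter.Eventually.of_forall fun ξ => ?_
    have hε' : (0 : ℝ) < ε := hε
    rw [norm_mul, norm_mul, hn, mul_one, Complex.norm_real, Real.norm_of_nonneg (exp_pos _).le]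
    refine mul_le_of_le_one_left (norm_nonneg _) (Real.exp_le_one_iff.2 ?_)
    have : 0 ≤ 2 * π * ε * ‖ξ‖ := by positivity
    linarith
  · refine Filter.Eventually.of_forall fun ξ => ?_
    have hcε : Continuous fun ε : ℝ => ((rexp (-(2 * π * ε) * ‖ξ‖) : ℝ) : ℂ) := by fun_prop
    have h := (hcε.tendsto 0).mul_const (𝓕 f ξ * Complex.exp (2 * π * Complex.I * ⟪x, ξ⟫))
    simp only [mul_zero, neg_zero, zero_mul, Real.exp_zero, Complex.ofReal_one, one_mul] at h
    exact h.mono_left nhdsWithin_le_nhds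

end WaveStrichartz

namespace WaveStrichartz

open scoped FourierTransform SchwartzMap ContDiff Topology

variable {d : ℕ}

theorem hasDerivAt_time {v : ℝ → Euc d → ℝ} (hv : ContDiff ℝ ∞ (Function.uncurry v)) (t : ℝ)
    (x : Euc d) :
    HasDerivAt (fun s => v s x) (fderiv ℝ (Function.uncurry v) (t, x) (1, 0)) t := by
  have h1 : HasFDerivAt (Function.uncurry v) (fderiv ℝ (Function.uncurry v) (t, x)) (t, x) :=
    ((hv.differentiable (by simp)) _).hasFDerivAt
  have h2 : HasDerivAt (fun s : ℝ => (s, x)) (1, (0 : Euc d)) t :=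
    (hasDerivAt_id t).prodMk (hasDerivAt_const t x)
  exact h1.comp_hasDerivAt t h2

theorem fderiv_space {v : ℝ → Euc d → ℝ} (hv : ContDiff ℝ ∞ (Function.uncurry v)) (t : ℝ)
    (x e : Euc d) :
    fderiv ℝ (v t) x e = fderiv ℝ (Function.uncurry v) (t, x) (0, e) := by
  have h1 : HasFDerivAt (Function.uncurry v) (fderiv ℝ (Function.uncurry v) (t, x)) (t, x) :=
    ((hv.differentiable (by simp)) _).hasFDerivAt
  have h2 : HasFDerivAt (fun y : Euc d => (t, y))
      (ContinuousLinearMap.inr ℝ ℝ (Euc d)) x := hasFDerivAt_prodMk_right t x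
  have h3 : HasFDerivAt (v t) _ x := h1.comp x h2
  rw [h3.fderiv]
  simp

theorem contDiff_fderiv_uncurry {v : ℝ → Euc d → ℝ} (hv : ContDiff ℝ ∞ (Function.uncurry v))
    (w : ℝ × Euc d) : ContDiff ℝ ∞ fun p => fderiv ℝ (Function.uncurry v) p w :=
  (hv.fderiv_right (by simp)).clm_apply contDiff_const

theorem contDiff_timeDeriv {v : ℝ → Euc d → ℝ} (hv : ContDiff ℝ ∞ (Function.uncurry v)) :
    ContDiff ℝ ∞ (Function.uncurry (timeDeriv d v)) := by
  have : Function.uncurry (timeDeriv d v) =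
      fun p => fderiv ℝ (Function.uncurry v) p (1, 0) := by
    funext p
    exact (hasDerivAt_time hv p.1 p.2).deriv
  rw [this]
  exact contDiff_fderiv_uncurry hv _

theorem hasDerivAt_timeDeriv {v : ℝ → Euc d → ℝ} (hv : ContDiff ℝ ∞ (Function.uncurry v)) (t : ℝ)
    (x : Euc d) : HasDerivAt (fun s => v s x) (timeDeriv d v t x) t :=
  (hasDerivAt_time hv t x).differentiableAt.hasDerivAt

theorem timeDeriv_timeDeriv (v : ℝ → Euc d → ℝ) :
    timeDeriv d (timeDeriv d v) = timeDeriv2 d v := rfl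

theorem contDiff_spatialLap {v : ℝ → Euc d → ℝ} (hv : ContDiff ℝ ∞ (Function.uncurry v)) :
    ContDiff ℝ ∞ (Function.uncurry fun t => spatialLap d (v t)) := by
  have h1 : ∀ {w : ℝ → Euc d → ℝ} (_ : ContDiff ℝ ∞ (Function.uncurry w)) (e : Euc d),
      ContDiff ℝ ∞ (Function.uncurry fun t x => fderiv ℝ (w t) x e) := fun {w} hw e => by
    have : (Function.uncurry fun t x => fderiv ℝ (w t) x e) =
        fun p => fderiv ℝ (Function.uncurry w) p (0, e) := by
      funext p
      exact fderiv_space hw p.1 p.2 e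
    rw [this]
    exact contDiff_fderiv_uncurry hw _
  have h2 : ∀ i : Fin d, ContDiff ℝ ∞ fun p : ℝ × Euc d =>
      fderiv ℝ (fun y => fderiv ℝ (v p.1) y (EuclideanSpace.single i 1)) p.2
        (EuclideanSpace.single i 1) := fun i => h1 (h1 hv _) _
  change ContDiff ℝ ∞ fun p : ℝ × Euc d => spatialLap d (v p.1) p.2
  simp only [spatialLap]
  exact ContDiff.sum fun i _ => h2 i

theorem spatialLap_congr {f g : Euc d → ℝ} {x : Euc d} (h : f =ᶠ[𝓝 x] g) :
    spatialLap d f x = spatialLap d g x := by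
  refine Finset.sum_congr rfl fun i _ => ?_
  have : (fun y => fderiv ℝ f y (EuclideanSpace.single i 1)) =ᶠ[𝓝 x]
      fun y => fderiv ℝ g y (EuclideanSpace.single i 1) := by
    filter_upwards [h.fderiv (𝕜 := ℝ)] with y hy
    rw [hy]
  rw [this.fderiv_eq]

theorem spatialLap_const_zero (x : Euc d) : spatialLap d (fun _ => 0) x = 0 := by
  simp [spatialLap]

theorem spatialLap_eq_zero {f : Euc d → ℝ} {R : ℝ} (hs : ∀ y, R < ‖y‖ → f y = 0) {x : Euc d}
    (hx : R < ‖x‖) : spatialLap d f x = 0 := by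
  rw [← spatialLap_const_zero x]
  refine spatialLap_congr ?_
  filter_upwards [(isOpen_lt continuous_const continuous_norm).mem_nhds hx] with y hy
  exact hs y hy

theorem timeDeriv_eq_zero {v : ℝ → Euc d → ℝ} {R : ℝ} (hs : ∀ t y, R < ‖y‖ → v t y = 0)
    (t : ℝ) {x : Euc d} (hx : R < ‖x‖) : timeDeriv d v t x = 0 := by
  have : (fun s => v s x) = fun _ => 0 := funext fun s => hs s x hx
  rw [timeDeriv, this, deriv_const]

theorem contDiff_slice {v : ℝ → Euc d → ℝ} (hv : ContDiff ℝ ∞ (Function.uncurry v)) (t : ℝ) :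
    ContDiff ℝ ∞ (v t) :=
  hv.comp (contDiff_const.prodMk contDiff_id : ContDiff ℝ ∞ fun y : Euc d => (t, y))

theorem isSchwartzFn_of_supp {f : Euc d → ℝ} (hf : ContDiff ℝ ∞ f) {R : ℝ}
    (hs : ∀ y, R < ‖y‖ → f y = 0) : IsSchwartzFn d f :=
  have hc : HasCompactSupport f :=
    HasCompactSupport.intro (isCompact_closedBall 0 R) fun y hy => hs y (by simpa using hy)
  ⟨hc.toSchwartzMap hf, fun _ => rfl⟩

theorem fourier_sub_apply {f g : Euc d → ℂ} (hf : Integrable f) (hg : Integrable g) (ξ : Euc d) :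
    𝓕 (fun x => f x - g x) ξ = 𝓕 f ξ - 𝓕 g ξ := by
  simp only [Real.fourier_eq, smul_sub]
  exact integral_sub ((Real.fourierIntegral_convergent_iff ξ).2 hf)
    ((Real.fourierIntegral_convergent_iff ξ).2 hg)

theorem integrable_ofReal_slice {v : ℝ → Euc d → ℝ} (hv : Continuous (Function.uncurry v)) {R : ℝ}
    (hs : ∀ t y, R < ‖y‖ → v t y = 0) (t : ℝ) : Integrable fun x => (v t x : ℂ) :=
  ((hv.comp (by fun_prop : Continuous fun y : Euc d => (t, y))).integrable_of_hasCompactSupport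
    (HasCompactSupport.intro (isCompact_closedBall 0 R) fun y hy =>
      hs t y (by simpa using hy))).ofReal

/-- The forcing term `Δv - ∂ₜ²v` of the wave equation satisfied by `v`. -/
def forcing (v : ℝ → Euc d → ℝ) (t : ℝ) (x : Euc d) : ℝ :=
  spatialLap d (v t) x - timeDeriv2 d v t x

theorem contDiff_forcing {v : ℝ → Euc d → ℝ} (hv : ContDiff ℝ ∞ (Function.uncurry v)) :
    ContDiff ℝ ∞ (Function.uncurry (forcing v)) :=
  (contDiff_spatialLap hv).sub (contDiff_timeDeriv (contDiff_timeDeriv hv))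

theorem forcing_eq_zero {v : ℝ → Euc d → ℝ} {R : ℝ} (hs : ∀ t y, R < ‖y‖ → v t y = 0)
    (t : ℝ) {x : Euc d} (hx : R < ‖x‖) : forcing v t x = 0 := by
  rw [forcing, spatialLap_eq_zero (hs t) hx, ← timeDeriv_timeDeriv,
    timeDeriv_eq_zero (fun t y hy => timeDeriv_eq_zero hs t hy) t hx, sub_zero]

theorem tendsto_approxSol_of_supp (hd : 2 ≤ d) {v : ℝ → Euc d → ℝ}
    (hv : ContDiff ℝ ∞ (Function.uncurry v)) {R : ℝ} (hs : ∀ t y, R < ‖y‖ → v t y = 0)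
    (p : ℝ × Euc d) :
    Filter.Tendsto (fun ε => approxSol ε (𝓕 fun x => (v 0 x : ℂ))
      (𝓕 fun x => (timeDeriv d v 0 x : ℂ)) (Function.uncurry fun t x => (forcing v t x : ℂ)) p)
      (𝓝[>] 0) (𝓝 (v p.1 p.2 : ℂ)) := by
  have hv' := contDiff_timeDeriv hv
  have hv'' := contDiff_timeDeriv hv'
  have hG := contDiff_forcing hv
  have hs' : ∀ t y, R < ‖y‖ → timeDeriv d v t y = 0 := fun t y => timeDeriv_eq_zero hs t
  have hs'' : ∀ t y, R < ‖y‖ → timeDeriv2 d v t y = 0 := fun t y => timeDeriv_eq_zero hs' t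
  have hsG : ∀ t y, R < ‖y‖ → forcing v t y = 0 := fun t y => forcing_eq_zero hs t
  have hsL : ∀ t y, R < ‖y‖ → spatialLap d (v t) y = 0 := fun t y => spatialLap_eq_zero (hs t)
  have hSch : IsSchwartzFn d (v p.1) := isSchwartzFn_of_supp (contDiff_slice hv p.1) (hs p.1)
  obtain ⟨Φ, hΦ⟩ := exists_schwartzMap_complex hSch
  have hΦ' : (Φ : Euc d → ℂ) = fun x => (v p.1 x : ℂ) := funext hΦ
  have hT := tendsto_integral_exp_mul_fourier Φ.continuous Φ.integrable
    (by rw [← SchwartzMap.fourier_coe]; exact SchwartzMap.integrable _) p.2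
  rw [hΦ p.2, hΦ'] at hT
  refine hT.congr' ?_
  filter_upwards [self_mem_nhdsWithin] with ε hε
  refine (approxSol_eq_integral (φ := fun t x => (v t x : ℂ))
    (φ' := fun t x => (timeDeriv d v t x : ℂ)) (φ'' := fun t x => (timeDeriv2 d v t x : ℂ))
    (G := fun t x => (forcing v t x : ℂ)) (R := R) hd hε (Complex.continuous_ofReal.comp hv.continuous)
    (Complex.continuous_ofReal.comp hv'.continuous)
    (Complex.continuous_ofReal.comp hv''.continuous)
    (Complex.continuous_ofReal.comp hG.continuous)
    (fun t y => (hasDerivAt_timeDeriv hv t y).ofReal_comp)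
    (fun t y => (hasDerivAt_timeDeriv hv' t y).ofReal_comp)
    (fun t y hy => by rw [hs t y hy, Complex.ofReal_zero])
    (fun t y hy => by rw [hs' t y hy, Complex.ofReal_zero])
    (fun t y hy => by rw [hs'' t y hy, Complex.ofReal_zero])
    (fun t y hy => by rw [hsG t y hy, Complex.ofReal_zero]) (fun t ξ => ?_) p).symm
  rw [← fourier_spatialLap (isSchwartzFn_of_supp (contDiff_slice hv t) (hs t)),
    ← fourier_sub_apply (integrable_ofReal_slice (v := fun t => spatialLap d (v t))
      (contDiff_spatialLap hv).continuous hsL t)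
      (integrable_ofReal_slice hG.continuous hsG t)]
  have he : (fun x => (timeDeriv2 d v t x : ℂ)) =
      fun x => (spatialLap d (v t) x : ℂ) - (forcing v t x : ℂ) := by
    funext x
    simp [forcing]
  rw [he]

end WaveStrichartz

namespace WaveStrichartz

open scoped FourierTransform SchwartzMap ContDiff Topology

variable {d : ℕ}

theorem forcing_congr {u v : ℝ → Euc d → ℝ} {R : ℝ} (h : ∀ t y, ‖y‖ ≤ R → v t y = u t y) (t : ℝ)
    {x : Euc d} (hx : ‖x‖ < R) : forcing v t x = forcing u t x := by
  have h1 : spatialLap d (v t) x = spatialLap d (u t) x := by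
    refine spatialLap_congr ?_
    filter_upwards [(isOpen_lt continuous_norm continuous_const).mem_nhds hx] with y hy
    exact h t y (le_of_lt hy)
  have h2 : (fun s => v s x) = fun s => u s x := funext fun s => h s x hx.le
  rw [forcing, forcing, h1, timeDeriv2, timeDeriv2, h2]

theorem approxSol_congr {ε : ℝ} {a b : Euc d → ℂ} {H K : ℝ × Euc d → ℂ} {p : ℝ × Euc d}
    (h : ∀ q, |q.1| ≤ |p.1| → H q = K q) : approxSol ε a b H p = approxSol ε a b K p := by
  have h1 : ∀ σ, halfDuhamel ε σ H p = halfDuhamel ε σ K p := fun σ => by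
    refine integral_congr_ae (Filter.Eventually.of_forall fun q => ?_)
    by_cases hq : |q.1| ≤ |p.1|
    · simp only [h q hq]
    · simp only [timeWindow_eq_zero (not_le.1 hq), Complex.ofReal_zero, zero_mul]
  rw [approxSol, approxSol, h1, h1]

theorem isTest_indicator {g : ℝ × Euc d → ℝ} (hg : Continuous g) (R : ℝ) :
    IsTest ((Metric.closedBall (0 : ℝ × Euc d) R).indicator fun q => (g q : ℂ)) := by
  have hgc : Continuous fun q => (g q : ℂ) := Complex.continuous_ofReal.comp hg
  obtain ⟨M, hM⟩ := (isCompact_closedBall (0 : ℝ × Euc d) R).exists_bound_of_continuousOn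
    hgc.continuousOn
  refine ⟨hgc.measurable.indicator measurableSet_closedBall, ⟨max M 0, fun q => ?_⟩, ⟨R, fun q hq => ?_⟩⟩
  · by_cases hq : q ∈ Metric.closedBall (0 : ℝ × Euc d) R
    · rw [indicator_of_mem hq]
      exact (hM q hq).trans (le_max_left _ _)
    · rw [indicator_of_notMem hq, norm_zero]
      exact le_max_right _ _
  · exact indicator_of_notMem (by simpa using hq) _

theorem integrable_of_isSchwartzFn {f : Euc d → ℝ} (hf : IsSchwartzFn d f) :
    Integrable fun x => (f x : ℂ) := by
  obtain ⟨Φ, hΦ⟩ := exists_schwartzMap_complex hf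
  rw [← funext hΦ]
  exact Φ.integrable

theorem tendsto_approxSol (hd : 2 ≤ d) {u : ℝ → Euc d → ℝ}
    (hu : ContDiff ℝ ∞ (Function.uncurry u)) (hu₀ : IsSchwartzFn d (u 0))
    (hu₁ : IsSchwartzFn d fun x => timeDeriv d u 0 x) {r : ℝ} {p : ℝ × Euc d} (hp : ‖p‖ ≤ r) :
    Filter.Tendsto (fun ε => approxSol ε (𝓕 fun x => (u 0 x : ℂ))
      (𝓕 fun x => (timeDeriv d u 0 x : ℂ))
      ((Metric.closedBall (0 : ℝ × Euc d) (3 * r + 2)).indicator fun q => (forcing u q.1 q.2 : ℂ)) p)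
      (𝓝[>] 0) (𝓝 (u p.1 p.2 : ℂ)) := by
  have hr : 0 ≤ r := (norm_nonneg p).trans hp
  have hp1 : |p.1| ≤ r := (norm_fst_le p).trans hp
  have hp2 : ‖p.2‖ ≤ r := (norm_snd_le p).trans hp
  let χ : ContDiffBump (0 : Euc d) := ⟨3 * r + 2, 3 * r + 3, by linarith, by linarith⟩
  set v : ℝ → Euc d → ℝ := fun t y => χ y * u t y with hvdef
  have hv : ContDiff ℝ ∞ (Function.uncurry v) :=
    (χ.contDiff.comp contDiff_snd).mul hu
  have hvu : ∀ t y, ‖y‖ ≤ 3 * r + 2 → v t y = u t y := fun t y hy => by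
    rw [hvdef]
    simp only
    rw [χ.one_of_mem_closedBall (by simpa using hy), one_mul]
  have hs : ∀ t y, 3 * r + 3 < ‖y‖ → v t y = 0 := fun t y hy => by
    rw [hvdef]
    simp only
    rw [χ.zero_of_le_dist (by simpa using hy.le), zero_mul]
  have hs' : ∀ t y, 3 * r + 3 < ‖y‖ → timeDeriv d v t y = 0 := fun t y => timeDeriv_eq_zero hs t
  have hvu' : ∀ t y, ‖y‖ ≤ 3 * r + 2 → timeDeriv d v t y = timeDeriv d u t y := fun t y hy => by
    have : (fun s => v s y) = fun s => u s y := funext fun s => hvu s y hy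
    rw [timeDeriv, timeDeriv, this]
  have hH := isTest_indicator (contDiff_forcing hu).continuous (3 * r + 2)
  have hK := isTest_indicator (contDiff_forcing hv).continuous (3 * r + 3)
  have hfar : ∀ {y : Euc d} {s : ℝ}, |s| ≤ |p.1| → ‖p.2 - y‖ < |p.1 - s| + 1 →
      ‖y‖ < 3 * r + 2 := fun {y s} h1 h2 => by
    have h3 : ‖y‖ ≤ ‖p.2‖ + ‖p.2 - y‖ := by
      have := norm_sub_le p.2 (p.2 - y)
      rwa [sub_sub_cancel] at this
    have h4 : |p.1 - s| ≤ |p.1| + |s| := abs_sub _ _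
    linarith
  have hfar0 : ∀ y : Euc d, ‖p.2 - y‖ < |p.1| + 1 → ‖y‖ < 3 * r + 2 := fun y hy =>
    hfar (s := 0) (by simp) (by simpa using hy)
  have hsub := tendsto_approxSol_sub hd (integrable_of_isSchwartzFn hu₀)
    (integrable_ofReal_slice hv.continuous hs 0) (integrable_of_isSchwartzFn hu₁)
    (integrable_ofReal_slice (contDiff_timeDeriv hv).continuous hs' 0)
    hH.measurable hH.integrable hK.measurable hK.integrable p
    (fun y hy => by rw [hvu 0 y (hfar0 y hy).le])
    (fun y hy => by rw [hvu' 0 y (hfar0 y hy).le])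
    (fun q h1 h2 => by
      have h3 := hfar h2 h1
      have h4 : ‖q.1‖ ≤ r := h2.trans hp1
      rw [indicator_of_mem, indicator_of_mem]
      · exact congrArg Complex.ofReal (forcing_congr hvu q.1 h3).symm
      · rw [mem_closedBall_zero_iff, Prod.norm_def]
        exact max_le (by linarith) (by linarith)
      · rw [mem_closedBall_zero_iff, Prod.norm_def]
        exact max_le (by linarith) (by linarith))
  have hlim := tendsto_approxSol_of_supp hd hv hs p
  have hsum := hsub.add hlim
  rw [zero_add, hvu p.1 p.2 (by linarith)] at hsum
  refine hsum.congr fun ε => ?_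
  have hcongr : approxSol ε (𝓕 fun x => (v 0 x : ℂ)) (𝓕 fun x => (timeDeriv d v 0 x : ℂ))
      (Function.uncurry fun t x => (forcing v t x : ℂ)) p =
      approxSol ε (𝓕 fun x => (v 0 x : ℂ)) (𝓕 fun x => (timeDeriv d v 0 x : ℂ))
      ((Metric.closedBall (0 : ℝ × Euc d) (3 * r + 3)).indicator
        fun q => ((Function.uncurry (forcing v) q : ℝ) : ℂ)) p := by
    refine approxSol_congr fun q hq => ?_
    have h4 : ‖q.1‖ ≤ r := hq.trans hp1
    by_cases hq2 : ‖q.2‖ ≤ 3 * r + 3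
    · rw [indicator_of_mem]
      · rfl
      · rw [mem_closedBall_zero_iff, Prod.norm_def]
        exact max_le (by linarith) hq2
    · have h0 : forcing v q.1 q.2 = 0 := forcing_eq_zero hs q.1 (not_le.1 hq2)
      have h5 : Function.uncurry (forcing v) q = 0 := h0
      have h6 : (Function.uncurry fun t x => (forcing v t x : ℂ)) q = 0 := by
        rw [← Complex.ofReal_zero, ← h0]; rfl
      rw [h6]
      simp only [indicator, h5, Complex.ofReal_zero, ite_self]
  rw [hcongr]
  exact sub_add_cancel _ _

end WaveStrichartz

namespace WaveStrichartz

open scoped FourierTransform SchwartzMap ContDiff Topology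

variable {d : ℕ}


theorem sobolevNorm_spec {s : ℝ} {f : Euc d → ℝ} (hf : IsSchwartzFn d f)
    (hfin : sobolevNorm d s f ≠ ⊤) :
    Integrable (fun ξ => ‖ξ‖ ^ (2 * s) * ‖𝓕 (fun x => (f x : ℂ)) ξ‖ ^ 2) ∧
      sobolevNorm d s f = ENNReal.ofReal
        ((∫ ξ, ‖ξ‖ ^ (2 * s) * ‖𝓕 (fun x => (f x : ℂ)) ξ‖ ^ 2) ^ (1 / 2 : ℝ)) := by
  have hm : Measurable fun ξ : Euc d => ‖ξ‖ ^ (2 * s) * ‖𝓕 (fun x => (f x : ℂ)) ξ‖ ^ 2 :=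
    (measurable_norm.pow_const (2 * s)).mul
      ((continuous_fourier_of_integrable (integrable_of_isSchwartzFn hf)).norm.pow 2).measurable
  have h0 : ∀ ξ : Euc d, 0 ≤ ‖ξ‖ ^ (2 * s) * ‖𝓕 (fun x => (f x : ℂ)) ξ‖ ^ 2 := fun ξ => by
    positivity
  have hfin' : ∫⁻ ξ : Euc d, ENNReal.ofReal
      (‖ξ‖ ^ (2 * s) * ‖𝓕 (fun x => (f x : ℂ)) ξ‖ ^ 2) ≠ ⊤ := fun h => by
    apply hfin
    rw [sobolevNorm, h]
    exact ENNReal.top_rpow_of_pos (by norm_num)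
  have hi : Integrable fun ξ : Euc d => ‖ξ‖ ^ (2 * s) * ‖𝓕 (fun x => (f x : ℂ)) ξ‖ ^ 2 :=
    (lintegral_ofReal_ne_top_iff_integrable hm.aestronglyMeasurable
      (Filter.Eventually.of_forall h0)).1 hfin'
  refine ⟨hi, ?_⟩
  rw [sobolevNorm, ← ofReal_integral_eq_lintegral_ofReal hi (Filter.Eventually.of_forall h0),
    ENNReal.ofReal_rpow_of_nonneg (integral_nonneg h0) (by norm_num)]

theorem ofReal_integral_norm_rpow_indicator_le {g : ℝ × Euc d → ℝ} (hg : Continuous g) (R : ℝ)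
    {q : ℝ} (hq : 0 < q) :
    ENNReal.ofReal ((∫ p, ‖(Metric.closedBall (0 : ℝ × Euc d) R).indicator
      (fun p => (g p : ℂ)) p‖ ^ q) ^ (1 / q)) ≤ eLpNorm g (ENNReal.ofReal q) volume := by
  have hgc : Continuous fun q => (g q : ℂ) := Complex.continuous_ofReal.comp hg
  obtain ⟨M, hM⟩ := (isCompact_closedBall (0 : ℝ × Euc d) R).exists_bound_of_continuousOn
    hgc.continuousOn
  have : IsFiniteMeasure ((volume : Measure (ℝ × Euc d)).restrict (Metric.closedBall 0 R)) :=
    ⟨by simpa using (isCompact_closedBall (0 : ℝ × Euc d) R).measure_lt_top⟩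
  have hmem : MemLp ((Metric.closedBall (0 : ℝ × Euc d) R).indicator fun p => (g p : ℂ))
      (ENNReal.ofReal q) volume :=
    (memLp_indicator_iff_restrict measurableSet_closedBall).2
      (MemLp.of_bound hgc.aestronglyMeasurable M
        (ae_restrict_of_forall_mem measurableSet_closedBall hM))
  have h := hmem.eLpNorm_eq_integral_rpow_norm (by simpa using hq) ENNReal.ofReal_ne_top
  rw [ENNReal.toReal_ofReal hq.le, ← one_div] at h
  rw [← h]
  refine eLpNorm_mono fun p => ?_
  refine (norm_indicator_le_norm_self _ _).trans ?_
  rw [Complex.norm_real]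

theorem eLpNorm_le_of_forall_closedBall {g : ℝ × Euc d → ℝ} (hg : Measurable g) {q B : ℝ≥0∞}
    (h : ∀ r : ℝ, eLpNorm g q (volume.restrict (Metric.closedBall 0 r)) ≤ B) :
    eLpNorm g q volume ≤ B := by
  refine Lp.eLpNorm_le_of_ae_tendsto (u := Filter.atTop (α := ℕ))
    (f := fun n => (Metric.closedBall (0 : ℝ × Euc d) (n : ℝ)).indicator g)
    (Filter.Eventually.of_forall fun n => ?_)
    (fun n => (hg.indicator measurableSet_closedBall).aestronglyMeasurable)
    (Filter.Eventually.of_forall fun p => ?_)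
  · rw [eLpNorm_indicator_eq_eLpNorm_restrict measurableSet_closedBall]
    exact h n
  · refine tendsto_const_nhds.congr' ?_
    filter_upwards [Filter.eventually_ge_atTop ⌈‖p‖⌉₊] with n hn
    rw [indicator_of_mem]
    rw [mem_closedBall_zero_iff]
    exact Nat.ceil_le.1 hn

theorem exists_spacetimeNorm_le (hd : 2 ≤ d) :
    ∃ C : ℝ, 0 < C ∧
      ∀ u F : ℝ → Euc d → ℝ,
        ContDiff ℝ ∞ (Function.uncurry u) →
        IsSchwartzFn d (u 0) → IsSchwartzFn d (fun x => timeDeriv d u 0 x) →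
        (∀ t x, timeDeriv2 d u t x - spatialLap d (u t) x + F t x = 0) →
        spacetimeNorm d (ENNReal.ofReal (2 * ((d : ℝ) + 1) / ((d : ℝ) - 1))) u ≤
          ENNReal.ofReal C *
            (sobolevNorm d (1 / 2) (u 0) +
              sobolevNorm d (-(1 / 2)) (fun x => timeDeriv d u 0 x) +
              spacetimeNorm d (ENNReal.ofReal (2 * ((d : ℝ) + 1) / ((d : ℝ) + 3))) F) := by
  obtain ⟨C, hC, hmain⟩ := exists_eLpNorm_approxSol_le hd
  refine ⟨C + 1, by linarith, fun u F hu hu₀ hu₁ heq => ?_⟩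
  have hC1 : ENNReal.ofReal (C + 1) ≠ 0 := by
    rw [ne_eq, ENNReal.ofReal_eq_zero]
    linarith
  by_cases hf₀ : sobolevNorm d (1 / 2) (u 0) = ⊤
  · rw [hf₀, top_add, top_add, ENNReal.mul_top hC1]
    exact le_top
  by_cases hf₁ : sobolevNorm d (-(1 / 2)) (fun x => timeDeriv d u 0 x) = ⊤
  · rw [hf₁, add_top, top_add, ENNReal.mul_top hC1]
    exact le_top
  obtain ⟨i₀, e₀⟩ := sobolevNorm_spec hu₀ hf₀
  obtain ⟨i₁, e₁⟩ := sobolevNorm_spec hu₁ hf₁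
  have s₀ : ∀ ξ : Euc d, ‖ξ‖ ^ (2 * (1 / 2) : ℝ) * ‖𝓕 (fun x => (u 0 x : ℂ)) ξ‖ ^ 2 =
      ‖ξ‖ * ‖𝓕 (fun x => (u 0 x : ℂ)) ξ‖ ^ 2 := fun ξ => by norm_num
  have s₁ : ∀ ξ : Euc d,
      ‖ξ‖ ^ (2 * -(1 / 2) : ℝ) * ‖𝓕 (fun x => (timeDeriv d u 0 x : ℂ)) ξ‖ ^ 2 =
      ‖𝓕 (fun x => (timeDeriv d u 0 x : ℂ)) ξ‖ ^ 2 / ‖ξ‖ := fun ξ => by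
    rw [show (2 * -(1 / 2) : ℝ) = -1 by norm_num, Real.rpow_neg_one, div_eq_inv_mul]
  simp only [s₀] at i₀ e₀
  simp only [s₁] at i₁ e₁
  have m₀ := (continuous_fourier_of_integrable
    (integrable_of_isSchwartzFn hu₀)).aestronglyMeasurable (μ := (volume : Measure (Euc d)))
  have m₁ := (continuous_fourier_of_integrable
    (integrable_of_isSchwartzFn hu₁)).aestronglyMeasurable (μ := (volume : Measure (Euc d)))
  have hF : Function.uncurry F = fun q => forcing u q.1 q.2 := funext fun q => by
    have := heq q.1 q.2
    simp only [Function.uncurry, forcing]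
    linarith
  have hG : Continuous fun q : ℝ × Euc d => forcing u q.1 q.2 := (contDiff_forcing hu).continuous
  refine eLpNorm_le_of_forall_closedBall hu.continuous.measurable fun r => ?_
  set H : ℝ × Euc d → ℂ := (Metric.closedBall (0 : ℝ × Euc d) (3 * r + 2)).indicator
    fun q => (forcing u q.1 q.2 : ℂ) with hHdef
  have hH : IsTest H := isTest_indicator hG _
  have hlim : eLpNorm (fun q : ℝ × Euc d => (u q.1 q.2 : ℂ))
      (ENNReal.ofReal (2 * ((d : ℝ) + 1) / ((d : ℝ) - 1)))
      (volume.restrict (Metric.closedBall 0 r)) ≤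
      ENNReal.ofReal (C * ((∫ ξ, ‖ξ‖ * ‖𝓕 (fun x => (u 0 x : ℂ)) ξ‖ ^ 2) ^ (1 / 2 : ℝ) +
        (∫ ξ, ‖𝓕 (fun x => (timeDeriv d u 0 x : ℂ)) ξ‖ ^ 2 / ‖ξ‖) ^ (1 / 2 : ℝ) +
          (∫ p, ‖H p‖ ^ dualExp d) ^ (1 / dualExp d))) := by
    refine Lp.eLpNorm_le_of_ae_tendsto (u := 𝓝[>] (0 : ℝ)) (f := fun ε => (Ioi (0 : ℝ)).indicator
      (fun ε => approxSol ε (𝓕 fun x => (u 0 x : ℂ))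
      (𝓕 fun x => (timeDeriv d u 0 x : ℂ)) H) ε) ?_ ?_ ?_
    · filter_upwards [self_mem_nhdsWithin] with ε hε
      rw [indicator_of_mem hε]
      exact hmain ε hε _ _ m₀ m₁ i₀ i₁ H hH r
    · intro ε
      by_cases hε : ε ∈ Ioi (0 : ℝ)
      · rw [indicator_of_mem hε]
        exact (measurable_approxSol hd hε m₀ m₁ i₀ i₁ hH.measurable).aestronglyMeasurable
      · rw [indicator_of_notMem hε]
        exact aestronglyMeasurable_const
    · refine ae_restrict_of_forall_mem measurableSet_closedBall fun p hp => ?_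
      refine (tendsto_approxSol hd hu hu₀ hu₁ (mem_closedBall_zero_iff.1 hp)).congr' ?_
      filter_upwards [self_mem_nhdsWithin] with ε hε
      rw [indicator_of_mem hε]
  have hu' : eLpNorm (Function.uncurry u) (ENNReal.ofReal (2 * ((d : ℝ) + 1) / ((d : ℝ) - 1)))
      (volume.restrict (Metric.closedBall 0 r)) = eLpNorm (fun q : ℝ × Euc d => (u q.1 q.2 : ℂ))
      (ENNReal.ofReal (2 * ((d : ℝ) + 1) / ((d : ℝ) - 1)))
      (volume.restrict (Metric.closedBall 0 r)) :=
    eLpNorm_congr_norm_ae (Filter.Eventually.of_forall fun q => (Complex.norm_real _).symm)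
  rw [hu']
  refine hlim.trans ?_
  have hHF := ofReal_integral_norm_rpow_indicator_le hG (3 * r + 2) (dualExp_pos d)
  rw [← hF] at hHF
  rw [e₀, e₁, ENNReal.ofReal_mul hC, ENNReal.ofReal_add (by positivity) (by positivity),
    ENNReal.ofReal_add (by positivity) (by positivity)]
  refine mul_le_mul' (ENNReal.ofReal_le_ofReal (by linarith)) (add_le_add le_rfl hHF)

end WaveStrichartz

/-- **The conformal Strichartz estimate** (Strichartz).
Let `d ≥ 2` and let `u : ℝ × ℝ^d → ℝ` be smooth, with each time slice of `u`, `∂ₜu` and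
`F` Schwartz in `x`, satisfying `∂ₜ²u − Δu + F = 0`. Then
`‖u‖_{L^{2(d+1)/(d−1)}_{t,x}} ≤ C(d) (‖u(0)‖_{Ḣ^{1/2}} + ‖∂ₜu(0)‖_{Ḣ^{−1/2}}
+ ‖F‖_{L^{2(d+1)/(d+3)}_{t,x}})`. -/
theorem conformal_strichartz_estimate (d : ℕ) (hd : 2 ≤ d) :
    ∃ C : ℝ, 0 < C ∧
      ∀ u F : ℝ → Euc d → ℝ,
        ContDiff ℝ (⊤ : ℕ∞) (Function.uncurry u) →
        (∀ t, IsSchwartzFn d (u t)) →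
        (∀ t, IsSchwartzFn d (fun x => timeDeriv d u t x)) →
        (∀ t, IsSchwartzFn d (F t)) →
        (∀ t x, timeDeriv2 d u t x - spatialLap d (u t) x + F t x = 0) →
        spacetimeNorm d (ENNReal.ofReal (2 * ((d : ℝ) + 1) / ((d : ℝ) - 1))) u ≤
          ENNReal.ofReal C *
            (sobolevNorm d (1 / 2) (u 0) +
              sobolevNorm d (-(1 / 2)) (fun x => timeDeriv d u 0 x) +
              spacetimeNorm d (ENNReal.ofReal (2 * ((d : ℝ) + 1) / ((d : ℝ) + 3))) F) := by
  obtain ⟨C, hC, h⟩ := WaveStrichartz.exists_spacetimeNorm_le hd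
  exact ⟨C, hC, fun u F hu hu₀ hu₁ _ heq => h u F hu (hu₀ 0) (hu₁ 0) heq⟩
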